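/- Let D1 and D2 be good drawings of K_n in the sphere with the same rotation scheme, and let u, v, w, x be distinct vertices. The closed disc bounded by the 3-cycle on u, v, w (D_α restricted to the triangle uvw is a simple closed curve) that contains x is the same in both drawings, in the sense determined by the rotation scheme: x lies on the side where the majority of the initial segments of edges xu, xv, xw attach. -/

import Mathlib

open Set unitInterval

noncomputable section

/-- The 2-sphere, realized as the unit sphere in `ℝ³`. -/
abbrev Sph : Type := ↥(Metric.sphere (0 : EuclideanSpace ℝ (Fin 3)) 1)

/-- A drawing of the complete graph `K_n` in the sphere: an injective placement of the
vertices together with, for each ordered pair of distinct vertices, a simple arc joining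
them (the same arc in both directions), meeting the vertex set only at its endpoints. -/
structure SphereDrawing (n : ℕ) where
  vert : Fin n → Sph
  vert_inj : Function.Injective vert
  edge : ∀ i j : Fin n, i ≠ j → Path (vert i) (vert j)
  edge_symm : ∀ (i j : Fin n) (h : i ≠ j), edge j i h.symm = (edge i j h).symm
  edge_inj : ∀ (i j : Fin n) (h : i ≠ j), Function.Injective ⇑(edge i j h)
  edge_vert : ∀ (i j : Fin n) (h : i ≠ j),
    Set.range ⇑(edge i j h) ∩ Set.range vert = {vert i, vert j}

namespace SphereDrawing

variable {n : ℕ}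

/-- The point set of the edge between `i` and `j` (empty if `i = j`). -/
def arc (D : SphereDrawing n) (i j : Fin n) : Set Sph :=
  ⋃ h : i ≠ j, Set.range ⇑(D.edge i j h)

/-- The open interior of an edge: its point set minus all vertices. -/
def inner (D : SphereDrawing n) (i j : Fin n) : Set Sph :=
  D.arc i j \ Set.range D.vert

/-- A good drawing: no two edges with a common end cross; no two (independent) edges
cross more than once; and no three edges pass through a common non-vertex point. -/
structure IsGood (D : SphereDrawing n) : Prop where
  adj : ∀ i j k : Fin n, j ≠ k → D.inner i j ∩ D.inner i k = ∅
  indep : ∀ i j k l : Fin n, ([i, j, k, l] : List (Fin n)).Nodup →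
    (D.inner i j ∩ D.inner k l).Subsingleton
  no_triple : ∀ p : Sph, p ∉ Set.range D.vert →
    {s : Fin n × Fin n | s.1 < s.2 ∧ p ∈ D.arc s.1 s.2}.encard ≤ 2

/-- Independent edges `ij` and `kl` cross: their interiors meet. -/
def Cross (D : SphereDrawing n) (i j k l : Fin n) : Prop :=
  (D.inner i j ∩ D.inner k l).Nonempty

end SphereDrawing

/-- A self-homeomorphism of the sphere is orientation preserving iff it is homotopic to
the identity (i.e. has degree `1`). -/
def OrientPres (h : Sph ≃ₜ Sph) : Prop :=
  ContinuousMap.Homotopic ⟨⇑h, h.continuous⟩ (ContinuousMap.id Sph)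

/-- Two drawings of `K_n` have the same rotation at `v` if some orientation-preserving
homeomorphism of the sphere carries the first drawing's germ at `v` (the vertex together
with initial pieces of all incident edges) into the second drawing's edges at `v`. -/
def SameRotationAt (D1 D2 : SphereDrawing n) (v : Fin n) : Prop :=
  ∃ h : Sph ≃ₜ Sph, OrientPres h ∧ h (D1.vert v) = D2.vert v ∧
    ∃ U ∈ nhds (D1.vert v), ∀ u : Fin n, u ≠ v →
      h '' (D1.arc v u ∩ U) ⊆ D2.arc v u

/-- Same rotation scheme: the same rotation at every vertex. -/
def SameRotation {n : ℕ} (D1 D2 : SphereDrawing n) : Prop :=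
  ∀ v : Fin n, SameRotationAt D1 D2 v

/-- The edge from `i` to `j` initially enters the set `Δ`: some initial open piece of the
edge (just after leaving `D.vert i`) lies in `Δ`. -/
def EntersInit {n : ℕ} (D : SphereDrawing n) (i j : Fin n) (hij : i ≠ j)
    (Δ : Set Sph) : Prop :=
  ∃ ε : ℝ, 0 < ε ∧ ∀ t : unitInterval, 0 < (t : ℝ) → (t : ℝ) < ε →
    (D.edge i j hij) t ∈ Δ

/-- The simple closed curve that is the image of the triangle `uvw`. -/
def SphereDrawing.tri {n : ℕ} (D : SphereDrawing n) (u v w : Fin n) : Set Sph :=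
  D.arc u v ∪ D.arc v w ∪ D.arc u w

section PlaneLogs
open Filter Topology Metric

/-- `f` admits a continuous logarithm on `K`. -/
def HasLog {X : Type*} [TopologicalSpace X] (f : X → ℂ) (K : Set X) : Prop :=
  ∃ g : X → ℂ, ContinuousOn g K ∧ ∀ z ∈ K, Complex.exp (g z) = f z

theorem HasLog.mono {X : Type*} [TopologicalSpace X] {f : X → ℂ} {K L : Set X}
    (h : HasLog f L) (hKL : K ⊆ L) : HasLog f K :=
  let ⟨g, hg, he⟩ := h
  ⟨g, hg.mono hKL, fun z hz => he z (hKL hz)⟩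

theorem HasLog.congr {X : Type*} [TopologicalSpace X] {f f' : X → ℂ} {K : Set X}
    (h : HasLog f K) (hff : ∀ z ∈ K, f z = f' z) : HasLog f' K :=
  let ⟨g, hg, he⟩ := h
  ⟨g, hg, fun z hz => (he z hz).trans (hff z hz)⟩

theorem HasLog.mul {X : Type*} [TopologicalSpace X] {f f' : X → ℂ} {K : Set X}
    (h : HasLog f K) (h' : HasLog f' K) : HasLog (fun z => f z * f' z) K :=
  let ⟨g, hg, he⟩ := h
  let ⟨g', hg', he'⟩ := h'
  ⟨fun z => g z + g' z, hg.add hg', fun z hz => by rw [Complex.exp_add, he z hz, he' z hz]⟩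

theorem HasLog.inv {X : Type*} [TopologicalSpace X] {f : X → ℂ} {K : Set X}
    (h : HasLog f K) : HasLog (fun z => (f z)⁻¹) K :=
  let ⟨g, hg, he⟩ := h
  ⟨fun z => -g z, hg.neg, fun z hz => by rw [Complex.exp_neg, he z hz]⟩

theorem HasLog.zpow {X : Type*} [TopologicalSpace X] {f : X → ℂ} {K : Set X}
    (h : HasLog f K) (n : ℤ) : HasLog (fun z => f z ^ n) K :=
  let ⟨g, hg, he⟩ := h
  ⟨fun z => n * g z, continuousOn_const.mul hg,
    fun _ hz => by rw [Complex.exp_int_mul, he _ hz]⟩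

theorem HasLog.div {X : Type*} [TopologicalSpace X] {f f' : X → ℂ} {K : Set X}
    (h : HasLog f K) (h' : HasLog f' K) : HasLog (fun z => f z / f' z) K :=
  (h.mul h'.inv).congr fun _ _ => (div_eq_mul_inv _ _).symm

theorem HasLog.comp {X Y : Type*} [TopologicalSpace X] [TopologicalSpace Y] {f : X → ℂ}
    {K : Set X} (h : HasLog f K) {u : Y → X} {L : Set Y} (hu : ContinuousOn u L)
    (hm : MapsTo u L K) : HasLog (fun y => f (u y)) L :=
  let ⟨g, hg, he⟩ := h
  ⟨fun y => g (u y), hg.comp hu hm, fun _ hy => he _ (hm hy)⟩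

theorem HasLog.of_slitPlane {X : Type*} [TopologicalSpace X] {f : X → ℂ} {K : Set X}
    (hf : ContinuousOn f K) (hs : ∀ z ∈ K, f z ∈ Complex.slitPlane) : HasLog f K :=
  ⟨fun z => Complex.log (f z), hf.clog hs,
    fun z hz => Complex.exp_log (Complex.slitPlane_ne_zero (hs z hz))⟩

theorem HasLog.const {X : Type*} [TopologicalSpace X] {c : ℂ} (hc : c ≠ 0) (K : Set X) :
    HasLog (fun _ => c) K :=
  ⟨fun _ => Complex.log c, continuousOn_const, fun _ _ => Complex.exp_log hc⟩

/-- Logarithms can be transported along homotopies of nonvanishing functions. -/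
theorem exists_log_of_homotopy {A : Type*} [TopologicalSpace A] {H : I × A → ℂ}
    (hH : Continuous H) (h0 : ∀ x, H x ≠ 0) {g₀ : A → ℂ} (hg : Continuous g₀)
    (he : ∀ a, Complex.exp (g₀ a) = H (0, a)) :
    ∃ g : A → ℂ, Continuous g ∧ ∀ a, Complex.exp (g a) = H (1, a) := by
  let H' : C(I × A, {z : ℂ // z ≠ 0}) := ⟨fun x => ⟨H x, h0 x⟩, hH.subtype_mk _⟩
  have h00 : ∀ a, H' (0, a) =
      (fun z : ℂ ↦ (⟨_, z.exp_ne_zero⟩ : {z : ℂ // z ≠ 0})) ((⟨g₀, hg⟩ : C(A, ℂ)) a) :=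
    fun a => Subtype.ext (he a).symm
  let L := Complex.isCoveringMap_exp.liftHomotopy H' ⟨g₀, hg⟩ h00
  refine ⟨fun a => L (1, a), by fun_prop, fun a => ?_⟩
  have := congrFun (Complex.isCoveringMap_exp.liftHomotopy_lifts H' ⟨g₀, hg⟩ h00) (1, a)
  exact congrArg Subtype.val this

theorem HasLog.of_homotopy {X : Type*} [TopologicalSpace X] {K : Set X} {H : I → X → ℂ}
    (hH : ContinuousOn (fun p : I × X => H p.1 p.2) (univ ×ˢ K))
    (h0 : ∀ t, ∀ x ∈ K, H t x ≠ 0) (hl : HasLog (H 0) K) : HasLog (H 1) K := by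
  classical
  obtain ⟨g₀, hg, he⟩ := hl
  obtain ⟨g, hg, he⟩ := exists_log_of_homotopy (A := K) (H := fun p => H p.1 p.2)
    (hH.comp_continuous (f := fun p : I × K => (p.1, (p.2 : X))) (by fun_prop)
      fun p => ⟨mem_univ _, p.2.2⟩)
    (fun p => h0 p.1 _ p.2.2) (g₀ := fun a => g₀ a) (continuousOn_iff_continuous_domRestrict.1 hg)
    (fun a => he a a.2)
  refine ⟨fun x => if hx : x ∈ K then g ⟨x, hx⟩ else 0, ?_, fun x hx => ?_⟩
  · rw [continuousOn_iff_continuous_domRestrict]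
    convert hg using 1
    ext x
    simp
  · simp only [hx, dite_true]
    exact he ⟨x, hx⟩

/-- A nonvanishing continuous function on the plane has a logarithm. -/
theorem HasLog.of_continuous {f : ℂ → ℂ} (hf : Continuous f) (h0 : ∀ z, f z ≠ 0) :
    HasLog f univ := by
  have := HasLog.of_homotopy (K := (univ : Set ℂ)) (H := fun t z => f ((t : ℝ) * z))
    (by fun_prop) (fun t x _ => h0 _) ((HasLog.const (h0 0) univ).congr fun z _ => by simp)
  exact this.congr fun z _ => by simp

/-- A nonvanishing function on an interval has a logarithm. -/
theorem HasLog.of_unitInterval {f : I → ℂ} (hf : Continuous f) (h0 : ∀ z, f z ≠ 0) :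
    HasLog f univ := by
  have := HasLog.of_homotopy (K := (univ : Set I)) (H := fun t z => f (t * z))
    (by fun_prop) (fun t x _ => h0 _) ((HasLog.const (h0 0) univ).congr fun z _ => by simp)
  exact this.congr fun z _ => by simp

/-- A continuous function on a preconnected set with trivial exponential increments is constant. -/
theorem exp_eq_imp_const {X : Type*} [TopologicalSpace X] {K : Set X} (hK : IsPreconnected K)
    {g : X → ℂ} (hg : ContinuousOn g K) {c : ℂ} (he : ∀ z ∈ K, Complex.exp (g z) = c)
    {x y : X} (hx : x ∈ K) (hy : y ∈ K) : g x = g y := by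
  have : ∀ z ∈ K, ∃ n : ℤ, g z - g x = n * (2 * Real.pi * Complex.I) := fun z hz => by
    obtain ⟨n, hn⟩ := Complex.exp_eq_exp_iff_exists_int.1 ((he z hz).trans (he x hx).symm)
    exact ⟨n, by rw [hn]; ring⟩
  have hpi : (2 * Real.pi * Complex.I) ≠ 0 := Complex.two_pi_I_ne_zero
  let u : X → ℝ := fun z => ((g z - g x) / (2 * Real.pi * Complex.I)).re
  have hu : ContinuousOn u K :=
    Complex.continuous_re.comp_continuousOn ((hg.sub continuousOn_const).div_const _)
  have hun : ∀ z ∈ K, ∃ n : ℤ, u z = n ∧ g z - g x = n * (2 * Real.pi * Complex.I) :=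
    fun z hz => by
      obtain ⟨n, hn⟩ := this z hz
      exact ⟨n, by simp only [u]; rw [hn, mul_div_cancel_right₀ _ hpi]; simp, hn⟩
  have himg : IsPreconnected (u '' K) := hK.image u hu
  have hsub : (u '' K).Subsingleton := by
    have hss : u '' K ⊆ range ((↑) : ℤ → ℝ) := by
      rintro _ ⟨z, hz, rfl⟩
      obtain ⟨n, hn, -⟩ := hun z hz
      exact ⟨n, hn.symm⟩
    obtain ⟨s, hs⟩ := subset_range_iff_exists_image_eq.1 hss
    rw [← hs] at himg ⊢
    have := (Int.isClosedEmbedding_coe_real.isEmbedding.toIsInducing.isPreconnected_image).1 himg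
    exact this.subsingleton.image _
  have hxy : u x = u y := hsub (mem_image_of_mem u hx) (mem_image_of_mem u hy)
  obtain ⟨n, hn, hn'⟩ := hun y hy
  have hx0 : u x = 0 := by simp [u]
  have : (n : ℝ) = 0 := by rw [← hn, ← hxy, hx0]
  have : n = 0 := by exact_mod_cast this
  subst this
  simp at hn'
  exact (sub_eq_zero.1 hn').symm

/-- Logarithms on two closed sets, or two open sets, with connected intersection can be glued. -/
theorem HasLog.union {X : Type*} [TopologicalSpace X] {f : X → ℂ} {A B : Set X}
    (hAB : (IsClosed A ∧ IsClosed B) ∨ (IsOpen A ∧ IsOpen B)) (hc : IsPreconnected (A ∩ B))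
    (hA : HasLog f A) (hB : HasLog f B) : HasLog f (A ∪ B) := by
  classical
  obtain ⟨g, hg, he⟩ := hA
  obtain ⟨g', hg', he'⟩ := hB
  obtain ⟨c, hc1, hcd⟩ : ∃ c, Complex.exp c = 1 ∧ ∀ z ∈ A ∩ B, g z = g' z + c := by
    rcases (A ∩ B).eq_empty_or_nonempty with h | ⟨x, hx⟩
    · exact ⟨0, by simp, by simp [h]⟩
    · have hd : ∀ z ∈ A ∩ B, Complex.exp (g z - g' z) = 1 := fun z hz => by
        rw [Complex.exp_sub, he z hz.1, he' z hz.2, div_self]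
        rw [← he z hz.1]; exact Complex.exp_ne_zero _
      refine ⟨g x - g' x, hd x hx, fun z hz => ?_⟩
      have := exp_eq_imp_const hc ((hg.mono inter_subset_left).sub (hg'.mono inter_subset_right))
        hd hz hx
      simp only [Pi.sub_apply] at this
      rw [← this]; ring
  let F : X → ℂ := fun z => if z ∈ A then g z else g' z + c
  have hFA : EqOn F g A := fun z hz => if_pos hz
  have hFB : EqOn F (fun z => g' z + c) B := fun z hz => by
    by_cases h : z ∈ A
    · simp only [F, h, if_true]; exact hcd z ⟨h, hz⟩
    · simp only [F, h, if_false]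
  have hF1 : ContinuousOn F A := hg.congr hFA
  have hF2 : ContinuousOn F B := (hg'.add continuousOn_const).congr hFB
  refine ⟨F, ?_, ?_⟩
  · rcases hAB with ⟨h1, h2⟩ | ⟨h1, h2⟩
    · exact hF1.union_of_isClosed hF2 h1 h2
    · exact hF1.union_of_isOpen hF2 h1 h2
  · rintro z (hz | hz)
    · rw [hFA hz, he z hz]
    · rw [hFB hz]; simp only [Complex.exp_add, hc1, he' z hz, mul_one]

/-- No nontrivial power of `z - p` has a logarithm on a circle around `p`. -/
theorem not_hasLog_circle {p : ℂ} {R : ℝ} (hR : 0 < R) {a : ℤ}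
    (h : HasLog (fun z => (z - p) ^ a) (sphere p R)) : a = 0 := by
  obtain ⟨g, hg, he⟩ := h
  have hm : ∀ θ : ℝ, circleMap p R θ ∈ sphere p R := fun θ => circleMap_mem_sphere p hR.le θ
  let u : ℝ → ℂ := fun θ => g (circleMap p R θ) - a * (θ * Complex.I)
  have hu : ContinuousOn u univ := by
    refine ContinuousOn.sub ?_ (by fun_prop)
    exact hg.comp (continuous_circleMap p R).continuousOn fun θ _ => hm θ
  have hue : ∀ θ ∈ (univ : Set ℝ), Complex.exp (u θ) = (R : ℂ) ^ a := fun θ _ => by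
    simp only [u]
    rw [Complex.exp_sub, he _ (hm θ), Complex.exp_int_mul]
    simp only [circleMap, add_sub_cancel_left]
    rw [mul_zpow, mul_div_assoc, div_self, mul_one]
    exact zpow_ne_zero _ (Complex.exp_ne_zero _)
  have := exp_eq_imp_const isPreconnected_univ hu hue (mem_univ 0) (mem_univ (2 * Real.pi))
  simp only [u] at this
  have h2 : circleMap p R (2 * Real.pi) = circleMap p R 0 := by simp [circleMap]
  rw [h2] at this
  have h3 : (a : ℂ) * (2 * Real.pi * Complex.I) = 0 := by
    have h4 := sub_right_inj.1 this
    push_cast at h4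
    rw [← h4]; simp
  rcases mul_eq_zero.1 h3 with h | h
  · exact_mod_cast h
  · exact absurd h Complex.two_pi_I_ne_zero

end PlaneLogs

section PlaneSeparation
open Filter Topology Metric

theorem frontier_connectedComponentIn_subset {X : Type*} [TopologicalSpace X]
    [LocallyConnectedSpace X] {K : Set X} (hK : IsClosed K) (p : X) :
    frontier (connectedComponentIn Kᶜ p) ⊆ K := by
  intro z hz
  by_contra hzK
  have ho := hK.isOpen_compl.connectedComponentIn (x := z)
  have hop := hK.isOpen_compl.connectedComponentIn (x := p)
  obtain ⟨y, hy1, hy2⟩ := mem_closure_iff.1 (frontier_subset_closure hz) _ ho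
    (mem_connectedComponentIn hzK)
  rw [hop.frontier_eq] at hz
  apply hz.2
  rw [connectedComponentIn_eq hy2, ← connectedComponentIn_eq hy1]
  exact mem_connectedComponentIn hzK

theorem closure_connectedComponentIn_subset {X : Type*} [TopologicalSpace X]
    [LocallyConnectedSpace X] {K : Set X} (hK : IsClosed K) (p : X) :
    closure (connectedComponentIn Kᶜ p) ⊆ connectedComponentIn Kᶜ p ∪ K := by
  rw [closure_eq_self_union_frontier]
  exact union_subset_union_right _ (frontier_connectedComponentIn_subset hK p)

/-- A nonvanishing function on a bounded domain cannot agree with a nontrivial power of `z - p`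
on the frontier. -/
theorem eq_zero_of_zpow_extends {U : Set ℂ} (hU : IsOpen U) (hb : Bornology.IsBounded U) {p : ℂ}
    (hp : p ∈ U) {F : ℂ → ℂ} (hF : ContinuousOn F (closure U)) (h0 : ∀ z ∈ closure U, F z ≠ 0)
    {a : ℤ} (ha : ∀ z ∈ frontier U, F z = (z - p) ^ a) : a = 0 := by
  classical
  let f : ℂ → ℂ := fun z => if z ∈ U then F z else (z - p) ^ a
  have h1 : EqOn f F (closure U) := fun z hz => by
    by_cases h : z ∈ U
    · exact if_pos h
    · simp only [f, h, if_false]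
      exact (ha z (by rw [hU.frontier_eq]; exact ⟨hz, h⟩)).symm
  have h2 : EqOn f (fun z => (z - p) ^ a) Uᶜ := fun z hz => if_neg hz
  have hne : ∀ z ∈ Uᶜ, z - p ≠ 0 := fun z hz h => hz (by rw [sub_eq_zero.1 h]; exact hp)
  have hf : Continuous f := by
    rw [← continuousOn_univ]
    have := (hF.congr h1).union_of_isClosed (s := closure U) (t := Uᶜ)
      ((ContinuousOn.zpow₀ (f := fun z => z - p) (by fun_prop) a
        fun z hz => Or.inl (hne z hz)).congr h2)
      isClosed_closure hU.isClosed_compl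
    refine this.mono fun z _ => ?_
    by_cases h : z ∈ U
    · exact Or.inl (subset_closure h)
    · exact Or.inr h
  have hf0 : ∀ z, f z ≠ 0 := fun z => by
    by_cases h : z ∈ U
    · rw [h1 (subset_closure h)]; exact h0 z (subset_closure h)
    · rw [h2 h]; exact zpow_ne_zero _ (hne z h)
  obtain ⟨R, hR⟩ := hb.subset_ball p
  have hRpos : 0 < R := by simpa using hR hp
  refine not_hasLog_circle (p := p) hRpos
    (((HasLog.of_continuous hf hf0).mono (subset_univ _)).congr ?_)
  intro z hz
  exact h2 fun h => by
    have := hR h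
    rw [mem_ball] at this
    rw [mem_sphere] at hz
    linarith

theorem exists_continuous_extension {K : Set ℂ} (hK : IsClosed K) {g : ℂ → ℂ}
    (hg : ContinuousOn g K) : ∃ G : ℂ → ℂ, Continuous G ∧ EqOn G g K := by
  obtain ⟨G, hG⟩ := ContinuousMap.exists_restrict_eq hK
    ⟨_, continuousOn_iff_continuous_domRestrict.1 hg⟩
  exact ⟨G, G.continuous, fun z hz => congrArg (fun f => f ⟨z, hz⟩) (congrArg DFunLike.coe hG)⟩

theorem HasLog.of_mem_component {K : Set ℂ} (hK : IsClosed K) {p q : ℂ} (hp : p ∈ Kᶜ)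
    (h : q ∈ connectedComponentIn Kᶜ p) : HasLog (fun z => (z - q) / (z - p)) K := by
  have hc : IsConnected (connectedComponentIn Kᶜ p) :=
    ⟨⟨p, mem_connectedComponentIn hp⟩, isPreconnected_connectedComponentIn⟩
  obtain ⟨γ, hγ⟩ :=
    ((hK.isOpen_compl.connectedComponentIn (x := p)).isConnected_iff_isPathConnected.1
    hc).joinedIn p (mem_connectedComponentIn hp) q h
  have hγK : ∀ t, γ t ∉ K := fun t => connectedComponentIn_subset _ _ (hγ t)
  have hne : ∀ z ∈ K, z - p ≠ 0 := fun z hz h => hp (by rwa [← sub_eq_zero.1 h])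
  have := HasLog.of_homotopy (K := K) (H := fun t z => (z - γ t) / (z - p))
    (by
      refine ContinuousOn.div (by fun_prop) (by fun_prop) ?_
      rintro ⟨t, z⟩ ⟨-, hz⟩
      exact hne z hz)
    (fun t z hz => div_ne_zero (fun h => hγK t (by rwa [← sub_eq_zero.1 h])) (hne z hz))
    ((HasLog.const one_ne_zero K).congr fun z hz => by simp [div_self (hne z hz)])
  exact this.congr fun z _ => by simp

theorem isPreconnected_compl_closedBall {R : ℝ} (hR : 0 < R) :
    IsPreconnected (closedBall (0 : ℂ) R)ᶜ := by
  have : (closedBall (0 : ℂ) R)ᶜ = Complex.exp '' {z | Real.log R < z.re} := by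
    ext z
    simp only [mem_compl_iff, mem_closedBall, dist_zero_right, not_le, mem_image, mem_ofPred_eq]
    constructor
    · intro hz
      have hz0 : z ≠ 0 := norm_pos_iff.1 (hR.trans hz)
      exact ⟨Complex.log z, by rw [Complex.log_re]; exact Real.log_lt_log hR hz,
        Complex.exp_log hz0⟩
    · rintro ⟨w, hw, rfl⟩
      rw [Complex.norm_exp]
      exact (Real.log_lt_iff_lt_exp hR).1 hw
  rw [this]
  exact (convex_halfSpace_re_gt _).isPreconnected.image _ Complex.continuous_exp.continuousOn

/-- A component of the complement of a compact set is bounded or contains all far points. -/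
theorem bounded_or_far {K : Set ℂ} (hK : IsCompact K) (p : ℂ) :
    Bornology.IsBounded (connectedComponentIn Kᶜ p) ∨
      ∃ R : ℝ, 0 < R ∧ ∀ q : ℂ, R < ‖q‖ → q ∈ connectedComponentIn Kᶜ p := by
  by_cases hb : Bornology.IsBounded (connectedComponentIn Kᶜ p)
  · exact Or.inl hb
  · right
    obtain ⟨R, hR⟩ := hK.isBounded.subset_closedBall 0
    refine ⟨max R 1, by positivity, fun q hq => ?_⟩
    have hconn : IsPreconnected (closedBall (0 : ℂ) (max R 1))ᶜ :=
      isPreconnected_compl_closedBall (by positivity)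
    have : ∃ z ∈ connectedComponentIn Kᶜ p, z ∈ (closedBall (0 : ℂ) (max R 1))ᶜ := by
      by_contra! h
      exact hb (isBounded_closedBall.subset fun z hz => not_not.1 (h z hz))
    obtain ⟨z, hz, hz'⟩ := this
    have hsub : (closedBall (0 : ℂ) (max R 1))ᶜ ⊆ Kᶜ :=
      compl_subset_compl.2 (hR.trans (closedBall_subset_closedBall (le_max_left _ _)))
    rw [connectedComponentIn_eq hz]
    exact hconn.subset_connectedComponentIn hz' hsub (by simpa using hq)

theorem not_hasLog_of_bounded {K : Set ℂ} (hK : IsCompact K) {p : ℂ} (hp : p ∈ Kᶜ)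
    (hb : Bornology.IsBounded (connectedComponentIn Kᶜ p)) {w : ℂ → ℂ}
    (hw : ContinuousOn w (closure (connectedComponentIn Kᶜ p)))
    (hw0 : ∀ z ∈ closure (connectedComponentIn Kᶜ p), w z ≠ 0) {a : ℤ}
    (h : HasLog (fun z => (z - p) ^ a / w z) K) : a = 0 := by
  obtain ⟨g, hg, he⟩ := h
  obtain ⟨G, hG, hGg⟩ := exists_continuous_extension hK.isClosed hg
  refine eq_zero_of_zpow_extends (hK.isClosed.isOpen_compl.connectedComponentIn) hb
    (mem_connectedComponentIn hp) (F := fun z => Complex.exp (G z) * w z)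
    ((Complex.continuous_exp.comp hG).continuousOn.mul hw)
    (fun z hz => mul_ne_zero (Complex.exp_ne_zero _) (hw0 z hz)) fun z hz => ?_
  have hzK := frontier_connectedComponentIn_subset hK.isClosed p hz
  rw [hGg hzK, he z hzK, div_mul_cancel₀]
  exact hw0 z (frontier_subset_closure hz)

theorem mem_component_of_hasLog {K : Set ℂ} (hK : IsCompact K) {p q : ℂ} (hp : p ∈ Kᶜ)
    (hq : q ∈ Kᶜ) (h : HasLog (fun z => (z - q) / (z - p)) K) :
    q ∈ connectedComponentIn Kᶜ p := by
  have key : ∀ p q : ℂ, p ∈ Kᶜ → q ∈ Kᶜ → HasLog (fun z => (z - p) / (z - q)) K →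
      Bornology.IsBounded (connectedComponentIn Kᶜ p) → q ∈ connectedComponentIn Kᶜ p := by
    intro p q hp hq h hb
    by_contra hqp
    have hqc : ∀ z ∈ closure (connectedComponentIn Kᶜ p), z - q ≠ 0 := fun z hz h0 => by
      rw [sub_eq_zero.1 h0] at hz
      exact (closure_connectedComponentIn_subset hK.isClosed p hz).elim hqp hq
    exact one_ne_zero (not_hasLog_of_bounded hK hp hb (w := fun z => z - q) (by fun_prop) hqc
      (a := 1) (h.congr fun z _ => by simp))
  rcases bounded_or_far hK p with hb | ⟨R, -, hR⟩
  · exact key p q hp hq (h.inv.congr fun z _ => by simp) hb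
  rcases bounded_or_far hK q with hb | ⟨R', -, hR'⟩
  · rw [← connectedComponentIn_eq (key q p hq hp h hb)]
    exact mem_connectedComponentIn hq
  · obtain ⟨z, hz⟩ := NormedField.exists_lt_norm ℂ (max R R')
    rw [connectedComponentIn_eq (hR z ((le_max_left _ _).trans_lt hz)),
      ← connectedComponentIn_eq (hR' z ((le_max_right _ _).trans_lt hz))]
    exact mem_connectedComponentIn hq

theorem HasLog.of_unbounded {K : Set ℂ} (hK : IsCompact K) {p : ℂ} (hp : p ∈ Kᶜ)
    (hb : ¬ Bornology.IsBounded (connectedComponentIn Kᶜ p)) : HasLog (fun z => z - p) K := by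
  obtain ⟨R, hR0, hR⟩ := (bounded_or_far hK p).resolve_left hb
  obtain ⟨R', hR'⟩ := hK.isBounded.subset_ball 0
  obtain ⟨q, hq⟩ := NormedField.exists_lt_norm ℂ (max R R')
  have hqR := hR q ((le_max_left _ _).trans_lt hq)
  have hq0 : q ≠ 0 := by
    rintro rfl
    simp at hq
    linarith [hq.1]
  have h1 : HasLog (fun z => 1 - z / q) K := HasLog.of_slitPlane (by fun_prop) fun z hz => by
    have hz' : ‖z‖ < R' := by simpa using hR' hz
    rw [sub_eq_add_neg]
    apply Complex.mem_slitPlane_of_norm_lt_one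
    rw [norm_neg, norm_div, div_lt_one (norm_pos_iff.2 hq0)]
    exact hz'.trans ((le_max_right _ _).trans_lt hq)
  have h2 := (h1.mul (HasLog.const (neg_ne_zero.2 hq0) K)).div
    (HasLog.of_mem_component hK.isClosed hp hqR)
  refine h2.congr fun z hz => ?_
  have hzp : z - p ≠ 0 := fun h => hp (by rwa [← sub_eq_zero.1 h])
  have hzq : z - q ≠ 0 := fun h => connectedComponentIn_subset _ _ hqR (by rwa [← sub_eq_zero.1 h])
  field_simp
  ring

theorem unbounded_of_hasLog {K : Set ℂ} (hK : IsCompact K) {p : ℂ} (hp : p ∈ Kᶜ)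
    (h : HasLog (fun z => z - p) K) : ¬ Bornology.IsBounded (connectedComponentIn Kᶜ p) :=
  fun hb => one_ne_zero (not_hasLog_of_bounded hK hp hb (w := fun _ => 1) (by fun_prop)
    (by simp) (a := 1) (h.congr fun z _ => by simp))

/-- Janiszewski's theorem. -/
theorem mem_component_union {A B : Set ℂ} (hA : IsCompact A) (hB : IsCompact B)
    (hAB : IsPreconnected (A ∩ B)) {p q : ℂ} (hp : p ∈ (A ∪ B)ᶜ) (hq : q ∈ (A ∪ B)ᶜ)
    (h1 : q ∈ connectedComponentIn Aᶜ p) (h2 : q ∈ connectedComponentIn Bᶜ p) :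
    q ∈ connectedComponentIn (A ∪ B)ᶜ p :=
  mem_component_of_hasLog (hA.union hB) hp hq <|
    HasLog.union (Or.inl ⟨hA.isClosed, hB.isClosed⟩) hAB
      (HasLog.of_mem_component hA.isClosed (fun h => hp (Or.inl h)) h1)
      (HasLog.of_mem_component hB.isClosed (fun h => hp (Or.inr h)) h2)

/-- Janiszewski's theorem for a point and infinity. -/
theorem unbounded_component_union {A B : Set ℂ} (hA : IsCompact A) (hB : IsCompact B)
    (hAB : IsPreconnected (A ∩ B)) {p : ℂ} (hp : p ∈ (A ∪ B)ᶜ)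
    (h1 : ¬ Bornology.IsBounded (connectedComponentIn Aᶜ p))
    (h2 : ¬ Bornology.IsBounded (connectedComponentIn Bᶜ p)) :
    ¬ Bornology.IsBounded (connectedComponentIn (A ∪ B)ᶜ p) :=
  unbounded_of_hasLog (hA.union hB) hp <|
    HasLog.union (Or.inl ⟨hA.isClosed, hB.isClosed⟩) hAB
      (HasLog.of_unbounded hA (fun h => hp (Or.inl h)) h1)
      (HasLog.of_unbounded hB (fun h => hp (Or.inr h)) h2)

end PlaneSeparation

section JordanCurve
open Filter Topology Metric

theorem continuousOn_invFun_range {X Y : Type*} [TopologicalSpace X] [CompactSpace X] [Nonempty X]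
    [TopologicalSpace Y] [T2Space Y] {γ : X → Y} (hγ : Continuous γ) (hi : Function.Injective γ) :
    ContinuousOn (Function.invFun γ) (range γ) := by
  have he := (hγ.isClosedEmbedding hi).isEmbedding
  rw [continuousOn_iff_continuous_domRestrict]
  have h2 : (range γ).domRestrict (Function.invFun γ) = he.toHomeomorph.symm := by
    ext ⟨_, t, rfl⟩
    have : (⟨γ t, t, rfl⟩ : range γ) = he.toHomeomorph t := rfl
    rw [this, he.toHomeomorph.symm_apply_apply]
    exact Function.leftInverse_invFun hi t
  rw [h2]
  exact he.toHomeomorph.symm.continuous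

theorem hasLog_range {X : Type*} [TopologicalSpace X] [CompactSpace X] [Nonempty X] {γ : X → ℂ}
    (hγ : Continuous γ) (hi : Function.Injective γ) {f : ℂ → ℂ}
    (h : HasLog (fun c => f (γ c)) univ) : HasLog f (range γ) := by
  refine (h.comp (continuousOn_invFun_range hγ hi) (mapsTo_univ _ _)).congr ?_
  rintro _ ⟨t, rfl⟩
  rw [Function.leftInverse_invFun hi t]

/-- An arc in the plane does not separate it. -/
theorem mem_component_of_arc {γ : I → ℂ} (hγ : Continuous γ) (hi : Function.Injective γ) {p q : ℂ}
    (hp : p ∈ (range γ)ᶜ) (hq : q ∈ (range γ)ᶜ) : q ∈ connectedComponentIn (range γ)ᶜ p := by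
  have hK := isCompact_range hγ
  refine mem_component_of_hasLog hK hp hq ?_
  have hne : ∀ t, γ t - p ≠ 0 := fun t h => hp ⟨t, sub_eq_zero.1 h⟩
  have hne' : ∀ t, γ t - q ≠ 0 := fun t h => hq ⟨t, sub_eq_zero.1 h⟩
  exact hasLog_range hγ hi (HasLog.of_unitInterval
    ((by fun_prop : Continuous fun t => γ t - q).div (by fun_prop) hne)
    fun t => div_ne_zero (hne' t) (hne t))

theorem isPreconnected_compl_arc {γ : I → ℂ} (hγ : Continuous γ) (hi : Function.Injective γ) :
    IsPreconnected (range γ)ᶜ :=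
  isPreconnected_of_forall_pair fun p hp _ hq =>
    ⟨_, connectedComponentIn_subset _ p, mem_connectedComponentIn hp,
      mem_component_of_arc hγ hi hp hq, isPreconnected_connectedComponentIn⟩

/-- The sub-arc of the circle between the angles `2 π s` and `2 π t`. -/
def circArc (s t : ℝ) : I → Circle := fun u => Circle.exp (2 * Real.pi * (s + u * (t - s)))

theorem continuous_circArc (s t : ℝ) : Continuous (circArc s t) := by
  unfold circArc; fun_prop

theorem circleExp_eq_iff {a b : ℝ} : Circle.exp (2 * Real.pi * a) = Circle.exp (2 * Real.pi * b) ↔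
    ∃ n : ℤ, a = b + n := by
  rw [Circle.exp_eq_exp]
  have := Real.pi_pos
  constructor <;> rintro ⟨n, hn⟩ <;> refine ⟨n, ?_⟩
  · have : (2 * Real.pi) * a = 2 * Real.pi * (b + n) := by rw [hn]; ring
    exact mul_left_cancel₀ (by positivity) this
  · rw [hn]; ring

theorem circArc_injective {s t : ℝ} (h : s < t) (h' : t < s + 1) :
    Function.Injective (circArc s t) := by
  intro u v huv
  obtain ⟨n, hn⟩ := circleExp_eq_iff.1 huv
  have h1 : ((u : ℝ) - v) * (t - s) = n := by linarith
  have hlt : |(n : ℝ)| < 1 := by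
    rw [← h1, abs_mul, abs_of_pos (sub_pos.2 h)]
    have : |(u : ℝ) - v| ≤ 1 := by
      rw [abs_le]; constructor <;> linarith [u.2.1, u.2.2, v.2.1, v.2.2]
    nlinarith [abs_nonneg ((u : ℝ) - v)]
  have hn0 : n = 0 := by
    rw [← Int.cast_abs] at hlt
    exact Int.abs_lt_one_iff.1 (by exact_mod_cast hlt)
  rw [hn0, Int.cast_zero, mul_eq_zero] at h1
  rcases h1 with h1 | h1
  · exact Subtype.ext (by linarith)
  · linarith

theorem mem_range_circArc {s t : ℝ} (h : s < t) {c : Circle} :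
    c ∈ range (circArc s t) ↔ ∃ r ∈ Icc s t, c = Circle.exp (2 * Real.pi * r) := by
  constructor
  · rintro ⟨u, rfl⟩
    refine ⟨s + u * (t - s), ⟨?_, ?_⟩, rfl⟩ <;> nlinarith [u.2.1, u.2.2]
  · rintro ⟨r, hr, rfl⟩
    have hd := sub_pos.2 h
    refine ⟨⟨(r - s) / (t - s), div_nonneg (by linarith [hr.1]) hd.le,
      (div_le_one hd).2 (by linarith [hr.2])⟩, ?_⟩
    simp only [circArc]
    rw [div_mul_cancel₀ _ hd.ne']
    ring_nf

theorem exists_circleExp (s : ℝ) (c : Circle) :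
    ∃ r ∈ Ico s (s + 1), c = Circle.exp (2 * Real.pi * r) := by
  obtain ⟨x, hx⟩ : ∃ x, Circle.exp x = c := ⟨_, Circle.exp_arg c⟩
  have := Real.pi_pos
  refine ⟨toIcoMod one_pos s (x / (2 * Real.pi)), toIcoMod_mem_Ico _ _ _, ?_⟩
  rw [← hx]
  have : x = 2 * Real.pi * (x / (2 * Real.pi)) := by field_simp
  conv_lhs => rw [this]
  rw [circleExp_eq_iff]
  refine ⟨toIcoDiv one_pos s (x / (2 * Real.pi)), ?_⟩
  conv_lhs => rw [← toIcoMod_add_toIcoDiv_zsmul one_pos s (x / (2 * Real.pi))]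
  simp

/-- Any neighbourhood of a point of the circle has its complement covered by a proper sub-arc
avoiding the point. -/
theorem exists_circArc_compl {c : Circle} {U : Set Circle} (hU : U ∈ 𝓝 c) :
    ∃ s t : ℝ, s < t ∧ t < s + 1 ∧ Uᶜ ⊆ range (circArc s t) ∧ c ∉ range (circArc s t) := by
  obtain ⟨r, -, rfl⟩ := exists_circleExp 0 c
  have hcont : Continuous fun r : ℝ => Circle.exp (2 * Real.pi * r) := by fun_prop
  obtain ⟨δ, hδ, hb⟩ := Metric.mem_nhds_iff.1 (hcont.continuousAt.preimage_mem_nhds hU)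
  set η := min (δ / 2) (1 / 4) with hη
  have h1 : η ≤ δ / 2 := min_le_left _ _
  have h2 : η ≤ 1 / 4 := min_le_right _ _
  have h0 : 0 < η := lt_min (by linarith) (by norm_num)
  refine ⟨r + η, r + 1 - η, by linarith, by linarith, fun c' hc' => ?_, fun hc => ?_⟩
  · obtain ⟨r', hr', rfl⟩ := exists_circleExp (r - η) c'
    rw [mem_range_circArc (by linarith)]
    refine ⟨r', ⟨?_, by linarith [hr'.2]⟩, rfl⟩
    by_contra! hlt
    refine hc' (hb (show r' ∈ ball r δ from ?_))
    rw [mem_ball, Real.dist_eq, abs_lt]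
    constructor <;> linarith [hr'.1]
  · rw [mem_range_circArc (by linarith)] at hc
    obtain ⟨r', hr', h⟩ := hc
    obtain ⟨n, hn⟩ := circleExp_eq_iff.1 h
    have h3 : (n : ℝ) < 0 := by linarith [hr'.1]
    have h4 : (-1 : ℝ) < n := by linarith [hr'.2]
    have h3' : n < 0 := by exact_mod_cast h3
    have h4' : -1 < n := by exact_mod_cast h4
    omega

/-- Every nonvanishing function on the circle is, up to an exponential, a power of the
coordinate. -/
theorem exists_hasLog_mul_zpow {f : Circle → ℂ} (hf : Continuous f) (h0 : ∀ c, f c ≠ 0) :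
    ∃ m : ℤ, HasLog (fun c : Circle => f c * (c : ℂ) ^ m) univ := by
  have hpi := Real.pi_pos
  have : Fact (0 < 2 * Real.pi) := ⟨by positivity⟩
  obtain ⟨g, hg, he⟩ := HasLog.of_unitInterval (f := fun s => f (circArc 0 1 s))
    (hf.comp (continuous_circArc _ _)) fun s => h0 _
  rw [continuousOn_univ] at hg
  have hends : Complex.exp (g 1) = Complex.exp (g 0) := by
    rw [he 1 trivial, he 0 trivial]
    have := (circleExp_eq_iff (a := 1) (b := 0)).2 ⟨1, by simp⟩
    exact congrArg f (by simp [circArc])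
  obtain ⟨n, hn⟩ := Complex.exp_eq_exp_iff_exists_int.1 hends
  let u : ℝ → ℂ := fun t => g (projIcc 0 1 zero_le_one (t / (2 * Real.pi))) - n * (t * Complex.I)
  have hu : Continuous u := by
    have : Continuous fun t : ℝ => projIcc (0 : ℝ) 1 zero_le_one (t / (2 * Real.pi)) :=
      continuous_projIcc.comp (by fun_prop)
    exact (hg.comp this).sub (by fun_prop)
  have hu2 : u 0 = u (0 + 2 * Real.pi) := by
    simp only [u, zero_div, zero_add]
    rw [div_self (by positivity), projIcc_left, projIcc_right]
    change g 0 - _ = g 1 - _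
    rw [hn]; push_cast; ring
  have hL := AddCircle.liftIco_continuous (p := 2 * Real.pi) hu2 hu.continuousOn
  refine ⟨-n, fun c => AddCircle.liftIco (2 * Real.pi) 0 u (AddCircle.homeomorphCircle'.symm c),
    (hL.comp (by fun_prop)).continuousOn, fun c _ => ?_⟩
  obtain ⟨r, hr, rfl⟩ := exists_circleExp 0 c
  have h1 : AddCircle.homeomorphCircle'.symm (Circle.exp (2 * Real.pi * r)) =
      ((2 * Real.pi * r : ℝ) : AddCircle (2 * Real.pi)) := by
    rw [Homeomorph.symm_apply_eq, AddCircle.homeomorphCircle'_apply_mk]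
  beta_reduce
  erw [h1]
  rw [AddCircle.liftIco_coe_apply]
  · simp only [u]
    have h2 : 2 * Real.pi * r / (2 * Real.pi) = r := by field_simp
    rw [h2, projIcc_of_mem _ (⟨hr.1, by linarith [hr.2]⟩ : r ∈ Icc (0 : ℝ) 1), Complex.exp_sub,
      he _ trivial, Complex.exp_int_mul]
    simp only [circArc, Circle.coe_exp, zpow_neg, div_eq_mul_inv]
    congr 3
    simp
  · constructor <;> nlinarith [hr.1, hr.2]

variable {Γ : Circle → ℂ}

theorem exists_not_mem_component (hΓ : Continuous Γ) (hi : Function.Injective Γ) :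
    ∃ p ∈ (range Γ)ᶜ, ∃ q ∈ (range Γ)ᶜ, q ∉ connectedComponentIn (range Γ)ᶜ p := by
  by_contra! hcon
  have hJ : IsPreconnected (range Γ)ᶜ := isPreconnected_of_forall_pair fun p hp q hq =>
    ⟨_, connectedComponentIn_subset _ p, mem_connectedComponentIn hp, hcon p hp q hq,
      isPreconnected_connectedComponentIn⟩
  let e : ℝ → ℂ := fun r => Γ (Circle.exp (2 * Real.pi * r))
  have he : Continuous e := hΓ.comp (by fun_prop)
  have heq : ∀ {s t : ℝ}, e s = e t ↔ ∃ n : ℤ, s = t + n := hi.eq_iff.trans circleExp_eq_iff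
  have hA : IsClosed (e '' Icc 0 (1 / 2)) := (isCompact_Icc.image he).isClosed
  have hB : IsClosed (e '' Icc (1 / 2) 1) := (isCompact_Icc.image he).isClosed
  have hU : e '' Icc 0 (1 / 2) ∪ e '' Icc (1 / 2) 1 = range Γ := by
    rw [← image_union, Icc_union_Icc_eq_Icc (by norm_num) (by norm_num)]
    ext z
    constructor
    · rintro ⟨r, -, rfl⟩; exact ⟨_, rfl⟩
    · rintro ⟨c, rfl⟩
      obtain ⟨r, hr, rfl⟩ := exists_circleExp 0 c
      exact ⟨r, ⟨hr.1, by linarith [hr.2]⟩, rfl⟩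
  have hI : e '' Icc 0 (1 / 2) ∩ e '' Icc (1 / 2) 1 ⊆ {e 0, e (1 / 2)} := by
    rintro _ ⟨⟨s, hs, rfl⟩, ⟨t, ht, hst⟩⟩
    obtain ⟨n, hn⟩ := heq.1 hst
    have h1 : (n : ℝ) ≤ 1 := by linarith [hs.1, ht.2]
    have h2 : (0 : ℝ) ≤ n := by linarith [hs.2, ht.1]
    have h1' : n ≤ 1 := by exact_mod_cast h1
    have h2' : 0 ≤ n := by exact_mod_cast h2
    obtain rfl | rfl : n = 0 ∨ n = 1 := by omega
    · right; rw [mem_singleton_iff]; congr 1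
      push_cast at hn; linarith [hs.2, ht.1]
    · left; congr 1
      push_cast at hn; linarith [hs.1, ht.2]
  have hab : e 0 ≠ e (1 / 2) := fun h => by
    obtain ⟨n, hn⟩ := heq.1 h
    have h1 : (n : ℝ) * 2 = -1 := by linarith
    have h2 : n * 2 = -1 := by exact_mod_cast h1
    omega
  have hb1 : e (1 / 2) ∈ e '' Icc 0 (1 / 2) := ⟨_, ⟨by norm_num, le_rfl⟩, rfl⟩
  have hb2 : e (1 / 2) ∈ e '' Icc (1 / 2) 1 := ⟨_, ⟨le_rfl, by norm_num⟩, rfl⟩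
  have hlog : ∀ (K : Set ℂ) (φ : I → ℝ), Continuous φ → (∀ t, e (φ t) ∈ K) → φ 0 = 1 / 2 →
      e (φ 1) = e 0 → HasLog (fun z => (z - e 0) / (z - e (1 / 2))) Kᶜ := by
    intro K φ hφ hK hφ0 hφ1
    have hne : ∀ t, ∀ z ∈ Kᶜ, z - e (φ t) ≠ 0 :=
      fun t z hz h => hz (by rw [sub_eq_zero.1 h]; exact hK t)
    have := HasLog.of_homotopy (K := Kᶜ) (H := fun t z => (z - e (φ t)) / (z - e (φ 0)))
      (by
        refine ContinuousOn.div (by fun_prop) (by fun_prop) ?_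
        rintro ⟨t, z⟩ ⟨-, hz⟩
        exact hne _ z hz)
      (fun t z hz => div_ne_zero (hne t z hz) (hne 0 z hz))
      ((HasLog.const one_ne_zero _).congr fun z hz => by simp [div_self (hne 0 z hz)])
    exact this.congr fun z _ => by simp only [hφ1, hφ0]
  have l1 := hlog (e '' Icc 0 (1 / 2)) (fun t => 1 / 2 - t / 2) (by fun_prop)
    (fun t => ⟨_, ⟨by linarith [t.2.2], by linarith [t.2.1]⟩, rfl⟩) (by simp) (by norm_num)
  have l2 := hlog (e '' Icc (1 / 2) 1) (fun t => 1 / 2 + t / 2) (by fun_prop)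
    (fun t => ⟨_, ⟨by linarith [t.2.1], by linarith [t.2.2]⟩, rfl⟩) (by simp)
    (heq.2 ⟨1, by norm_num⟩)
  have l3 := HasLog.union (Or.inr ⟨hA.isOpen_compl, hB.isOpen_compl⟩)
    (by rw [← compl_union, hU]; exact hJ) l1 l2
  rw [← compl_inter] at l3
  have hr : 0 < dist (e (1 / 2)) (e 0) / 2 := by
    have := dist_pos.2 hab.symm; linarith
  have hs : sphere (e 0) (dist (e (1 / 2)) (e 0) / 2) ⊆
      (e '' Icc 0 (1 / 2) ∩ e '' Icc (1 / 2) 1)ᶜ := fun z hz h => by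
    rw [mem_sphere] at hz
    rcases hI h with rfl | rfl
    · rw [dist_self] at hz; linarith
    · linarith
  have hba : e 0 - e (1 / 2) ≠ 0 := sub_ne_zero.2 hab
  have l4 : HasLog (fun z => 1 + (z - e 0) / (e 0 - e (1 / 2)))
      (sphere (e 0) (dist (e (1 / 2)) (e 0) / 2)) :=
    HasLog.of_slitPlane (by fun_prop) fun z hz => by
      apply Complex.mem_slitPlane_of_norm_lt_one
      rw [norm_div, ← dist_eq_norm, ← dist_eq_norm, mem_sphere.1 hz,
        div_lt_one (dist_pos.2 hab), dist_comm (e 0)]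
      linarith
  have l5 := ((l3.mono hs).mul l4).mul (HasLog.const hba _)
  refine one_ne_zero (not_hasLog_circle hr (a := 1) (l5.congr fun z hz => ?_))
  have : z - e (1 / 2) ≠ 0 := fun h => by
    rw [sub_eq_zero.1 h, mem_sphere] at hz; linarith
  field_simp
  ring

/-- Every complementary component of a Jordan curve has the whole curve in its closure. -/
theorem range_subset_closure_component (hΓ : Continuous Γ) (hi : Function.Injective Γ) {p : ℂ}
    (hp : p ∈ (range Γ)ᶜ) : range Γ ⊆ closure (connectedComponentIn (range Γ)ᶜ p) := by
  have hJ : IsClosed (range Γ) := (isCompact_range hΓ).isClosed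
  set C := connectedComponentIn (range Γ)ᶜ p with hC
  have hCo : IsOpen C := hJ.isOpen_compl.connectedComponentIn
  obtain ⟨q, hq, hqp⟩ : ∃ q ∈ (range Γ)ᶜ, q ∉ C := by
    obtain ⟨a, ha, b, hb, hab⟩ := exists_not_mem_component hΓ hi
    by_contra! h
    exact hab (connectedComponentIn_eq (h a ha) ▸ h b hb)
  rintro _ ⟨c, rfl⟩
  rw [mem_closure_iff_nhds]
  intro U hU
  by_contra hne
  obtain ⟨s, t, hst, hst', hsub, hc⟩ := exists_circArc_compl
    (hΓ.continuousAt.preimage_mem_nhds (interior_mem_nhds.2 hU))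
  set L := range (Γ ∘ circArc s t) with hL
  have hLc : IsPreconnected Lᶜ := isPreconnected_compl_arc (hΓ.comp (continuous_circArc s t))
    (hi.comp (circArc_injective hst hst'))
  have hLJ : (range Γ)ᶜ ⊆ Lᶜ := compl_subset_compl.2 (range_comp_subset_range _ _)
  have := hLc.subset_of_closure_inter_subset hCo ⟨p, hLJ hp, mem_connectedComponentIn hp⟩ (by
    rintro z ⟨hz, hzL⟩
    rcases closure_connectedComponentIn_subset hJ p hz with h | ⟨c', rfl⟩
    · exact h
    · by_cases h : Γ c' ∈ interior U
      · obtain ⟨y, hy, hy'⟩ := mem_closure_iff.1 hz _ isOpen_interior h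
        exact absurd ⟨y, interior_subset hy, hy'⟩ hne
      · obtain ⟨u, hu⟩ := hsub h
        exact absurd ⟨u, congrArg Γ hu⟩ hzL)
  exact hqp (this (hLJ hq))

theorem exists_bounded_component (hΓ : Continuous Γ) (hi : Function.Injective Γ) :
    ∃ p ∈ (range Γ)ᶜ, Bornology.IsBounded (connectedComponentIn (range Γ)ᶜ p) := by
  obtain ⟨a, ha, b, hb, hab⟩ := exists_not_mem_component hΓ hi
  have hJ := isCompact_range hΓ
  rcases bounded_or_far hJ a with h | ⟨R, -, hR⟩
  · exact ⟨a, ha, h⟩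
  rcases bounded_or_far hJ b with h | ⟨R', -, hR'⟩
  · exact ⟨b, hb, h⟩
  exfalso
  obtain ⟨z, hz⟩ := NormedField.exists_lt_norm ℂ (max R R')
  apply hab
  rw [connectedComponentIn_eq (hR z ((le_max_left _ _).trans_lt hz)),
    ← connectedComponentIn_eq (hR' z ((le_max_right _ _).trans_lt hz))]
  exact mem_connectedComponentIn hb

/-- The complement of a Jordan curve has only one bounded component. -/
theorem mem_component_of_bounded (hΓ : Continuous Γ) (hi : Function.Injective Γ) {p q : ℂ}
    (hp : p ∈ (range Γ)ᶜ) (hq : q ∈ (range Γ)ᶜ)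
    (hbp : Bornology.IsBounded (connectedComponentIn (range Γ)ᶜ p))
    (hbq : Bornology.IsBounded (connectedComponentIn (range Γ)ᶜ q)) :
    q ∈ connectedComponentIn (range Γ)ᶜ p := by
  have hJ := isCompact_range hΓ
  by_contra hqp
  have hne : ∀ p ∈ (range Γ)ᶜ, ∀ c, Γ c - p ≠ 0 :=
    fun p hp c h => hp ⟨c, sub_eq_zero.1 h⟩
  obtain ⟨m, hm⟩ := exists_hasLog_mul_zpow (f := fun c => Γ c - p) (by fun_prop) (hne p hp)
  obtain ⟨k, hk⟩ := exists_hasLog_mul_zpow (f := fun c => Γ c - q) (by fun_prop) (hne q hq)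
  have hcl : ∀ z ∈ closure (connectedComponentIn (range Γ)ᶜ p), z - q ≠ 0 := fun z hz h => by
    rw [sub_eq_zero.1 h] at hz
    exact (closure_connectedComponentIn_subset hJ.isClosed p hz).elim hqp hq
  have hk0 : k = 0 := by
    refine not_hasLog_of_bounded hJ hp hbp (w := fun z => (z - q) ^ m)
      (ContinuousOn.zpow₀ (by fun_prop) _ fun z hz => Or.inl (hcl z hz))
      (fun z hz => zpow_ne_zero _ (hcl z hz)) (hasLog_range hΓ hi ?_)
    refine ((hm.zpow k).div (hk.zpow m)).congr fun c _ => ?_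
    rw [mul_zpow, mul_zpow, ← zpow_mul, ← zpow_mul, mul_comm k m, mul_div_mul_right]
    exact zpow_ne_zero _ (Circle.coe_ne_zero c)
  subst hk0
  exact unbounded_of_hasLog hJ hq (hasLog_range hΓ hi (by simpa using hk)) hbq

end JordanCurve

section RiemannMapping
open Filter Topology Metric
open scoped ComplexConjugate

/-- A function with logarithms on all compact subsets of a domain has one on the domain. -/
theorem HasLog.of_compact {V : Set ℂ} (ho : IsOpen V) (hc : IsPreconnected V) {f : ℂ → ℂ}
    (h : ∀ K ⊆ V, IsCompact K → HasLog f K) : HasLog f V := by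
  rcases V.eq_empty_or_nonempty with rfl | ⟨z₀, hz₀⟩
  · exact ⟨f, by simp, by simp⟩
  have hpc := ho.isConnected_iff_isPathConnected.1 ⟨⟨z₀, hz₀⟩, hc⟩
  obtain ⟨g₀, -, hg₀⟩ := h {z₀} (by simpa using hz₀) isCompact_singleton
  have hlog : ∀ K ⊆ V, IsCompact K → z₀ ∈ K → ∃ g : ℂ → ℂ, ContinuousOn g K ∧
      (∀ z ∈ K, Complex.exp (g z) = f z) ∧ g z₀ = g₀ z₀ := by
    intro K hKV hK hz
    obtain ⟨g, hg, he⟩ := h K hKV hK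
    refine ⟨fun z => g z + (g₀ z₀ - g z₀), hg.add continuousOn_const, fun z hz' => ?_, by ring⟩
    rw [Complex.exp_add, Complex.exp_sub, he _ hz, hg₀ _ rfl, he z hz', div_self, mul_one]
    rw [← he _ hz]; exact Complex.exp_ne_zero _
  have huniq : ∀ K : Set ℂ, IsPreconnected K → z₀ ∈ K → ∀ g g' : ℂ → ℂ, ContinuousOn g K →
      ContinuousOn g' K → (∀ z ∈ K, Complex.exp (g z) = f z) →
      (∀ z ∈ K, Complex.exp (g' z) = f z) → g z₀ = g' z₀ → ∀ z ∈ K, g z = g' z := by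
    intro K hK hz₀ g g' hg hg' he he' h0 z hz
    have := exp_eq_imp_const hK (hg.sub hg') (c := 1) (fun z hz => by
      rw [Pi.sub_apply, Complex.exp_sub, he z hz, he' z hz, div_self]
      rw [← he z hz]; exact Complex.exp_ne_zero _) hz hz₀
    simp only [Pi.sub_apply, h0, sub_self] at this
    exact sub_eq_zero.1 this
  have hK : ∀ z ∈ V, ∃ K ⊆ V, IsCompact K ∧ IsPreconnected K ∧ z₀ ∈ K ∧ z ∈ K := fun z hz => by
    obtain ⟨γ, hγ⟩ := hpc.joinedIn z₀ hz₀ z hz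
    exact ⟨range γ, range_subset_iff.2 hγ, isCompact_range γ.continuous,
      isPreconnected_range γ.continuous, ⟨0, γ.source⟩, ⟨1, γ.target⟩⟩
  choose! K hKV hKc hKp hK0 hKz using hK
  choose! g hg he hgz using hlog
  let G : ℂ → ℂ := fun z => g (K z) z
  have hG : ∀ z ∈ V, ∀ L ⊆ V, IsCompact L → IsPreconnected L → z₀ ∈ L → z ∈ L →
      G z = g L z := by
    intro z hz L hLV hLc hLp hL0 hLz
    have hUV := union_subset (hKV z hz) hLV
    have hUc := (hKc z hz).union hLc
    have h1 := huniq (K z) (hKp z hz) (hK0 z hz) (g (K z)) (g (K z ∪ L))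
      (hg _ (hKV z hz) (hKc z hz) (hK0 z hz))
      ((hg _ hUV hUc (Or.inl (hK0 z hz))).mono subset_union_left)
      (he _ (hKV z hz) (hKc z hz) (hK0 z hz))
      (fun w hw => he _ hUV hUc (Or.inl (hK0 z hz)) w (Or.inl hw))
      ((hgz _ (hKV z hz) (hKc z hz) (hK0 z hz)).trans (hgz _ hUV hUc (Or.inl (hK0 z hz))).symm)
      z (hKz z hz)
    have h2 := huniq L hLp hL0 (g L) (g (K z ∪ L)) (hg _ hLV hLc hL0)
      ((hg _ hUV hUc (Or.inr hL0)).mono subset_union_right) (he _ hLV hLc hL0)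
      (fun w hw => he _ hUV hUc (Or.inr hL0) w (Or.inr hw))
      ((hgz _ hLV hLc hL0).trans (hgz _ hUV hUc (Or.inr hL0)).symm) z hLz
    exact h1.trans h2.symm
  refine ⟨G, fun z hz => ?_, fun z hz => he _ (hKV z hz) (hKc z hz) (hK0 z hz) z (hKz z hz)⟩
  obtain ⟨r, hr, hb⟩ := nhds_basis_closedBall.mem_iff.1 (ho.mem_nhds hz)
  have hUV := union_subset (hKV z hz) hb
  have hUc := (hKc z hz).union (isCompact_closedBall z r)
  have hUp : IsPreconnected (K z ∪ closedBall z r) :=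
    (hKp z hz).union z (hKz z hz) (mem_closedBall_self hr.le)
      (convex_closedBall z r).isPreconnected
  have hev : G =ᶠ[𝓝 z] g (K z ∪ closedBall z r) := by
    filter_upwards [closedBall_mem_nhds z hr] with w hw
    exact hG w (hb hw) _ hUV hUc hUp (Or.inl (hK0 z hz)) (Or.inr hw)
  refine ContinuousAt.continuousWithinAt (ContinuousAt.congr ?_ hev.symm)
  exact (hg _ hUV hUc (Or.inl (hK0 z hz))).continuousAt
    (mem_of_superset (closedBall_mem_nhds z hr) subset_union_right)

/-- The coordinate has a logarithm on a domain in the disc whose complement in the closed disc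
is connected and contains the origin. -/
theorem hasLog_id_of_compl_preconnected {V : Set ℂ} (ho : IsOpen V) (hc : IsPreconnected V)
    (hV : V ⊆ ball 0 1) (h0 : (0 : ℂ) ∉ V) (hE : IsPreconnected (closedBall 0 1 \ V)) :
    HasLog (fun z => z) V := by
  refine HasLog.of_compact ho hc fun K hKV hK => ?_
  have h0K : (0 : ℂ) ∈ Kᶜ := fun h => h0 (hKV h)
  refine (HasLog.of_unbounded hK h0K fun hb => ?_).congr fun z _ => sub_zero z
  have h1V : (1 : ℂ) ∉ V := fun h => by simpa using hV h
  have h1 : (1 : ℂ) ∈ connectedComponentIn Kᶜ 0 :=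
    hE.subset_connectedComponentIn ⟨by simp, h0⟩ (fun z hz h => hz.2 (hKV h)) ⟨by simp, h1V⟩
  obtain ⟨R, hR⟩ := hb.subset_ball 0
  let ray : Set ℂ := (fun t : ℝ => (t : ℂ)) '' Ici 1
  have hray : IsPreconnected ray := isPreconnected_Ici.image _ (by fun_prop)
  have hrayK : ray ⊆ Kᶜ := by
    rintro _ ⟨t, ht, rfl⟩ h
    have := hV (hKV h)
    simp only [mem_ball, dist_zero_right, Complex.norm_real, Real.norm_eq_abs] at this
    linarith [le_abs_self t, mem_Ici.1 ht]
  rw [connectedComponentIn_eq h1] at hR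
  have := hR (hray.subset_connectedComponentIn ⟨1, by simp, by simp⟩ hrayK
    ⟨max R 1, mem_Ici.2 (le_max_right _ _), rfl⟩)
  simp only [mem_ball, dist_zero_right, Complex.norm_real, Real.norm_eq_abs] at this
  linarith [le_abs_self (max R 1), le_max_left R 1]

/-- The preimage of a connected set containing the origin under squaring is connected. -/
theorem isPreconnected_sq_preimage {E : Set ℂ} (hE : IsCompact E) (hc : IsPreconnected E)
    (h0 : (0 : ℂ) ∈ E) (hE1 : E ⊆ closedBall 0 1) : IsPreconnected {z : ℂ | z ^ 2 ∈ E} := by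
  have key : ∀ t t' : Set ℂ, IsClosed t → IsClosed t' → {z : ℂ | z ^ 2 ∈ E} ⊆ t ∪ t' →
      ({z : ℂ | z ^ 2 ∈ E} ∩ t').Nonempty → (0 : ℂ) ∈ t →
      ({z : ℂ | z ^ 2 ∈ E} ∩ (t ∩ t')).Nonempty := by
    intro t t' ht ht' hsub ⟨b, hb, hbt⟩ h0t
    by_contra hne
    have hPc : IsCompact {z : ℂ | z ^ 2 ∈ E} := by
      refine (isCompact_closedBall (0 : ℂ) 1).of_isClosed_subset
        (hE.isClosed.preimage (by fun_prop)) fun z hz => ?_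
      have : ‖z ^ 2‖ ≤ 1 := by simpa using hE1 hz
      rw [norm_pow] at this
      simpa using (pow_le_one_iff_of_nonneg (norm_nonneg z) two_ne_zero).1 this
    set A := {z : ℂ | z ^ 2 ∈ E ∧ z ∈ t ∧ -z ∈ t} with hA
    set B := {z : ℂ | z ^ 2 ∈ E ∧ (z ∈ t' ∨ -z ∈ t')} with hB
    have hAc : IsCompact A := hPc.inter_right
      (ht.inter (ht.preimage (continuous_neg (G := ℂ))))
    have hBc : IsCompact B := hPc.inter_right
      (ht'.union (ht'.preimage (continuous_neg (G := ℂ))))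
    have hsq : Continuous fun z : ℂ => z ^ 2 := by fun_prop
    obtain ⟨y, hy, ⟨a, ha, rfl⟩, ⟨b, hb, hab⟩⟩ := isPreconnected_closed_iff.1 hc
      _ _ (hAc.image hsq).isClosed (hBc.image hsq).isClosed
      (fun y hy => by
        obtain ⟨z, rfl⟩ : ∃ z : ℂ, z ^ 2 = y := ⟨y ^ (1 / 2 : ℂ), by
          rw [← Complex.cpow_nat_mul]; norm_num⟩
        have h1 : z ^ 2 ∈ E := hy
        have h2 : (-z) ^ 2 ∈ E := by rwa [neg_sq]
        by_cases h : z ∈ t' ∨ -z ∈ t'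
        · exact Or.inr ⟨z, ⟨h1, h⟩, rfl⟩
        · push Not at h
          exact Or.inl ⟨z, ⟨h1, (hsub h1).resolve_right h.1, (hsub h2).resolve_right h.2⟩, rfl⟩)
      ⟨0, h0, 0, ⟨by simpa using h0, h0t, by simpa using h0t⟩, by simp⟩
      ⟨_, hb, b, ⟨hb, Or.inl hbt⟩, rfl⟩
    have hd : ∀ z : ℂ, z ^ 2 ∈ E → z ∈ t → z ∉ t' := fun z h1 h2 h3 => hne ⟨z, h1, h2, h3⟩
    have h1 : (-a) ^ 2 ∈ E := by rw [neg_sq]; exact ha.1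
    have ha1 := hd a ha.1 ha.2.1
    have ha2 := hd _ h1 ha.2.2
    rcases sq_eq_sq_iff_eq_or_eq_neg.1 hab with rfl | rfl
    · exact hb.2.elim ha1 ha2
    · exact hb.2.elim ha2 (by rwa [neg_neg])
  rw [isPreconnected_closed_iff]
  intro t t' ht ht' hsub h1 h2
  rcases hsub (show (0 : ℂ) ^ 2 ∈ E by simpa using h0) with h | h
  · exact key t t' ht ht' hsub h2 h
  · rw [inter_comm t t']
    exact key t' t ht' ht (by rwa [union_comm]) h1 h

/-- Taking a square root on a domain preserves connectedness of the complement in the disc. -/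
theorem isPreconnected_compl_sqrt_image {V : Set ℂ} (ho : IsOpen V) (hc : IsPreconnected V)
    (hne : V.Nonempty) (hV : V ⊆ ball 0 1) (h0 : (0 : ℂ) ∉ V)
    (hE : IsPreconnected (closedBall 0 1 \ V)) {s : ℂ → ℂ} (hs : ContinuousOn s V)
    (hsq : ∀ v ∈ V, s v ^ 2 = v) : IsPreconnected (closedBall 0 1 \ s '' V) := by
  have hn : ∀ z : ℂ, z ^ 2 ∈ closedBall (0 : ℂ) 1 ↔ z ∈ closedBall (0 : ℂ) 1 := fun z => by
    simp only [mem_closedBall, dist_zero_right, norm_pow]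
    exact pow_le_one_iff_of_nonneg (norm_nonneg z) two_ne_zero
  have hEc : IsCompact (closedBall 0 1 \ V) := (isCompact_closedBall 0 1).diff ho
  have hP := isPreconnected_sq_preimage hEc hE ⟨by simp, h0⟩ sdiff_subset
  have hsm : ∀ v ∈ V, -s v ∈ closedBall (0 : ℂ) 1 := fun v hv => by
    rw [← hn, neg_sq, hsq v hv]; exact ball_subset_closedBall (hV hv)
  have hN : IsPreconnected ((fun v => -s v) '' V) := hc.image _ hs.neg
  obtain ⟨y, hy1, hy2⟩ : ∃ y ∈ closure ((fun v => -s v) '' V),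
      y ^ 2 ∈ closedBall (0 : ℂ) 1 \ V := by
    have hbd : ∃ v ∈ closure V, v ∉ V := by
      by_contra! h
      have : IsClopen V := ⟨isClosed_of_closure_subset h, ho⟩
      rcases isClopen_iff.1 this with h | h
      · exact hne.ne_empty h
      · exact h0 (h ▸ mem_univ _)
    obtain ⟨v, hv, hvV⟩ := hbd
    have hcomp : IsCompact (closure ((fun v => -s v) '' V)) :=
      (isCompact_closedBall (0 : ℂ) 1).of_isClosed_subset isClosed_closure
        (closure_minimal (by rintro _ ⟨v, hv, rfl⟩; exact hsm v hv) isClosed_closedBall)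
    have himg := (hcomp.image (f := fun z : ℂ => z ^ 2) (by fun_prop)).isClosed
    have hsub : V ⊆ (fun z : ℂ => z ^ 2) '' closure ((fun v => -s v) '' V) := fun v hv =>
      ⟨-s v, subset_closure ⟨v, hv, rfl⟩, by simp only [neg_sq, hsq v hv]⟩
    obtain ⟨y, hy, rfl⟩ := closure_minimal hsub himg hv
    exact ⟨y, hy, closure_minimal (hV.trans ball_subset_closedBall) isClosed_closedBall hv, hvV⟩
  have hN' : IsPreconnected (insert y ((fun v => -s v) '' V)) :=
    hN.subset_closure (subset_insert _ _) (insert_subset hy1 subset_closure)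
  convert hN'.union y (mem_insert _ _) (show y ∈ {z : ℂ | z ^ 2 ∈ closedBall 0 1 \ V} from hy2) hP
    using 1
  ext z
  constructor
  · rintro ⟨hz, hzs⟩
    by_cases h : z ^ 2 ∈ V
    · left; right
      rcases sq_eq_sq_iff_eq_or_eq_neg.1 (hsq _ h) with h' | h'
      · exact absurd ⟨_, h, h'⟩ hzs
      · exact ⟨_, h, by simp [h']⟩
    · exact Or.inr ⟨(hn z).2 hz, h⟩
  · have hPz : ∀ z : ℂ, z ^ 2 ∈ closedBall (0 : ℂ) 1 \ V → z ∈ closedBall 0 1 \ s '' V := by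
      rintro z ⟨h1, h2⟩
      refine ⟨(hn z).1 h1, ?_⟩
      rintro ⟨v, hv, rfl⟩
      exact h2 (by rwa [hsq v hv])
    rintro ((rfl | ⟨v, hv, rfl⟩) | h)
    · exact hPz _ hy2
    · refine ⟨hsm v hv, ?_⟩
      rintro ⟨v', hv', h⟩
      have : v' = v := by rw [← hsq v' hv', h, neg_sq, hsq v hv]
      subst this
      have h1 : s v' = 0 := by
        have : (2 : ℂ) * s v' = 0 := by linear_combination h
        simpa using this
      have h2 := hsq _ hv
      rw [h1] at h2
      exact h0 (by rwa [← h2, zero_pow two_ne_zero] at hv)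
    · exact hPz _ h

/-- The disc automorphism moving `w` to the origin. -/
def discMap (w z : ℂ) : ℂ := (z - w) / (1 - conj w * z)

variable {w : ℂ}

theorem discMap_denom_ne_zero (hw : ‖w‖ < 1) {z : ℂ} (hz : ‖z‖ ≤ 1) : 1 - conj w * z ≠ 0 := by
  intro h
  have h1 : ‖conj w * z‖ = 1 := by rw [← sub_eq_zero.1 h, norm_one]
  rw [norm_mul, Complex.norm_conj] at h1
  nlinarith [norm_nonneg w, norm_nonneg z]

theorem normSq_discMap (w z : ℂ) : Complex.normSq (1 - conj w * z) - Complex.normSq (z - w) =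
    (1 - Complex.normSq w) * (1 - Complex.normSq z) := by
  simp only [Complex.normSq_apply, Complex.sub_re, Complex.sub_im, Complex.mul_re, Complex.mul_im,
    Complex.one_re, Complex.one_im, Complex.conj_re, Complex.conj_im]
  ring

theorem discMap_mem_closedBall (hw : ‖w‖ < 1) {z : ℂ} (hz : z ∈ closedBall (0 : ℂ) 1) :
    discMap w z ∈ closedBall (0 : ℂ) 1 := by
  have hz' : ‖z‖ ≤ 1 := by simpa using hz
  have hd := norm_pos_iff.2 (discMap_denom_ne_zero hw hz')
  have := normSq_discMap w z
  simp only [Complex.normSq_eq_norm_sq] at this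
  rw [mem_closedBall, dist_zero_right, discMap, norm_div, div_le_one hd]
  refine abs_le_of_sq_le_sq' ?_ hd.le |>.2
  have h1 : 0 ≤ (1 - ‖w‖ ^ 2) * (1 - ‖z‖ ^ 2) := by
    apply mul_nonneg <;> nlinarith [norm_nonneg w, norm_nonneg z]
  linarith

theorem discMap_mem_ball (hw : ‖w‖ < 1) {z : ℂ} (hz : z ∈ ball (0 : ℂ) 1) :
    discMap w z ∈ ball (0 : ℂ) 1 := by
  have hz' : ‖z‖ < 1 := by simpa using hz
  have hd := norm_pos_iff.2 (discMap_denom_ne_zero hw hz'.le)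
  have := normSq_discMap w z
  simp only [Complex.normSq_eq_norm_sq] at this
  rw [mem_ball, dist_zero_right, discMap, norm_div, div_lt_one hd]
  refine abs_lt_of_sq_lt_sq' ?_ hd.le |>.2
  have h1 : 0 < (1 - ‖w‖ ^ 2) * (1 - ‖z‖ ^ 2) := by
    apply mul_pos <;> nlinarith [norm_nonneg w, norm_nonneg z]
  linarith

theorem discMap_neg_discMap (hw : ‖w‖ < 1) {z : ℂ} (hz : ‖z‖ ≤ 1) :
    discMap (-w) (discMap w z) = z := by
  have hd := discMap_denom_ne_zero hw hz
  have hw2 : 1 - conj w * w ≠ 0 := discMap_denom_ne_zero hw hw.le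
  unfold discMap
  have e1 : (z - w) / (1 - conj w * z) - -w = z * (1 - conj w * w) / (1 - conj w * z) := by
    rw [eq_div_iff hd, sub_mul, div_mul_cancel₀ _ hd]; ring
  have e2 : 1 - conj (-w) * ((z - w) / (1 - conj w * z)) =
      (1 - conj w * w) / (1 - conj w * z) := by
    rw [eq_div_iff hd, sub_mul, mul_assoc, div_mul_cancel₀ _ hd, map_neg]; ring
  rw [e1, e2, div_div_div_cancel_right₀ hd, mul_div_assoc, div_self hw2, mul_one]

theorem discMap_discMap_neg (hw : ‖w‖ < 1) {z : ℂ} (hz : ‖z‖ ≤ 1) :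
    discMap w (discMap (-w) z) = z := by
  have := discMap_neg_discMap (w := -w) (by rwa [norm_neg]) hz
  rwa [neg_neg] at this

theorem hasDerivAt_discMap (hw : ‖w‖ < 1) {z : ℂ} (hz : ‖z‖ ≤ 1) :
    HasDerivAt (discMap w) ((1 - conj w * w) / (1 - conj w * z) ^ 2) z := by
  have hd := discMap_denom_ne_zero hw hz
  have := ((hasDerivAt_id z).sub_const w).div
    (((hasDerivAt_id z).const_mul (conj w)).const_sub 1) hd
  exact this.congr_deriv (by congr 1; simp only [id]; ring)

theorem continuousOn_discMap (hw : ‖w‖ < 1) : ContinuousOn (discMap w) (closedBall 0 1) :=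
  fun _ hz => (hasDerivAt_discMap hw (by simpa using hz)).continuousAt.continuousWithinAt

/-- Disc automorphisms preserve connectedness of complements in the closed disc. -/
theorem isPreconnected_compl_discMap (hw : ‖w‖ < 1) {V : Set ℂ} (hV : V ⊆ closedBall 0 1)
    (h : IsPreconnected (closedBall 0 1 \ V)) :
    IsPreconnected (closedBall 0 1 \ discMap w '' V) := by
  convert h.image (discMap w) ((continuousOn_discMap hw).mono sdiff_subset) using 1
  ext z
  constructor
  · rintro ⟨hz, hzV⟩
    refine ⟨discMap (-w) z, ⟨discMap_mem_closedBall (by rwa [norm_neg]) hz, fun h => hzV ?_⟩, ?_⟩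
    · exact ⟨_, h, discMap_discMap_neg hw (by simpa using hz)⟩
    · exact discMap_discMap_neg hw (by simpa using hz)
  · rintro ⟨y, ⟨hy, hyV⟩, rfl⟩
    refine ⟨discMap_mem_closedBall hw hy, ?_⟩
    rintro ⟨v, hv, hvy⟩
    apply hyV
    rw [← discMap_neg_discMap hw (show ‖y‖ ≤ 1 by simpa using hy), ← hvy,
      discMap_neg_discMap hw (by simpa using hV hv)]
    exact hv

end RiemannMapping

section RiemannMappingExistence
open Filter Topology Metric
open scoped ComplexConjugate

variable {ι : Type*}

theorem tendsto_limUnder_ultrafilter {φ : Ultrafilter ι} {f : ι → ℂ} {M : ℝ}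
    (h : ∀ᶠ n in (φ : Filter ι), f n ∈ closedBall (0 : ℂ) M) :
    Tendsto f φ (𝓝 (limUnder φ f)) := by
  refine tendsto_nhds_limUnder ?_
  obtain ⟨x, -, hx⟩ := (isCompact_closedBall (0 : ℂ) M).ultrafilter_le_nhds' (φ.map f) h
  exact ⟨x, hx⟩

/-- Bounded families of holomorphic functions converge locally uniformly along ultrafilters. -/
theorem tendstoLocallyUniformlyOn_ultrafilter {φ : Ultrafilter ι} {f : ι → ℂ → ℂ} {U : Set ℂ}
    (hU : IsOpen U) {M : ℝ} (h : ∀ᶠ n in (φ : Filter ι), DifferentiableOn ℂ (f n) U ∧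
      MapsTo (f n) U (closedBall 0 M)) :
    TendstoLocallyUniformlyOn f (fun z => limUnder φ fun n => f n z) φ U := by
  have hlim : ∀ z ∈ U, Tendsto (fun n => f n z) φ (𝓝 (limUnder φ fun n => f n z)) :=
    fun z hz => tendsto_limUnder_ultrafilter (h.mono fun n hn => hn.2 hz)
  rw [Metric.tendstoLocallyUniformlyOn_iff]
  intro ε hε z hz
  obtain ⟨r, hr, hb⟩ := Metric.isOpen_iff.1 hU z hz
  have hM : 0 ≤ M := by
    obtain ⟨n, hn⟩ := h.exists
    exact (norm_nonneg _).trans (by simpa using hn.2 hz)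
  have hlip : ∀ᶠ n in (φ : Filter ι), ∀ w ∈ ball z r, dist (f n w) (f n z) ≤
      (2 * M) / r * dist w z := by
    filter_upwards [h] with n hn w hw
    refine Complex.dist_le_div_mul_dist_of_mapsTo_ball (hn.1.mono hb) (fun y hy => ?_) hw
    have h1 := hn.2 (hb hy)
    have h2 := hn.2 hz
    rw [mem_closedBall] at *
    linarith [dist_triangle_right (f n y) (f n z) 0]
  have hlip' : ∀ w ∈ ball z r, dist (limUnder φ fun n => f n w) (limUnder φ fun n => f n z) ≤
      (2 * M) / r * dist w z := fun w hw =>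
    le_of_tendsto ((hlim w (hb hw)).dist (hlim z hz)) (hlip.mono fun n hn => hn w hw)
  set δ := min r (ε / 3 / (2 * M / r + 1)) with hδ
  have hC : 0 ≤ 2 * M / r := by positivity
  have hδ0 : 0 < δ := lt_min hr (by positivity)
  refine ⟨ball z δ, mem_nhdsWithin_of_mem_nhds (ball_mem_nhds _ hδ0), ?_⟩
  filter_upwards [hlip, (hlim z hz).eventually (ball_mem_nhds _ (show 0 < ε / 3 by positivity))]
    with n hn hn' w hw
  have hwr : w ∈ ball z r := ball_subset_ball (min_le_left _ _) hw
  have hw' : (2 * M) / r * dist w z < ε / 3 := by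
    have h1 : dist w z < ε / 3 / (2 * M / r + 1) := (mem_ball.1 hw).trans_le (min_le_right _ _)
    rw [lt_div_iff₀ (by positivity)] at h1
    nlinarith [dist_nonneg (x := w) (y := z)]
  have h1 := hn w hwr
  have h2 := hlip' w hwr
  rw [dist_comm] at h1
  rw [dist_comm] at hn'
  refine (dist_triangle4 _ (limUnder φ fun n => f n z) (f n z) _).trans_lt ?_
  linarith

/-- Hurwitz: a locally uniform limit of nonvanishing functions vanishes near its zeros. -/
theorem eventually_eq_zero_of_tendstoLocallyUniformlyOn {φ : Filter ι} [φ.NeBot]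
    {f : ι → ℂ → ℂ} {g : ℂ → ℂ} {U : Set ℂ} (hU : IsOpen U)
    (hd : ∀ᶠ n in φ, DifferentiableOn ℂ (f n) U) (h0 : ∀ᶠ n in φ, ∀ z ∈ U, f n z ≠ 0)
    (h : TendstoLocallyUniformlyOn f g φ U) {w : ℂ} (hw : w ∈ U) (hgw : g w = 0) :
    ∀ᶠ z in 𝓝 w, g z = 0 := by
  have hg : DifferentiableOn ℂ g U := h.differentiableOn hd hU
  rcases (hg.analyticAt (hU.mem_nhds hw)).eventually_eq_zero_or_eventually_ne_zero with h1 | h1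
  · exact h1
  exfalso
  obtain ⟨r, hr, hb⟩ := nhds_basis_closedBall.mem_iff.1
    (Filter.inter_mem (hU.mem_nhds hw) (eventually_nhdsWithin_iff.1 h1))
  have hS : IsCompact (sphere w r) := isCompact_sphere w r
  have hSU : closedBall w r ⊆ U := fun z hz => (hb hz).1
  have hSc : sphere w r ⊆ closedBall w r := sphere_subset_closedBall
  obtain ⟨x, hx, hmin⟩ := hS.exists_isMinOn (NormedSpace.sphere_nonempty.2 hr.le)
    ((hg.continuousOn.mono (hSc.trans hSU)).norm)
  have hm : 0 < ‖g x‖ := norm_pos_iff.2 ((hb (hSc hx)).2 (ne_of_mem_sphere hx hr.ne'))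
  have hu : TendstoUniformlyOn f g φ (closedBall w r) :=
    (tendstoLocallyUniformlyOn_iff_forall_isCompact hU).1 h _ hSU (isCompact_closedBall _ _)
  obtain ⟨n, hn, hnd, hn0⟩ := ((Metric.tendstoUniformlyOn_iff.1 hu _ (half_pos hm)).and
    (hd.and h0)).exists
  have hbd : ∀ z ∈ sphere w r, ‖(f n z)⁻¹‖ ≤ (‖g x‖ / 2)⁻¹ := fun z hz => by
    rw [norm_inv]
    refine inv_anti₀ (half_pos hm) ?_
    have h2 := hn z (hSc hz)
    have h3 : ‖g x‖ ≤ ‖g z‖ := hmin hz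
    rw [dist_eq_norm] at h2
    linarith [norm_sub_norm_le (g z) (f n z)]
  have hdiff : DiffContOnCl ℂ (fun z => (f n z)⁻¹) (ball w r) := by
    refine DifferentiableOn.diffContOnCl ?_
    rw [closure_ball _ hr.ne']
    exact (hnd.mono hSU).inv fun z hz => hn0 z (hSU hz)
  have h4 := Complex.norm_le_of_forall_mem_frontier_norm_le isBounded_ball hdiff
    (fun z hz => hbd z (by rwa [frontier_ball _ hr.ne'] at hz)) (subset_closure (mem_ball_self hr))
  have h5 := hn w (mem_closedBall_self hr.le)
  rw [hgw, dist_zero_left] at h5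
  rw [norm_inv, inv_le_inv₀ (norm_pos_iff.2 (hn0 w hw)) (half_pos hm)] at h4
  linarith

/-- Univalent maps of a domain into the unit disc whose image has connected complement. -/
structure DiscEmbedding (Ω : Set ℂ) (z₀ : ℂ) (F G : ℂ → ℂ) : Prop where
  diff : DifferentiableOn ℂ F Ω
  diff_inv : DifferentiableOn ℂ G (F '' Ω)
  leftInv : LeftInvOn G F Ω
  mapsTo : MapsTo F Ω (ball 0 1)
  base : F z₀ = 0
  compl : IsPreconnected (closedBall 0 1 \ F '' Ω)

variable {Ω : Set ℂ} {z₀ : ℂ}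

theorem isOpen_image_of_injOn (ho : IsOpen Ω) (hc : IsPreconnected Ω) {F : ℂ → ℂ}
    (hF : DifferentiableOn ℂ F Ω) (hi : InjOn F Ω) : IsOpen (F '' Ω) := by
  rcases (hF.analyticOnNhd ho).is_constant_or_isOpen hc with ⟨w, hw⟩ | h
  · rcases Ω.eq_empty_or_nonempty with rfl | ⟨z, hz⟩
    · simp
    obtain ⟨y, hy, hyz⟩ := (accPt_iff_nhds.1 (PerfectSpace.univ_preperfect z (mem_univ z))) Ω
      (ho.mem_nhds hz)
    exact absurd (hi hy.1 hz ((hw y hy.1).trans (hw z hz).symm)) hyz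
  · exact h Ω subset_rfl ho

theorem exists_discEmbedding (hb : Bornology.IsBounded Ω)
    (hE : IsPreconnected Ωᶜ) : ∃ F G, DiscEmbedding Ω z₀ F G ∧ deriv F z₀ ≠ 0 := by
  obtain ⟨R, hR, hR'⟩ := hb.subset_ball_lt 0 z₀
  have hRc : (R : ℂ) ≠ 0 := by exact_mod_cast hR.ne'
  have hd : ∀ z, HasDerivAt (fun z : ℂ => (z - z₀) / R) (1 / R) z := fun z =>
    ((hasDerivAt_id z).sub_const z₀).div_const (R : ℂ)
  refine ⟨fun z => (z - z₀) / R, fun z => z₀ + R * z, ⟨fun z _ =>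
    (hd z).differentiableAt.differentiableWithinAt, by fun_prop, fun z _ => ?_, fun z hz => ?_,
    by simp, ?_⟩, ?_⟩
  · simp only [mul_div_cancel₀ _ hRc]; ring
  · have := hR' hz
    rw [mem_ball, dist_eq_norm] at this
    rw [mem_ball, dist_zero_right, norm_div, Complex.norm_real, Real.norm_of_nonneg hR.le,
      div_lt_one hR]
    exact this
  · let ρ : ℂ → ℂ := fun z => z / (max 1 ‖z‖ : ℝ)
    have hm : ∀ z : ℂ, 0 < max 1 ‖z‖ := fun z => zero_lt_one.trans_le (le_max_left _ _)
    have hρ : Continuous ρ := by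
      refine continuous_id.div (by fun_prop) fun z => ?_
      exact_mod_cast (hm z).ne'
    have hin : ∀ y : ℂ, y ∈ (fun z => (z - z₀) / (R : ℂ)) '' Ω ↔ z₀ + R * y ∈ Ω := fun y => by
      constructor
      · rintro ⟨z, hz, rfl⟩
        dsimp only; rw [mul_div_cancel₀ _ hRc]; simpa using hz
      · exact fun h => ⟨_, h, by dsimp only; rw [add_sub_cancel_left, mul_div_cancel_left₀ _ hRc]⟩
    convert hE.image (fun z => ρ ((z - z₀) / R)) (by fun_prop) using 1
    ext y
    constructor
    · rintro ⟨hy, hy'⟩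
      have hy1 : ‖y‖ ≤ 1 := by simpa using hy
      refine ⟨z₀ + R * y, fun h => hy' ((hin y).2 h), ?_⟩
      simp only [ρ, add_sub_cancel_left, mul_div_cancel_left₀ _ hRc, max_eq_left hy1]
      simp
    · rintro ⟨z, hz, rfl⟩
      have hz' : (z - z₀) / R ∉ (fun z => (z - z₀) / (R : ℂ)) '' Ω := fun h => hz (by
        have := (hin _).1 h
        rwa [mul_div_cancel₀ _ hRc, add_sub_cancel] at this)
      rcases le_total ‖(z - z₀) / R‖ 1 with h | h
      · simp only [ρ, max_eq_left h]
        simpa using ⟨by simpa using h, by simpa using hz'⟩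
      · have h1 : ‖ρ ((z - z₀) / R)‖ = 1 := by
          simp only [ρ, max_eq_right h]
          rw [norm_div, Complex.norm_real, norm_norm, div_self (zero_lt_one.trans_le h).ne']
        refine ⟨by simpa using h1.le, fun h2 => ?_⟩
        have h3 := hR' ((hin _).1 h2)
        rw [mem_ball, dist_eq_norm, add_sub_cancel_left, norm_mul, h1, Complex.norm_real,
          Real.norm_of_nonneg hR.le] at h3
        linarith
  · rw [(hd z₀).deriv]
    exact one_div_ne_zero hRc


/-- Koebe's square root trick: a univalent map omitting a point of the disc can be improved. -/
theorem DiscEmbedding.exists_better (ho : IsOpen Ω) (hc : IsPreconnected Ω) (hz₀ : z₀ ∈ Ω)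
    {F G : ℂ → ℂ} (h : DiscEmbedding Ω z₀ F G) {w : ℂ} (hw : ‖w‖ < 1) (hwF : w ∉ F '' Ω) :
    ∃ F₂ G₂, DiscEmbedding Ω z₀ F₂ G₂ ∧
      ‖deriv F z₀‖ = 2 * √‖w‖ / (1 + ‖w‖) * ‖deriv F₂ z₀‖ := by
  have hFo := isOpen_image_of_injOn ho hc h.diff h.leftInv.injOn
  have hFb : F '' Ω ⊆ ball 0 1 := h.mapsTo.image_subset
  have hFc : F '' Ω ⊆ closedBall 0 1 := hFb.trans ball_subset_closedBall
  have hdF : DifferentiableOn ℂ (fun z => discMap w (F z)) Ω := fun z hz =>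
    (hasDerivAt_discMap hw
      (by simpa using hFc ⟨z, hz, rfl⟩)).differentiableAt.comp_differentiableWithinAt
      z (h.diff z hz)
  have hw' : ‖-w‖ < 1 := by rwa [norm_neg]
  have hinv1 : ∀ z ∈ Ω, discMap (-w) (discMap w (F z)) = F z := fun z hz =>
    discMap_neg_discMap hw (by simpa using hFc ⟨z, hz, rfl⟩)
  have himg : (fun z => discMap w (F z)) '' Ω = discMap w '' (F '' Ω) :=
    (image_image (discMap w) F Ω).symm
  set V := discMap w '' (F '' Ω) with hVdef
  have hVo : IsOpen V := by
    rw [← himg]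
    exact isOpen_image_of_injOn ho hc hdF (LeftInvOn.injOn (f₁' := G ∘ discMap (-w)) fun z hz => by
      simp only [Function.comp, hinv1 z hz, h.leftInv hz])
  have hVc : IsPreconnected V := by rw [← himg]; exact hc.image _ hdF.continuousOn
  have hVb : V ⊆ ball 0 1 := by
    rintro _ ⟨z, hz, rfl⟩; exact discMap_mem_ball hw (hFb hz)
  have hV0 : (0 : ℂ) ∉ V := by
    rintro ⟨z, hz, h0⟩
    have h1 := discMap_neg_discMap hw (show ‖z‖ ≤ 1 by simpa using hFc hz)
    rw [h0] at h1
    simp only [discMap, zero_sub, neg_neg, mul_zero, sub_zero, div_one] at h1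
    exact hwF (h1 ▸ hz)
  have hVE : IsPreconnected (closedBall 0 1 \ V) := isPreconnected_compl_discMap hw hFc h.compl
  obtain ⟨g, hg, hge⟩ := hasLog_id_of_compl_preconnected hVo hVc hVb hV0 hVE
  let s : ℂ → ℂ := fun z => Complex.exp (g z / 2)
  have hs : ContinuousOn s V := (hg.div_const 2).cexp
  have hsq : ∀ v ∈ V, s v ^ 2 = v := fun v hv => by
    refine Eq.trans ?_ (hge v hv)
    simp only [s]
    rw [← Complex.exp_nat_mul]
    congr 1
    push_cast
    ring
  have hs0 : ∀ v, s v ≠ 0 := fun v => Complex.exp_ne_zero _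
  have hds : DifferentiableOn ℂ s V := fun v hv =>
    (HasDerivAt.of_local_left_inverse (f := fun z : ℂ => z ^ 2) (hs.continuousAt (hVo.mem_nhds hv))
      (by simpa using hasDerivAt_pow 2 (s v)) (by simpa using hs0 v)
      (by filter_upwards [hVo.mem_nhds hv] with y hy using
        hsq y hy)).differentiableAt.differentiableWithinAt
  have hsb : ∀ v ∈ V, ‖s v‖ < 1 := fun v hv => by
    have h1 : ‖v‖ < 1 := by simpa using hVb hv
    rw [← hsq v hv, norm_pow] at h1
    exact (pow_lt_one_iff_of_nonneg (norm_nonneg _) two_ne_zero).1 h1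
  have hwV : -w ∈ V := ⟨0, ⟨z₀, hz₀, h.base⟩, by simp [discMap]⟩
  have hs2 : IsPreconnected (closedBall 0 1 \ s '' V) :=
    isPreconnected_compl_sqrt_image hVo hVc ⟨_, hwV⟩ hVb hV0 hVE hs hsq
  set a := s (-w) with ha
  have ha1 : ‖a‖ < 1 := hsb _ hwV
  have ha1' : ‖-a‖ < 1 := by rwa [norm_neg]
  have haw : a ^ 2 = -w := hsq _ hwV
  have hsV : s '' V ⊆ closedBall 0 1 := by
    rintro _ ⟨v, hv, rfl⟩; simpa using (hsb v hv).le
  have hFV : ∀ z ∈ Ω, discMap w (F z) ∈ V := fun z hz => ⟨_, ⟨z, hz, rfl⟩, rfl⟩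
  let F₂ : ℂ → ℂ := fun z => discMap a (s (discMap w (F z)))
  let Ψ : ℂ → ℂ := fun z => discMap (-w) (discMap (-a) z ^ 2)
  have hΨF : ∀ z ∈ Ω, Ψ (F₂ z) = F z := fun z hz => by
    simp only [Ψ, F₂]
    rw [discMap_neg_discMap ha1 (hsb _ (hFV z hz)).le, hsq _ (hFV z hz), hinv1 z hz]
  have hF₂b : ∀ z ∈ Ω, F₂ z ∈ ball (0 : ℂ) 1 := fun z hz =>
    discMap_mem_ball ha1 (by simpa using hsb _ (hFV z hz))
  have hΨd : ∀ z ∈ ball (0 : ℂ) 1, DifferentiableAt ℂ Ψ z := fun z hz => by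
    have h1 : ‖z‖ ≤ 1 := by simpa using ball_subset_closedBall hz
    have h2 : ‖discMap (-a) z‖ < 1 := by simpa using discMap_mem_ball ha1' hz
    have h3 : ‖discMap (-a) z ^ 2‖ ≤ 1 := by
      rw [norm_pow]; exact pow_le_one₀ (norm_nonneg _) h2.le
    exact (hasDerivAt_discMap hw' h3).differentiableAt.comp z
      ((hasDerivAt_discMap ha1' h1).differentiableAt.pow 2)
  have hF₂d : DifferentiableOn ℂ F₂ Ω := fun z hz =>
    DifferentiableAt.comp_differentiableWithinAt (g := discMap a)
      (f := fun z => s (discMap w (F z))) z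
      (hasDerivAt_discMap ha1 (hsb _ (hFV z hz)).le).differentiableAt ((hds.comp hdF hFV) z hz)
  have hF₂0 : F₂ z₀ = 0 := by
    simp only [F₂, h.base]
    simp [discMap, ha]
  refine ⟨F₂, G ∘ Ψ, ⟨hF₂d, ?_, fun z hz => ?_, hF₂b, hF₂0, ?_⟩, ?_⟩
  · refine h.diff_inv.comp (fun y hy => ?_) ?_
    · obtain ⟨z, hz, rfl⟩ := hy
      exact (hΨd _ (hF₂b z hz)).differentiableWithinAt
    · rintro _ ⟨z, hz, rfl⟩
      rw [hΨF z hz]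
      exact ⟨z, hz, rfl⟩
  · simp only [Function.comp, hΨF z hz, h.leftInv hz]
  · convert isPreconnected_compl_discMap ha1 hsV hs2 using 2
    simp only [hVdef, image_image, F₂]
  · have h1 : ‖(0 : ℂ)‖ ≤ 1 := by simp
    have e0 : discMap (-a) 0 = a := by simp [discMap]
    have d1 := hasDerivAt_discMap ha1' h1
    have d2 := d1.pow 2
    have h3 : ‖discMap (-a) 0 ^ 2‖ ≤ 1 := by rw [e0, haw]; exact hw'.le
    have d3 : HasDerivAt Ψ _ 0 :=
      HasDerivAt.comp (h₂ := discMap (-w)) (h := fun z => discMap (-a) z ^ 2) (0 : ℂ)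
        (hasDerivAt_discMap hw' h3) d2
    have d4 : HasDerivAt F₂ (deriv F₂ z₀) z₀ :=
      (hF₂d.differentiableAt (ho.mem_nhds hz₀)).hasDerivAt
    rw [← hF₂0] at d3
    have d5 := (d3.comp z₀ d4).congr_of_eventuallyEq
      (f₁ := F) (by filter_upwards [ho.mem_nhds hz₀] with z hz using (hΨF z hz).symm)
    rw [d5.deriv, norm_mul]
    congr 1
    rw [hF₂0, e0, haw]
    have n1 : ∀ z : ℂ, conj z * z = ((‖z‖ ^ 2 : ℝ) : ℂ) := fun z => by
      rw [mul_comm, Complex.mul_conj, Complex.normSq_eq_norm_sq]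
    have n2 : ‖a‖ ^ 2 = ‖w‖ := by rw [← norm_pow, haw, norm_neg]
    have n3 : ‖a‖ = √‖w‖ := by rw [← n2, Real.sqrt_sq (norm_nonneg _)]
    have n4 : ∀ t : ℝ, 0 ≤ t → ‖(1 : ℂ) - (t : ℂ)‖ = |1 - t| := fun t _ => by
      rw [← Complex.ofReal_one, ← Complex.ofReal_sub, Complex.norm_real, Real.norm_eq_abs]
    have p1 : 0 < 1 - ‖w‖ := by linarith
    have p2 : 0 < 1 - ‖w‖ ^ 2 := by nlinarith [norm_nonneg w]
    simp only [n1, norm_neg, n2, mul_zero, sub_zero, norm_mul, norm_div, norm_pow,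
      n4 _ (norm_nonneg w), n4 _ (sq_nonneg ‖w‖), abs_of_pos p1, abs_of_pos p2]
    simp only [n3]
    have p3 : (1 : ℝ) + ‖w‖ ≠ 0 := by positivity
    simp
    field_simp
    ring


/-- The Riemann mapping theorem for bounded domains with connected complement. -/
theorem exists_riemann_map (ho : IsOpen Ω) (hc : IsPreconnected Ω) (hb : Bornology.IsBounded Ω)
    (hz₀ : z₀ ∈ Ω) (hE : IsPreconnected Ωᶜ) :
    ∃ F G : ℂ → ℂ, DifferentiableOn ℂ F Ω ∧ DifferentiableOn ℂ G (ball 0 1) ∧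
      MapsTo F Ω (ball 0 1) ∧ MapsTo G (ball 0 1) Ω ∧ LeftInvOn G F Ω ∧
      LeftInvOn F G (ball 0 1) ∧ G 0 = z₀ := by
  obtain ⟨d, hd, hdΩ⟩ := Metric.isOpen_iff.1 ho z₀ hz₀
  let S : Set ℝ := {t | ∃ F G, DiscEmbedding Ω z₀ F G ∧ ‖deriv F z₀‖ = t}
  have hSb : BddAbove S := by
    refine ⟨1 / d, ?_⟩
    rintro _ ⟨F, G, h, rfl⟩
    refine Complex.norm_deriv_le_div_of_mapsTo_ball (h.diff.mono hdΩ) (fun z hz => ?_) hd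
    rw [h.base]
    exact ball_subset_closedBall (h.mapsTo (hdΩ hz))
  obtain ⟨F₀, G₀, h₀, hder₀⟩ := exists_discEmbedding (z₀ := z₀) hb hE
  have hS0 : 0 < sSup S := (norm_pos_iff.2 hder₀).trans_le (le_csSup hSb ⟨F₀, G₀, h₀, rfl⟩)
  obtain ⟨u, -, hu, huS⟩ := exists_seq_tendsto_sSup (S := S) ⟨_, F₀, G₀, h₀, rfl⟩ hSb
  choose F G hFG hder using huS
  have hcover : ∀ ρ < 1, ∀ᶠ n in atTop, ball 0 ρ ⊆ F n '' Ω := by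
    intro ρ hρ
    rcases le_or_gt ρ 0 with hρ0 | hρ0
    · exact Eventually.of_forall fun n => by rw [ball_eq_empty.2 hρ0]; exact empty_subset _
    have hq : √ρ < 1 := by rwa [Real.sqrt_lt' one_pos, one_pow]
    have hlt : 2 * √ρ / (1 + ρ) * sSup S < sSup S := by
      refine mul_lt_of_lt_one_left hS0 ?_
      rw [div_lt_one (by positivity)]
      nlinarith [Real.sq_sqrt hρ0.le, Real.sqrt_nonneg ρ, sq_pos_of_pos (sub_pos.2 hq)]
    filter_upwards [hu.eventually (lt_mem_nhds hlt)] with n hn w hw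
    by_contra hwF
    have hwρ : ‖w‖ < ρ := by simpa using hw
    obtain ⟨F₂, G₂, h₂, he⟩ := (hFG n).exists_better ho hc hz₀ (hwρ.trans hρ) hwF
    rw [hder] at he
    have h3 : ‖deriv F₂ z₀‖ ≤ sSup S := le_csSup hSb ⟨F₂, G₂, h₂, rfl⟩
    have h4 : 2 * √‖w‖ / (1 + ‖w‖) ≤ 2 * √ρ / (1 + ρ) := by
      rw [div_le_div_iff₀ (by positivity) (by positivity)]
      have e1 := Real.sq_sqrt hρ0.le
      have e2 := Real.sq_sqrt (norm_nonneg w)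
      have e3 := Real.sqrt_le_sqrt hwρ.le
      have e4 : √‖w‖ * √ρ ≤ 1 := by nlinarith [Real.sqrt_nonneg ‖w‖, Real.sqrt_nonneg ρ]
      nlinarith [mul_nonneg (sub_nonneg.2 e3) (sub_nonneg.2 e4)]
    have h5 : 2 * √‖w‖ / (1 + ‖w‖) * ‖deriv F₂ z₀‖ ≤ 2 * √ρ / (1 + ρ) * sSup S :=
      mul_le_mul h4 h3 (norm_nonneg _) (by positivity)
    linarith
  let φ : Ultrafilter ℕ := hyperfilter ℕ
  have hφ : (φ : Filter ℕ) ≤ atTop := Nat.hyperfilter_le_atTop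
  have hF := tendstoLocallyUniformlyOn_ultrafilter (φ := φ) (f := F) ho (M := 1)
    (Eventually.of_forall fun n => ⟨(hFG n).diff,
      fun z hz => ball_subset_closedBall ((hFG n).mapsTo hz)⟩)
  obtain ⟨M, hM⟩ := hb.subset_closedBall 0
  have hGmaps : ∀ n, MapsTo (G n) (F n '' Ω) Ω := fun n => by
    rintro _ ⟨z, hz, rfl⟩
    rwa [(hFG n).leftInv hz]
  have hFG' : ∀ n, ∀ y ∈ F n '' Ω, F n (G n y) = y := fun n => by
    rintro _ ⟨z, hz, rfl⟩
    rw [(hFG n).leftInv hz]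
  have hG : ∀ ρ < 1, TendstoLocallyUniformlyOn G (fun z => limUnder φ fun n => G n z) φ
      (ball 0 ρ) := fun ρ hρ => tendstoLocallyUniformlyOn_ultrafilter isOpen_ball (M := M)
    (((hcover ρ hρ).filter_mono hφ).mono fun n hn => ⟨(hFG n).diff_inv.mono hn,
      fun z hz => hM (hGmaps n (hn hz))⟩)
  set F' := fun z => limUnder φ fun n => F n z with hF'
  set G' := fun z => limUnder φ fun n => G n z with hG'
  have hexρ : ∀ w ∈ ball (0 : ℂ) 1, ∃ ρ < 1, w ∈ ball (0 : ℂ) ρ := fun w hw => by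
    obtain ⟨ρ, h1, h2⟩ := exists_between (show ‖w‖ < 1 by simpa using hw)
    exact ⟨ρ, h2, by simpa using h1⟩
  have hFd : DifferentiableOn ℂ F' Ω :=
    hF.differentiableOn (Eventually.of_forall fun n => (hFG n).diff) ho
  have hGdρ : ∀ ρ < 1, DifferentiableOn ℂ G' (ball 0 ρ) := fun ρ hρ =>
    (hG ρ hρ).differentiableOn (((hcover ρ hρ).filter_mono hφ).mono fun n hn =>
      (hFG n).diff_inv.mono hn) isOpen_ball
  have hGd : DifferentiableOn ℂ G' (ball 0 1) := fun w hw => by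
    obtain ⟨ρ, hρ, hwρ⟩ := hexρ w hw
    exact ((hGdρ ρ hρ).differentiableAt (isOpen_ball.mem_nhds hwρ)).differentiableWithinAt
  have hF0 : F' z₀ = 0 := by
    refine tendsto_nhds_unique (hF.tendsto_at hz₀) ?_
    simp only [(hFG _).base]
    exact tendsto_const_nhds
  have h0ball : (0 : ℂ) ∈ ball (0 : ℂ) (1 / 2) := mem_ball_self (by norm_num)
  have hG0 : G' 0 = z₀ := by
    refine tendsto_nhds_unique ((hG (1 / 2) (by norm_num)).tendsto_at h0ball) ?_
    refine tendsto_const_nhds.congr fun n => ?_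
    rw [← (hFG n).base, (hFG n).leftInv hz₀]
  have hFm : MapsTo F' Ω (ball 0 1) := by
    have hle : ∀ z ∈ Ω, ‖F' z‖ ≤ 1 := fun z hz =>
      le_of_tendsto (hF.tendsto_at hz).norm (Eventually.of_forall fun n => by
        simpa using ball_subset_closedBall ((hFG n).mapsTo hz))
    intro z hz
    by_contra hz1
    have h1 : ‖F' z‖ = 1 := le_antisymm (hle z hz) (by simpa using hz1)
    have h2 := Complex.norm_eqOn_of_isPreconnected_of_isMaxOn hc ho hFd hz
      (fun y hy => by simpa [h1] using hle y hy) hz₀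
    simp [hF0, h1] at h2
  have hGm : MapsTo G' (ball 0 1) Ω := by
    intro w hw
    by_contra hwΩ
    obtain ⟨ρ, hρ, hwρ⟩ := hexρ w hw
    have hev := eventually_eq_zero_of_tendstoLocallyUniformlyOn (φ := (φ : Filter ℕ))
      (f := fun n z => G n z - G' w) (g := fun z => G' z - G' w) isOpen_ball
      (((hcover ρ hρ).filter_mono hφ).mono fun n hn =>
        ((hFG n).diff_inv.mono hn).sub_const _)
      (((hcover ρ hρ).filter_mono hφ).mono fun n hn z hz h =>
        hwΩ (sub_eq_zero.1 h ▸ hGmaps n (hn hz)))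
      (by
        have h1 := hG ρ hρ
        rw [Metric.tendstoLocallyUniformlyOn_iff] at h1 ⊢
        simpa only [dist_sub_right] using h1) hwρ (sub_self _)
    have hρ0 : (0 : ℂ) ∈ ball (0 : ℂ) 1 := mem_ball_self one_pos
    have h2 := (hGd.analyticOnNhd isOpen_ball).eqOn_of_preconnected_of_eventuallyEq
      (g := fun _ => G' w) (fun _ _ => analyticAt_const)
      (convex_ball (0 : ℂ) 1).isPreconnected hw (hev.mono fun z hz => sub_eq_zero.1 hz) hρ0
    exact hwΩ ((show z₀ = G' w from hG0.symm.trans h2) ▸ hz₀)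
  refine ⟨F', G', hFd, hGd, hFm, hGm, fun z hz => ?_, fun w hw => ?_, hG0⟩
  · obtain ⟨ρ, hρ, hwρ⟩ := hexρ _ (hFm hz)
    have h1 := (hG ρ hρ).tendsto_comp (hGd.continuousOn.mono (ball_subset_ball hρ.le) _ hwρ) hwρ
      (tendsto_nhdsWithin_iff.2 ⟨hF.tendsto_at hz,
        (hF.tendsto_at hz).eventually (isOpen_ball.mem_nhds hwρ)⟩)
    refine tendsto_nhds_unique h1 (tendsto_const_nhds.congr fun n => ?_)
    exact ((hFG n).leftInv hz).symm
  · obtain ⟨ρ, hρ, hwρ⟩ := hexρ w hw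
    have h1 := hF.tendsto_comp (hFd.continuousOn _ (hGm hw)) (hGm hw)
      (tendsto_nhdsWithin_iff.2 ⟨(hG ρ hρ).tendsto_at hwρ,
        ((hG ρ hρ).tendsto_at hwρ).eventually (ho.mem_nhds (hGm hw))⟩)
    refine tendsto_nhds_unique h1 (tendsto_const_nhds.congr' ?_)
    filter_upwards [(hcover ρ hρ).filter_mono hφ] with n hn
    exact (hFG' n w (hn hwρ)).symm

end RiemannMappingExistence

section LengthArea
open Filter Topology Metric MeasureTheory
open scoped ENNReal

theorem lintegral_normSq_deriv {g : ℂ → ℂ} {U : Set ℂ} (hU : IsOpen U)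
    (hg : DifferentiableOn ℂ g U) (hi : InjOn g U) :
    ∫⁻ z in U, ENNReal.ofReal (‖deriv g z‖ ^ 2) = volume (g '' U) := by
  rw [← lintegral_abs_det_fderiv_eq_addHaar_image volume hU.measurableSet (f := g)
    (f' := fun z => (ContinuousLinearMap.toSpanSingleton ℂ (deriv g z)).restrictScalars ℝ)
    (fun z hz => ((hg.differentiableAt (hU.mem_nhds hz)).hasDerivAt.hasFDerivAt.restrictScalars
      ℝ).hasFDerivWithinAt) hi]
  congr 1
  ext z
  simp [ContinuousLinearMap.det, LinearMap.det_restrictScalars,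
      Algebra.norm_complex_eq, Complex.normSq_eq_norm_sq]

/-- A lower bound for the energy of a holomorphic map on a circular arc. -/
theorem le_lintegral_normSq_deriv_arc {g : ℂ → ℂ} {U : Set ℂ} (hU : IsOpen U)
    (hg : DifferentiableOn ℂ g U) {r α β ε : ℝ} (hr : 0 < r) (hαβ : α ≤ β)
    (hβ : β - α ≤ 2 * Real.pi) (hε : 0 ≤ ε) (hc : ∀ θ ∈ Icc α β, circleMap 0 r θ ∈ U)
    (hd : ε ≤ dist (g (circleMap 0 r β)) (g (circleMap 0 r α))) :
    ENNReal.ofReal (ε ^ 2 / (2 * Real.pi * r ^ 2)) ≤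
      ∫⁻ θ in Icc α β, ENNReal.ofReal (‖deriv g (circleMap 0 r θ)‖ ^ 2) := by
  have hpi := Real.pi_pos
  have hder : ∀ θ ∈ uIcc α β, HasDerivAt (fun θ => g (circleMap 0 r θ))
      (deriv g (circleMap 0 r θ) * (circleMap 0 r θ * Complex.I)) θ := fun θ hθ => by
    rw [uIcc_of_le hαβ] at hθ
    exact (hg.differentiableAt (hU.mem_nhds (hc θ hθ))).hasDerivAt.comp θ
      (hasDerivAt_circleMap 0 r θ)
  have hcont : ContinuousOn (fun θ => deriv g (circleMap 0 r θ)) (Icc α β) :=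
    (hg.deriv hU).continuousOn.comp (continuous_circleMap 0 r).continuousOn hc
  set k : ℝ → ℝ := fun θ => ‖deriv g (circleMap 0 r θ)‖ with hk
  have hkc : ContinuousOn k (Icc α β) := hcont.norm
  have hki : IntervalIntegrable k volume α β := by
    apply ContinuousOn.intervalIntegrable; rwa [uIcc_of_le hαβ]
  have hk2 : IntervalIntegrable (fun θ => k θ ^ 2) volume α β := by
    apply ContinuousOn.intervalIntegrable; rw [uIcc_of_le hαβ]; exact hkc.pow 2
  have hcont' : IntervalIntegrable
      (fun θ => deriv g (circleMap 0 r θ) * (circleMap 0 r θ * Complex.I)) volume α β := by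
    apply ContinuousOn.intervalIntegrable
    rw [uIcc_of_le hαβ]
    exact hcont.mul ((continuous_circleMap 0 r).mul continuous_const).continuousOn
  have h1 := intervalIntegral.integral_eq_sub_of_hasDerivAt hder hcont'
  have h2 : ε ≤ r * ∫ θ in α..β, k θ := by
    rw [dist_eq_norm, ← h1] at hd
    refine hd.trans ((intervalIntegral.norm_integral_le_integral_norm hαβ).trans_eq ?_)
    rw [← intervalIntegral.integral_const_mul]
    congr 1
    ext θ
    simp [hk, abs_of_pos hr, mul_comm]
  set c := ε / (2 * Real.pi * r) with hcdef
  have h3 : ∫ θ in α..β, (2 * c * k θ - c ^ 2) ≤ ∫ θ in α..β, k θ ^ 2 := by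
    refine intervalIntegral.integral_mono_on hαβ ((hki.const_mul _).sub intervalIntegrable_const)
      hk2 fun θ _ => ?_
    nlinarith [sq_nonneg (k θ - c)]
  rw [intervalIntegral.integral_sub (hki.const_mul _) intervalIntegrable_const,
    intervalIntegral.integral_const_mul, intervalIntegral.integral_const, smul_eq_mul] at h3
  rw [← ofReal_integral_eq_lintegral_ofReal, integral_Icc_eq_integral_Ioc,
    ← intervalIntegral.integral_of_le hαβ]
  · refine ENNReal.ofReal_le_ofReal (le_trans ?_ h3)
    have h4 : ε / r ≤ ∫ θ in α..β, k θ := by rw [div_le_iff₀ hr]; linarith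
    have h5 : 0 ≤ c := by positivity
    have h6 : ε ^ 2 / (2 * Real.pi * r ^ 2) = 2 * c * (ε / r) - 2 * Real.pi * c ^ 2 := by
      rw [hcdef]; field_simp; ring
    rw [h6]
    nlinarith [mul_le_mul_of_nonneg_left h4 h5, mul_le_mul_of_nonneg_right hβ (sq_nonneg c)]
  · rw [IntegrableOn.eq_def .. |>.symm]
    exact (intervalIntegrable_iff_integrableOn_Icc_of_le hαβ).1 hk2
  · exact Eventually.of_forall fun θ => sq_nonneg _

theorem lintegral_inv_eq_top {δ : ℝ} (hδ : 0 < δ) :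
    ∫⁻ r in Ioo 0 δ, ENNReal.ofReal r⁻¹ = ∞ := by
  by_contra h
  have h1 : IntegrableOn (fun x : ℝ => x⁻¹) (Ioo 0 δ) := by
    refine ⟨measurable_inv.aestronglyMeasurable, ?_⟩
    rw [hasFiniteIntegral_iff_ofReal]
    · exact lt_top_iff_ne_top.2 h
    · filter_upwards [ae_restrict_mem measurableSet_Ioo] with x hx using (inv_pos.2 hx.1).le
  have h2 : IntervalIntegrable (fun x : ℝ => x⁻¹) volume 0 δ :=
    (intervalIntegrable_iff_integrableOn_Ioo_of_le hδ.le).2 h1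
  rw [intervalIntegrable_inv_iff] at h2
  rcases h2 with h2 | h2
  · exact hδ.ne h2
  · exact h2 (by simp)

theorem circleMap_mem_ball_one {r θ : ℝ} (hr : 0 < r) :
    circleMap 0 r θ ∈ ball (1 : ℂ) 1 ↔ r / 2 < Real.cos θ := by
  rw [mem_ball, dist_eq_norm, ← sq_lt_one_iff₀ (norm_nonneg _), ← Complex.normSq_eq_norm_sq,
    Complex.normSq_apply]
  have h1 : (circleMap 0 r θ).re = r * Real.cos θ := by
    simp [circleMap, Complex.exp_ofReal_mul_I_re]
  have h2 : (circleMap 0 r θ).im = r * Real.sin θ := by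
    simp [circleMap, Complex.exp_ofReal_mul_I_im]
  simp only [Complex.sub_re, Complex.sub_im, h1, h2, Complex.one_re, Complex.one_im, sub_zero]
  have h3 : (r * Real.cos θ - 1) * (r * Real.cos θ - 1) + r * Real.sin θ * (r * Real.sin θ) =
      r ^ 2 - 2 * r * Real.cos θ + 1 := by
    have := Real.sin_sq_add_cos_sq θ
    linear_combination r ^ 2 * this
  rw [h3]
  constructor
  · intro h; by_contra h'; push Not at h'; nlinarith
  · intro h; nlinarith

theorem circleMap_arc_mem_ball_one {r α β θ : ℝ} (hr : 0 < r) (hα : -Real.pi ≤ α)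
    (hβ : β ≤ Real.pi) (h1 : circleMap 0 r α ∈ ball (1 : ℂ) 1)
    (h2 : circleMap 0 r β ∈ ball (1 : ℂ) 1) (hθ : θ ∈ Icc α β) :
    circleMap 0 r θ ∈ ball (1 : ℂ) 1 := by
  rw [circleMap_mem_ball_one hr] at *
  rcases le_total 0 θ with h | h
  · exact h2.trans_le (Real.cos_le_cos_of_nonneg_of_le_pi h hβ hθ.2)
  · rw [← Real.cos_neg α] at h1
    rw [← Real.cos_neg θ]
    exact h1.trans_le (Real.cos_le_cos_of_nonneg_of_le_pi (by linarith) (by linarith)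
      (by linarith [hθ.1]))

/-- The length-area principle: some small circular crosscuts have small images. -/
theorem exists_small_crosscut_one {g : ℂ → ℂ} (hg : DifferentiableOn ℂ g (ball 1 1))
    (hi : InjOn g (ball 1 1)) (hb : Bornology.IsBounded (g '' ball 1 1)) {ε δ : ℝ} (hε : 0 < ε)
    (hδ : 0 < δ) : ∃ r ∈ Ioo 0 δ, ∀ z ∈ ball (1 : ℂ) 1 ∩ sphere 0 r,
      ∀ w ∈ ball (1 : ℂ) 1 ∩ sphere 0 r, dist (g z) (g w) ≤ ε := by
  by_contra! hcon
  have hpi := Real.pi_pos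
  let f : ℂ → ℝ≥0∞ := (ball (1 : ℂ) 1).indicator fun z => ENNReal.ofReal (‖deriv g z‖ ^ 2)
  have hfm : Measurable f :=
    (((measurable_deriv g).norm.pow_const 2).ennreal_ofReal).indicator measurableSet_ball
  have hfin : ∫⁻ z, f z < ∞ := by
    rw [lintegral_indicator measurableSet_ball, lintegral_normSq_deriv isOpen_ball hg hi]
    exact hb.measure_lt_top
  have hpol : ∀ p : ℝ × ℝ, Complex.polarCoord.symm p = circleMap 0 p.1 p.2 := fun p => by
    rw [Complex.polarCoord_symm_apply, circleMap, Complex.exp_mul_I, zero_add]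
    simp
  have hcm : Measurable fun p : ℝ × ℝ => circleMap 0 p.1 p.2 := by
    unfold circleMap; fun_prop
  have key : ∀ r ∈ Ioo 0 δ, ENNReal.ofReal (ε ^ 2 / (2 * Real.pi * r ^ 2)) ≤
      ∫⁻ θ in Ioo (-Real.pi) Real.pi, f (circleMap 0 r θ) := by
    intro r hr
    obtain ⟨z, hz, w, hw, hzw⟩ := hcon r hr
    have harg : ∀ z ∈ ball (1 : ℂ) 1 ∩ sphere 0 r, ∃ α ∈ Ioo (-Real.pi) Real.pi,
        circleMap 0 r α = z := fun z hz => by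
      have hnz : ‖z‖ = r := by simpa using hz.2
      have hz' : circleMap 0 r (Complex.arg z) = z := by
        rw [circleMap, zero_add, ← hnz, Complex.norm_mul_exp_arg_mul_I]
      refine ⟨Complex.arg z, ⟨Complex.neg_pi_lt_arg z, lt_of_le_of_ne (Complex.arg_le_pi z)
        fun h => ?_⟩, hz'⟩
      have h1 := hz.1
      rw [← hz', circleMap_mem_ball_one hr.1, h, Real.cos_pi] at h1
      linarith [hr.1]
    have main : ∀ α ∈ Ioo (-Real.pi) Real.pi, ∀ β ∈ Ioo (-Real.pi) Real.pi, α ≤ β →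
        circleMap 0 r α ∈ ball (1 : ℂ) 1 → circleMap 0 r β ∈ ball (1 : ℂ) 1 →
        ε < dist (g (circleMap 0 r β)) (g (circleMap 0 r α)) →
        ENNReal.ofReal (ε ^ 2 / (2 * Real.pi * r ^ 2)) ≤
          ∫⁻ θ in Ioo (-Real.pi) Real.pi, f (circleMap 0 r θ) := by
      intro α hα β hβ hαβ h1 h2 hd
      have hmem := fun θ => circleMap_arc_mem_ball_one (θ := θ) hr.1 hα.1.le hβ.2.le h1 h2
      refine (le_lintegral_normSq_deriv_arc isOpen_ball hg hr.1 hαβ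
        (by linarith [hα.1, hβ.2]) hε.le hmem hd.le).trans ?_
      refine le_trans (setLIntegral_mono' measurableSet_Icc fun θ hθ => ?_)
        (lintegral_mono_set (Icc_subset_Ioo hα.1 hβ.2))
      simp only [f, indicator_of_mem (hmem θ hθ), le_refl]
    obtain ⟨α, hα, rfl⟩ := harg z hz
    obtain ⟨β, hβ, rfl⟩ := harg w hw
    rcases le_total α β with h | h
    · exact main α hα β hβ h hz.1 hw.1 (by rwa [dist_comm])
    · exact main β hβ α hα h hw.1 hz.1 hzw
  have h1 := Complex.lintegral_comp_polarCoord_symm f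
  rw [polarCoord_target, Measure.volume_eq_prod, ← Measure.prod_restrict, lintegral_prod] at h1
  swap
  · simp only [hpol]
    exact ((measurable_fst.ennreal_ofReal).mul (hfm.comp hcm)).aemeasurable
  have h2 : ∫⁻ r in Ioo 0 δ, ENNReal.ofReal (ε ^ 2 / (2 * Real.pi)) * ENNReal.ofReal r⁻¹ ≤
      ∫⁻ z, f z := by
    rw [← h1]
    refine le_trans (setLIntegral_mono' measurableSet_Ioo fun r hr => ?_)
      (lintegral_mono_set Ioo_subset_Ioi_self)
    simp only [hpol, smul_eq_mul]
    rw [lintegral_const_mul]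
    · refine le_trans (le_of_eq ?_) (mul_le_mul_right (key r hr) _)
      rw [← ENNReal.ofReal_mul (by positivity), ← ENNReal.ofReal_mul hr.1.le]
      congr 1
      have := hr.1.ne'
      field_simp
    · exact hfm.comp (hcm.comp (measurable_const.prodMk measurable_id))
  rw [lintegral_const_mul _ (measurable_inv.ennreal_ofReal), lintegral_inv_eq_top hδ,
    ENNReal.mul_top (by simpa using by positivity)] at h2
  exact (h2.trans_lt hfin).false

end LengthArea

section Caratheodory
open Filter Topology Metric

/-- A Riemann map `G`, with inverse `F`, onto a bounded component of the complement of the Jordan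
curve `Γ`. -/
structure JordanRiemann (Γ : Circle → ℂ) (F G : ℂ → ℂ) : Prop where
  cont : Continuous Γ
  inj : Function.Injective Γ
  mem : G 0 ∈ (range Γ)ᶜ
  bdd : Bornology.IsBounded (connectedComponentIn (range Γ)ᶜ (G 0))
  diffF : DifferentiableOn ℂ F (connectedComponentIn (range Γ)ᶜ (G 0))
  diffG : DifferentiableOn ℂ G (ball 0 1)
  mapsF : MapsTo F (connectedComponentIn (range Γ)ᶜ (G 0)) (ball 0 1)
  mapsG : MapsTo G (ball 0 1) (connectedComponentIn (range Γ)ᶜ (G 0))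
  leftInv : LeftInvOn G F (connectedComponentIn (range Γ)ᶜ (G 0))
  rightInv : LeftInvOn F G (ball 0 1)

theorem isPreconnected_compl_component {Γ : Circle → ℂ} (hΓ : Continuous Γ)
    (hi : Function.Injective Γ) (p : ℂ) :
    IsPreconnected (connectedComponentIn (range Γ)ᶜ p)ᶜ := by
  have hK : IsCompact (range Γ) := isCompact_range hΓ
  have hJ : range Γ ⊆ (connectedComponentIn (range Γ)ᶜ p)ᶜ := fun x hx hx' =>
    connectedComponentIn_subset _ _ hx' hx
  have hconn : ∀ q ∈ (range Γ)ᶜ,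
      IsPreconnected (connectedComponentIn (range Γ)ᶜ q ∪ range Γ) := fun q hq =>
    isPreconnected_connectedComponentIn.subset_closure subset_union_left
      (union_subset subset_closure (range_subset_closure_component hΓ hi hq))
  have hdis : ∀ q ∈ (range Γ)ᶜ, q ∉ connectedComponentIn (range Γ)ᶜ p →
      connectedComponentIn (range Γ)ᶜ q ∪ range Γ ⊆ (connectedComponentIn (range Γ)ᶜ p)ᶜ := by
    intro q hq hqp
    refine union_subset (fun x hx hx' => hqp ?_) hJ
    rw [connectedComponentIn_eq hx', ← connectedComponentIn_eq hx]
    exact mem_connectedComponentIn hq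
  refine isPreconnected_of_forall (Γ 1) fun y hy => ?_
  by_cases hyJ : y ∈ range Γ
  · exact ⟨range Γ, hJ, ⟨1, rfl⟩, hyJ, isPreconnected_range hΓ⟩
  · exact ⟨_, hdis y hyJ hy, Or.inr ⟨1, rfl⟩, Or.inl (mem_connectedComponentIn hyJ), hconn y hyJ⟩

theorem exists_jordanRiemann {Γ : Circle → ℂ} (hΓ : Continuous Γ)
    (hi : Function.Injective Γ) {p : ℂ} (hp : p ∈ (range Γ)ᶜ)
    (hb : Bornology.IsBounded (connectedComponentIn (range Γ)ᶜ p)) :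
    ∃ F G, JordanRiemann Γ F G ∧ G 0 = p := by
  obtain ⟨F, G, h1, h2, h3, h4, h5, h6, h7⟩ := exists_riemann_map
    ((isCompact_range hΓ).isClosed.isOpen_compl.connectedComponentIn (x := p))
    isPreconnected_connectedComponentIn hb (mem_connectedComponentIn hp)
    (isPreconnected_compl_component hΓ hi p)
  refine ⟨F, G, ?_, h7⟩
  subst h7
  exact ⟨hΓ, hi, hp, hb, h1, h2, h3, h4, h5, h6⟩

theorem exists_local_arcs {Γ : Circle → ℂ} (hΓ : Continuous Γ) (hi : Function.Injective Γ) {ε : ℝ}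
    (hε : 0 < ε) : ∃ δ > 0, ∀ y ∈ range Γ, ∃ β ⊆ range Γ, IsCompact β ∧ IsPreconnected β ∧
      range Γ ∩ closedBall y δ ⊆ β ∧ β ⊆ closedBall y ε := by
  have huc := CompactSpace.uniformContinuous_of_continuous hΓ
  obtain ⟨η, hη, h1⟩ := Metric.uniformContinuous_iff.1 huc ε hε
  have hexp : ∀ᶠ t in 𝓝 (0 : ℝ), dist (Circle.exp t) 1 < η := by
    have : Tendsto Circle.exp (𝓝 0) (𝓝 1) := by
      simpa using Circle.exp.continuous.tendsto 0
    exact this.eventually (ball_mem_nhds _ hη)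
  obtain ⟨τ, hτ, h2⟩ := Metric.eventually_nhds_iff.1 hexp
  have harg : ∀ᶠ c : Circle in 𝓝 1, |Complex.arg (c : ℂ)| ≤ τ / 2 := by
    have h : ContinuousAt (fun c : Circle => |Complex.arg (c : ℂ)|) 1 := by
      refine continuous_abs.continuousAt.comp ?_
      exact ContinuousAt.comp (g := Complex.arg) (f := fun c : Circle => (c : ℂ))
        (Complex.continuousAt_arg (by simp)) continuous_subtype_val.continuousAt
    have h' : Tendsto (fun c : Circle => |Complex.arg (c : ℂ)|) (𝓝 1) (𝓝 0) := by
      simpa [ContinuousAt] using h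
    exact (h'.eventually (gt_mem_nhds (half_pos hτ))).mono fun c hc => hc.le
  obtain ⟨s, hs, h3⟩ := Metric.eventually_nhds_iff.1 harg
  obtain ⟨δ, hδ, h4⟩ := Metric.uniformContinuousOn_iff.1
    ((isCompact_range hΓ).uniformContinuousOn_of_continuous (continuousOn_invFun_range hΓ hi)) s hs
  have hmul : ∀ c t : Circle, dist (c * t) c = dist t 1 := fun c t => by
    change dist ((c * t : Circle) : ℂ) c = dist (t : ℂ) (1 : Circle)
    rw [dist_eq_norm, dist_eq_norm, Circle.coe_mul,
      ← mul_sub_one, norm_mul, Circle.norm_coe, one_mul, Circle.coe_one]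
  refine ⟨δ / 2, half_pos hδ, ?_⟩
  rintro _ ⟨c, rfl⟩
  have hcont : Continuous fun t : ℝ => Γ (c * Circle.exp t) :=
    hΓ.comp (continuous_const.mul Circle.exp.continuous)
  refine ⟨(fun t : ℝ => Γ (c * Circle.exp t)) '' Icc (-(τ / 2)) (τ / 2), ?_,
    isCompact_Icc.image hcont, isPreconnected_Icc.image _ hcont.continuousOn, ?_, ?_⟩
  · rintro _ ⟨t, -, rfl⟩
    exact mem_range_self _
  · rintro _ ⟨⟨c', rfl⟩, hc'⟩
    have := h4 (Γ c') (mem_range_self _) (Γ c) (mem_range_self _)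
      ((mem_closedBall.1 hc').trans_lt (half_lt_self hδ))
    rw [Function.leftInverse_invFun hi, Function.leftInverse_invFun hi] at this
    have h5 := h3 (y := c⁻¹ * c') (by rwa [← hmul c, mul_inv_cancel_left])
    refine ⟨Complex.arg (c⁻¹ * c' : Circle), abs_le.1 h5, ?_⟩
    simp only [Circle.exp_arg, mul_inv_cancel_left]
  · rintro _ ⟨t, ht, rfl⟩
    refine mem_closedBall.2 (h1 ?_).le
    rw [hmul]
    refine h2 ?_
    rw [dist_zero_right, Real.norm_eq_abs]
    exact (abs_le.2 ht).trans_lt (half_lt_self hτ)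

namespace JordanRiemann

variable {Γ : Circle → ℂ} {F G : ℂ → ℂ}

theorem isOpen_component (h : JordanRiemann Γ F G) :
    IsOpen (connectedComponentIn (range Γ)ᶜ (G 0)) :=
  (isCompact_range h.cont).isClosed.isOpen_compl.connectedComponentIn

theorem image_ball (h : JordanRiemann Γ F G) :
    G '' ball 0 1 = connectedComponentIn (range Γ)ᶜ (G 0) :=
  Subset.antisymm h.mapsG.image_subset fun z hz => ⟨F z, h.mapsF hz, h.leftInv hz⟩

theorem injOn (h : JordanRiemann Γ F G) : InjOn G (ball 0 1) := h.rightInv.injOn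

theorem exists_small_crosscut (h : JordanRiemann Γ F G) {ζ : ℂ} (hζ : ‖ζ‖ = 1) {ε δ : ℝ}
    (hε : 0 < ε) (hδ : 0 < δ) : ∃ r ∈ Ioo 0 δ, ∀ z ∈ ball (0 : ℂ) 1 ∩ sphere ζ r,
      ∀ w ∈ ball (0 : ℂ) 1 ∩ sphere ζ r, dist (G z) (G w) ≤ ε := by
  have hζ0 : ζ ≠ 0 := by rintro rfl; simp at hζ
  have hmaps : MapsTo (fun z => ζ * (1 - z)) (ball 1 1) (ball 0 1) := by
    intro z hz
    rw [mem_ball_zero_iff, norm_mul, hζ, one_mul, norm_sub_rev]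
    rwa [mem_ball, dist_eq_norm] at hz
  obtain ⟨r, hr, H⟩ := exists_small_crosscut_one (g := fun z => G (ζ * (1 - z)))
    (h.diffG.comp (by fun_prop) hmaps)
    (h.injOn.comp (fun a _ b _ hab => by simpa [hζ0] using hab) hmaps)
    (h.bdd.subset (by rintro _ ⟨z, hz, rfl⟩; exact h.mapsG (hmaps hz))) hε hδ
  have key : ∀ z ∈ ball (0 : ℂ) 1 ∩ sphere ζ r, 1 - z / ζ ∈ ball (1 : ℂ) 1 ∩ sphere 0 r ∧
      ζ * (1 - (1 - z / ζ)) = z := by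
    rintro z ⟨h1, h2⟩
    refine ⟨⟨?_, ?_⟩, by field_simp; ring⟩
    · rw [mem_ball, dist_eq_norm]
      simpa [hζ] using h1
    · rw [mem_sphere_zero_iff_norm]
      rw [mem_sphere, dist_eq_norm] at h2
      rw [← h2, show 1 - z / ζ = -(z - ζ) / ζ by field_simp; ring, norm_div, hζ, norm_neg, div_one]
  refine ⟨r, hr, fun z hz w hw => ?_⟩
  have := H _ (key z hz).1 _ (key w hw).1
  rwa [(key z hz).2, (key w hw).2] at this

theorem mem_range_of_tendsto (h : JordanRiemann Γ F G) {u : Filter ℂ} [u.NeBot] {p y : ℂ}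
    (hu : u ≤ 𝓝 p) (hu' : ball 0 1 ∈ u) (hp : p ∉ ball (0 : ℂ) 1) (hy : Tendsto G u (𝓝 y)) :
    y ∈ range Γ := by
  have hcl : y ∈ closure (connectedComponentIn (range Γ)ᶜ (G 0)) :=
    mem_closure_of_tendsto hy (by filter_upwards [hu'] with z hz using h.mapsG hz)
  refine (closure_connectedComponentIn_subset (isCompact_range h.cont).isClosed _ hcl).resolve_left
    fun hy' => hp ?_
  have h1 : Tendsto (fun z => F (G z)) u (𝓝 (F y)) :=
    ((h.diffF.differentiableAt (h.isOpen_component.mem_nhds hy')).continuousAt.tendsto).comp hy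
  have h2 : Tendsto (fun z => F (G z)) u (𝓝 p) :=
    (tendsto_id'.2 hu).congr' (by filter_upwards [hu'] with z hz using (h.rightInv hz).symm)
  rw [tendsto_nhds_unique h2 h1]
  exact h.mapsF hy'

end JordanRiemann

end Caratheodory

section CaratheodoryExtension
open Filter Topology Metric
namespace JordanRiemann

variable {Γ : Circle → ℂ} {F G : ℂ → ℂ}

theorem exists_closure_crosscut (h : JordanRiemann Γ F G) {ζ : ℂ} (hζ : ‖ζ‖ = 1) {r : ℝ}
    (hr : 0 < r) (hr1 : r < 1) :
    ∃ y ∈ range Γ, y ∈ closure (G '' (ball 0 1 ∩ sphere ζ r)) := by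
  set θ₀ := Real.arccos (r / 2) with hθ₀
  have hcos : Real.cos θ₀ = r / 2 := Real.cos_arccos (by linarith) (by linarith)
  have hθpos : 0 < θ₀ := Real.arccos_pos.2 (by linarith)
  let f : ℝ → ℂ := fun θ => ζ * (1 - circleMap 0 r θ)
  have hf : Continuous f := continuous_const.mul (continuous_const.sub (continuous_circleMap 0 r))
  have hfball : ∀ θ, f θ ∈ ball (0 : ℂ) 1 ↔ r / 2 < Real.cos θ := fun θ => by
    rw [← circleMap_mem_ball_one hr, mem_ball_zero_iff, mem_ball, dist_eq_norm, norm_mul, hζ,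
      one_mul, norm_sub_rev]
  have hfs : ∀ θ, f θ ∈ sphere ζ r := fun θ => by
    rw [mem_sphere, dist_eq_norm, show f θ - ζ = -(ζ * circleMap 0 r θ) by simp only [f]; ring,
      norm_neg, norm_mul, hζ, one_mul, norm_circleMap_zero, abs_of_pos hr]
  have hev : ∀ᶠ θ in 𝓝[<] θ₀, f θ ∈ ball (0 : ℂ) 1 ∩ sphere ζ r := by
    filter_upwards [Ioo_mem_nhdsLT hθpos] with θ hθ
    refine ⟨(hfball θ).2 ?_, hfs θ⟩
    rw [← hcos]
    exact Real.cos_lt_cos_of_nonneg_of_le_pi hθ.1.le (Real.arccos_le_pi _) hθ.2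
  obtain ⟨u, hu⟩ := Ultrafilter.exists_le (map f (𝓝[<] θ₀))
  have hu1 : ball (0 : ℂ) 1 ∩ sphere ζ r ∈ (u : Filter ℂ) := hu hev
  have hu2 : ball (0 : ℂ) 1 ∈ (u : Filter ℂ) := mem_of_superset hu1 inter_subset_left
  obtain ⟨M, hM⟩ := h.bdd.subset_closedBall 0
  have hlim := tendsto_limUnder_ultrafilter (φ := u) (f := G) (M := M)
    (by filter_upwards [hu2] with z hz using hM (h.mapsG hz))
  refine ⟨_, h.mem_range_of_tendsto (p := f θ₀) (hu.trans ?_) hu2 ?_ hlim,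
    mem_closure_of_tendsto hlim (by filter_upwards [hu1] with z hz using mem_image_of_mem _ hz)⟩
  · exact (hf.tendsto θ₀).mono_left nhdsWithin_le_nhds
  · rw [hfball, hcos]
    exact lt_irrefl _

theorem exists_ball_image_subset (h : JordanRiemann Γ F G) {ζ : ℂ} (hζ : ‖ζ‖ = 1) {ε : ℝ}
    (hε : 0 < ε) : ∃ r > 0, ∃ y, ∀ z ∈ ball (0 : ℂ) 1 ∩ ball ζ r, dist (G z) y ≤ ε := by
  wlog hsmall : ε < dist (G 0) (G (-ζ / 2)) / 2 generalizing ε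
  · have h0 : 0 < dist (G 0) (G (-ζ / 2)) := by
      refine dist_pos.2 fun heq => ?_
      have := h.injOn (by simp) (by simp [hζ]; norm_num) heq
      have hζ0 : ζ ≠ 0 := by rintro rfl; simp at hζ
      exact hζ0 (by linear_combination 2 * this)
    obtain ⟨r, hr, y, H⟩ := this (ε := dist (G 0) (G (-ζ / 2)) / 4) (by positivity) (by linarith)
    exact ⟨r, hr, y, fun z hz => (H z hz).trans (by linarith)⟩
  obtain ⟨δ₀, hδ₀, harcs⟩ := exists_local_arcs h.cont h.inj hε
  obtain ⟨r, ⟨hr, hr1⟩, hcross⟩ := h.exists_small_crosscut hζ (lt_min hδ₀ hε) one_pos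
  obtain ⟨y, hyJ, hyc⟩ := h.exists_closure_crosscut hζ hr hr1
  obtain ⟨β, hβJ, hβc, hβp, hβ1, hβ2⟩ := harcs y hyJ
  set c := G '' (ball 0 1 ∩ sphere ζ r) with hc
  have hccl : closure c ⊆ closedBall y (min δ₀ ε) := by
    have h1 : ∀ a ∈ closure c, ∀ b ∈ c, dist b a ≤ min δ₀ ε := by
      rintro a ha _ ⟨w, hw, rfl⟩
      refine closure_minimal (t := closedBall (G w) (min δ₀ ε)) ?_ isClosed_closedBall ha |>
        fun h => by simpa [dist_comm] using h
      rintro _ ⟨z, hz, rfl⟩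
      exact hcross z hz w hw
    exact closure_minimal (fun b hb => h1 y hyc b hb) isClosed_closedBall
  refine ⟨r, hr, y, fun z hz => ?_⟩
  by_contra! hzy
  obtain ⟨w, hw, hwr, hwy⟩ : ∃ w ∈ ball (0 : ℂ) 1, r < dist w ζ ∧ ε < dist (G w) y := by
    by_cases hG0 : ε < dist (G 0) y
    · exact ⟨0, by simp, by simpa [hζ] using hr1, hG0⟩
    · refine ⟨-ζ / 2, by simp [hζ]; norm_num, ?_, ?_⟩
      · rw [dist_eq_norm, show -ζ / 2 - ζ = -(3 / 2) * ζ by ring, norm_mul, hζ]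
        norm_num
        linarith
      · have := dist_triangle_right (G 0) (G (-ζ / 2)) y
        linarith [not_lt.1 hG0]
  have hK : closure c ∪ β ⊆ closedBall y ε :=
    union_subset (hccl.trans (closedBall_subset_closedBall (min_le_right _ _))) hβ2
  have hJK : range Γ ∩ (closure c ∪ β) = β := by
    refine Subset.antisymm ?_ fun a ha => ⟨hβJ ha, Or.inr ha⟩
    rintro a ⟨haJ, ha | ha⟩
    · exact hβ1 ⟨haJ, closedBall_subset_closedBall (min_le_left _ _) (hccl ha)⟩
    · exact ha
  have hKc : IsCompact (closure c ∪ β) :=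
    ((isCompact_closedBall y _).of_isClosed_subset isClosed_closure hccl).union hβc
  have hout : ∀ a, ε < dist a y → a ∈ (closure c ∪ β)ᶜ := fun a ha haK =>
    ha.not_ge (hK haK)
  have hpre : IsPreconnected (closedBall y ε)ᶜ := by
    have := (isPreconnected_compl_closedBall hε).image (fun z => z + y) (by fun_prop)
    convert this using 1
    ext a
    simp [dist_eq_norm]
  have hsub : (closedBall y ε)ᶜ ⊆ (closure c ∪ β)ᶜ := compl_subset_compl.2 hK
  have hΩz := h.mapsG hz.1
  have hΩw := h.mapsG hw
  have hΩeq := connectedComponentIn_eq hΩz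
  have hmem := mem_component_union (isCompact_range h.cont) hKc (hJK.symm ▸ hβp)
    (p := G z) (q := G w)
    (fun h' => h'.elim (connectedComponentIn_subset _ _ hΩz) (hout _ hzy))
    (fun h' => h'.elim (connectedComponentIn_subset _ _ hΩw) (hout _ hwy))
    (hΩeq ▸ hΩw)
    (hpre.subset_connectedComponentIn (by simpa using hzy) hsub (by simpa using hwy))
  set E := connectedComponentIn (range Γ ∪ (closure c ∪ β))ᶜ (G z) with hE
  have hEsub : E ⊆ (range Γ ∪ (closure c ∪ β))ᶜ := connectedComponentIn_subset _ _
  have hzE : G z ∈ E := mem_connectedComponentIn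
    (fun h' => h'.elim (connectedComponentIn_subset _ _ hΩz) (hout _ hzy))
  have hEΩ : E ⊆ connectedComponentIn (range Γ)ᶜ (G 0) := by
    rw [hΩeq]
    exact isPreconnected_connectedComponentIn.subset_connectedComponentIn hzE
      (hEsub.trans (compl_subset_compl.2 subset_union_left))
  have hFE : IsPreconnected (F '' E) :=
    isPreconnected_connectedComponentIn.image F (h.diffF.continuousOn.mono hEΩ)
  have hd : IsPreconnected ((fun a => dist a ζ) '' (F '' E)) := hFE.image _ (by fun_prop)
  have hz' : dist z ζ ∈ (fun a => dist a ζ) '' (F '' E) := ⟨z, ⟨G z, hzE, h.rightInv hz.1⟩, rfl⟩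
  have hw' : dist w ζ ∈ (fun a => dist a ζ) '' (F '' E) := ⟨w, ⟨G w, hmem, h.rightInv hw⟩, rfl⟩
  obtain ⟨_, ⟨e, he, rfl⟩, her⟩ := hd.ordConnected.out hz' hw' ⟨(mem_ball.1 hz.2).le, hwr.le⟩
  refine hEsub he (Or.inr (Or.inl (subset_closure ⟨F e, ⟨h.mapsF (hEΩ he), her⟩, ?_⟩)))
  exact h.leftInv (hEΩ he)

theorem exists_tendsto (h : JordanRiemann Γ F G) {ζ : ℂ} (hζ : ζ ∈ closedBall (0 : ℂ) 1) :
    ∃ y, Tendsto G (𝓝[ball 0 1] ζ) (𝓝 y) := by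
  by_cases hb : ζ ∈ ball (0 : ℂ) 1
  · exact ⟨G ζ, h.diffG.continuousOn ζ hb⟩
  have hζ1 : ‖ζ‖ = 1 :=
    le_antisymm (mem_closedBall_zero_iff.1 hζ) (not_lt.1 fun h' => hb (mem_ball_zero_iff.2 h'))
  have hne : (𝓝[ball (0 : ℂ) 1] ζ).NeBot := by
    rw [← mem_closure_iff_nhdsWithin_neBot, closure_ball _ one_ne_zero]
    exact hζ
  refine CompleteSpace.complete (f := map G (𝓝[ball 0 1] ζ)) (Metric.cauchy_iff.2
    ⟨inferInstance, fun ε hε => ?_⟩)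
  obtain ⟨r, hr, y, H⟩ := h.exists_ball_image_subset hζ1 (ε := ε / 3) (by positivity)
  refine ⟨G '' (ball 0 1 ∩ ball ζ r), image_mem_map ?_, ?_⟩
  · exact inter_mem self_mem_nhdsWithin (mem_nhdsWithin_of_mem_nhds (ball_mem_nhds _ hr))
  · rintro _ ⟨a, ha, rfl⟩ _ ⟨b, hb, rfl⟩
    have := dist_triangle_right (G a) (G b) y
    linarith [H a ha, H b hb]

theorem continuousOn_extendFrom_closedBall (h : JordanRiemann Γ F G) :
    ContinuousOn (extendFrom (ball 0 1) G) (closedBall 0 1) :=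
  continuousOn_extendFrom (closure_ball (0 : ℂ) one_ne_zero).ge fun _ => h.exists_tendsto

theorem extendFrom_eq_of_mem (h : JordanRiemann Γ F G) {z : ℂ} (hz : z ∈ ball (0 : ℂ) 1) :
    extendFrom (ball 0 1) G z = G z :=
  extendFrom_eq (subset_closure hz) (h.diffG.continuousOn z hz)

theorem extendFrom_mem_range (h : JordanRiemann Γ F G) {z : ℂ} (hz : z ∈ sphere (0 : ℂ) 1) :
    extendFrom (ball 0 1) G z ∈ range Γ := by
  have hne : (𝓝[ball (0 : ℂ) 1] z).NeBot := by
    rw [← mem_closure_iff_nhdsWithin_neBot, closure_ball _ one_ne_zero]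
    exact sphere_subset_closedBall hz
  refine h.mem_range_of_tendsto (u := 𝓝[ball 0 1] z) nhdsWithin_le_nhds self_mem_nhdsWithin
    (by simpa using (mem_sphere_zero_iff_norm.1 hz).ge)
    (tendsto_extendFrom (h.exists_tendsto (sphere_subset_closedBall hz)))

theorem exists_extendFrom_eq (h : JordanRiemann Γ F G) (c : Circle) :
    ∃ z ∈ sphere (0 : ℂ) 1, extendFrom (ball 0 1) G z = Γ c := by
  have hcl : IsClosed (extendFrom (ball 0 1) G '' closedBall 0 1) :=
    ((isCompact_closedBall 0 1).image_of_continuousOn h.continuousOn_extendFrom_closedBall).isClosed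
  have hsub : closure (connectedComponentIn (range Γ)ᶜ (G 0)) ⊆
      extendFrom (ball 0 1) G '' closedBall 0 1 := by
    refine closure_minimal ?_ hcl
    rw [← h.image_ball]
    rintro _ ⟨z, hz, rfl⟩
    exact ⟨z, ball_subset_closedBall hz, h.extendFrom_eq_of_mem hz⟩
  obtain ⟨z, hz, hzc⟩ :=
    hsub (range_subset_closure_component h.cont h.inj h.mem (mem_range_self c))
  refine ⟨z, ?_, hzc⟩
  by_contra hzs
  have hzb : z ∈ ball (0 : ℂ) 1 := by
    rw [← ball_union_sphere] at hz
    exact hz.resolve_right hzs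
  rw [h.extendFrom_eq_of_mem hzb] at hzc
  exact connectedComponentIn_subset _ _ (h.mapsG hzb) ⟨c, hzc.symm⟩

end JordanRiemann

end CaratheodoryExtension

section CaratheodoryInjective
open Filter Topology Metric
open scoped ComplexConjugate

/-- A holomorphic function that is constant on an open arc of the unit circle takes this value at
the centre. -/
theorem eq_of_eqOn_arc {g : ℂ → ℂ} (hg : DiffContOnCl ℂ g (ball 0 1)) {N : Set ℂ} (hN : IsOpen N)
    {a y : ℂ} (ha : a ∈ N) (ha1 : ‖a‖ = 1) (h : ∀ z ∈ N, ‖z‖ = 1 → g z = y) : g 0 = y := by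
  let U : Circle → Set Circle := fun α => {c | (α * c : ℂ) ∈ N}
  have hU : ∀ α, IsOpen (U α) := fun α =>
    hN.preimage (continuous_const.mul continuous_subtype_val)
  obtain ⟨t, ht⟩ := isCompact_univ.elim_finite_subcover U hU fun c _ => by
    obtain ⟨a', rfl⟩ : ∃ a' : Circle, (a' : ℂ) = a := ⟨⟨a, mem_sphere_zero_iff_norm.2 ha1⟩, rfl⟩
    refine mem_iUnion.2 ⟨a' * c⁻¹, ?_⟩
    change ((_ : Circle) : ℂ) * c ∈ N
    rw [← Circle.coe_mul, inv_mul_cancel_right]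
    exact ha
  have hmaps : ∀ α : Circle, MapsTo (fun z : ℂ => (α : ℂ) * z) (ball 0 1) (ball 0 1) := by
    intro α z hz
    rw [mem_ball_zero_iff] at hz ⊢
    rwa [norm_mul, Circle.norm_coe, one_mul]
  have hP : DiffContOnCl ℂ (fun z => ∏ α ∈ t, (g (α * z) - y)) (ball 0 1) := by
    have h1 : ∀ α : Circle, DiffContOnCl ℂ (fun z => g (α * z) - y) (ball 0 1) := fun α => by
      have h2 : DiffContOnCl ℂ (fun z : ℂ => (α : ℂ) * z) (ball 0 1) :=
        (differentiable_id.const_mul (α : ℂ)).diffContOnCl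
      exact (hg.comp h2 (hmaps α)).sub_const y
    constructor
    · have := DifferentiableOn.fun_finsetProd (u := t) (f := fun (α : Circle) z => g (α * z) - y)
        (s := ball (0 : ℂ) 1) (𝕜 := ℂ) fun α _ => (h1 α).differentiableOn
      exact this
    · exact continuousOn_finsetProd t fun α _ => (h1 α).continuousOn
  have h0 : ‖∏ α ∈ t, (g (α * 0) - y)‖ ≤ 0 := by
    refine Complex.norm_le_of_forall_mem_frontier_norm_le isBounded_ball hP (fun z hz => ?_)
      (subset_closure (by simp))
    rw [frontier_ball _ one_ne_zero, mem_sphere_zero_iff_norm] at hz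
    obtain ⟨α, hα⟩ := mem_iUnion.1 (ht (mem_univ ⟨z, mem_sphere_zero_iff_norm.2 hz⟩))
    obtain ⟨hαt, hα⟩ := mem_iUnion.1 hα
    rw [Finset.prod_eq_zero hαt, norm_zero]
    rw [h _ hα (by rw [norm_mul, Circle.norm_coe, one_mul]; exact hz), sub_self]
  simp only [mul_zero] at h0
  have := norm_le_zero_iff.1 h0
  rw [Finset.prod_eq_zero_iff] at this
  obtain ⟨_, -, h2⟩ := this
  exact sub_eq_zero.1 h2

theorem isPreconnected_compl_singleton_circle (c : Circle) :
    IsPreconnected ({c}ᶜ : Set Circle) := by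
  obtain ⟨s, -, hs⟩ := exists_circleExp 0 c
  have hc : Continuous fun r : ℝ => Circle.exp (2 * Real.pi * r) := by fun_prop
  convert (isPreconnected_Ioo (a := s) (b := s + 1)).image _ hc.continuousOn using 1
  ext d
  constructor
  · intro hd
    obtain ⟨r, hr, hrd⟩ := exists_circleExp s d
    refine ⟨r, ⟨lt_of_le_of_ne hr.1 ?_, hr.2⟩, hrd.symm⟩
    rintro rfl
    exact hd (hrd.trans hs.symm)
  · rintro ⟨r, hr, rfl⟩ heq
    rw [mem_singleton_iff, hs] at heq
    obtain ⟨n, hn⟩ := circleExp_eq_iff.1 heq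
    have h1 : (0 : ℝ) < n := by linarith [hr.1]
    have h2 : (n : ℝ) < 1 := by linarith [hr.2]
    have h1' : 0 < n := by exact_mod_cast h1
    have h2' : n < 1 := by exact_mod_cast h2
    omega

/-- A real linear function that vanishes on the line through `a` and `b`. -/
def chordSide (a b z : ℂ) : ℝ := ((z - a) * conj (b - a)).im

theorem continuous_chordSide (a b : ℂ) : Continuous (chordSide a b) := by
  unfold chordSide
  fun_prop

theorem sq_add_sq_of_norm_eq_one {z : ℂ} (hz : ‖z‖ = 1) : z.re ^ 2 + z.im ^ 2 = 1 := by
  rw [sq, sq, ← Complex.normSq_apply, Complex.normSq_eq_norm_sq, hz, one_pow]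

theorem eq_or_eq_of_chordSide {a b z : ℂ} (ha : ‖a‖ = 1) (hb : ‖b‖ = 1) (hz : ‖z‖ = 1)
    (hab : a ≠ b) (h : chordSide a b z = 0) : z = a ∨ z = b := by
  have ha' := sq_add_sq_of_norm_eq_one ha
  have hb' := sq_add_sq_of_norm_eq_one hb
  have hz' := sq_add_sq_of_norm_eq_one hz
  simp only [chordSide, Complex.mul_im, Complex.sub_re, Complex.sub_im, Complex.conj_re,
    Complex.conj_im] at h
  have hd : (b.re - a.re) ^ 2 + (b.im - a.im) ^ 2 ≠ 0 := fun h0 => hab (Complex.ext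
    (by nlinarith [sq_nonneg (b.re - a.re), sq_nonneg (b.im - a.im)])
    (by nlinarith [sq_nonneg (b.re - a.re), sq_nonneg (b.im - a.im)]))
  obtain ⟨w1, h1⟩ : ∃ x, x = z.re - a.re := ⟨_, rfl⟩
  obtain ⟨w2, h2⟩ : ∃ x, x = z.im - a.im := ⟨_, rfl⟩
  obtain ⟨d1, h3⟩ : ∃ x, x = b.re - a.re := ⟨_, rfl⟩
  obtain ⟨d2, h4⟩ : ∃ x, x = b.im - a.im := ⟨_, rfl⟩
  rw [← h1, ← h2, ← h3, ← h4] at h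
  rw [← h3, ← h4] at hd
  have e1 : 2 * (a.re * w1 + a.im * w2) + w1 ^ 2 + w2 ^ 2 = 0 := by
    rw [h1, h2]; linear_combination hz' - ha'
  have e2 : 2 * (a.re * d1 + a.im * d2) + d1 ^ 2 + d2 ^ 2 = 0 := by
    rw [h3, h4]; linear_combination hb' - ha'
  have e3 : (d1 ^ 2 + d2 ^ 2) * (w1 ^ 2 + w2 ^ 2 - (w1 * d1 + w2 * d2)) = 0 := by
    linear_combination (d1 ^ 2 + d2 ^ 2) * e1 - (w1 * d1 + w2 * d2) * e2 +
      2 * (a.re * d2 - a.im * d1) * h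
  have e4 := (mul_eq_zero.1 e3).resolve_left hd
  have e5 : (w1 * d1 + w2 * d2) * (w1 * d1 + w2 * d2 - (d1 ^ 2 + d2 ^ 2)) = 0 := by
    linear_combination (d1 ^ 2 + d2 ^ 2) * e4 - h * (w2 * d1 - w1 * d2)
  rcases mul_eq_zero.1 e5 with e6 | e6
  · left
    have e7 : w1 ^ 2 + w2 ^ 2 = 0 := by linear_combination e4 + e6
    obtain ⟨e8, e9⟩ := (add_eq_zero_iff_of_nonneg (sq_nonneg _) (sq_nonneg _)).1 e7
    replace e8 := pow_eq_zero_iff two_ne_zero |>.1 e8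
    replace e9 := pow_eq_zero_iff two_ne_zero |>.1 e9
    exact Complex.ext (by linarith) (by linarith)
  · right
    have e7 : (w1 - d1) ^ 2 + (w2 - d2) ^ 2 = 0 := by linear_combination e4 - e6
    obtain ⟨e8, e9⟩ := (add_eq_zero_iff_of_nonneg (sq_nonneg _) (sq_nonneg _)).1 e7
    replace e8 := pow_eq_zero_iff two_ne_zero |>.1 e8
    replace e9 := pow_eq_zero_iff two_ne_zero |>.1 e9
    exact Complex.ext (by linarith) (by linarith)

theorem exists_chordSide_pos {a b : ℂ} (ha : ‖a‖ = 1) (hb : ‖b‖ = 1) (hab : a ≠ b) {s : ℝ}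
    (hs : s = 1 ∨ s = -1) : ∃ z : ℂ, ‖z‖ = 1 ∧ 0 < s * chordSide a b z := by
  have ha' := sq_add_sq_of_norm_eq_one ha
  have hb' := sq_add_sq_of_norm_eq_one hb
  have hd : 0 < ‖b - a‖ := norm_pos_iff.2 (sub_ne_zero.2 hab.symm)
  have hs2 : s * s = 1 := by rcases hs with rfl | rfl <;> norm_num
  have hsn : ‖(s : ℂ)‖ = 1 := by rcases hs with rfl | rfl <;> simp
  have hdn : ‖b - a‖ ^ 2 = (b.re - a.re) ^ 2 + (b.im - a.im) ^ 2 := by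
    rw [← Complex.normSq_eq_norm_sq, Complex.normSq_apply, Complex.sub_re, Complex.sub_im]
    ring
  refine ⟨s * (Complex.I * ((b - a) / ‖b - a‖)), ?_, ?_⟩
  · rw [norm_mul, hsn, norm_mul, Complex.norm_I, norm_div, Complex.norm_real, norm_norm,
      div_self hd.ne']
    norm_num
  · have key : chordSide a b (s * (Complex.I * ((b - a) / ‖b - a‖))) =
        s * ‖b - a‖ - (a * conj (b - a)).im := by
      have h1 : (b - a) / ‖b - a‖ * conj (b - a) = (‖b - a‖ : ℂ) := by
        rw [div_mul_eq_mul_div, Complex.mul_conj, Complex.normSq_eq_norm_sq]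
        have : (‖b - a‖ : ℂ) ≠ 0 := by exact_mod_cast hd.ne'
        push_cast
        field_simp
      rw [chordSide, sub_mul, mul_assoc, mul_assoc, h1, Complex.sub_im, Complex.im_ofReal_mul]
      simp
    rw [key, mul_sub, ← mul_assoc, hs2, one_mul, sub_pos]
    refine lt_of_abs_lt (abs_lt_of_sq_lt_sq ?_ hd.le)
    have hre : (b.re - a.re) * a.re + (b.im - a.im) * a.im = -(‖b - a‖ ^ 2 / 2) := by
      rw [hdn]; linear_combination (hb' - ha') / 2
    have him : (a * conj (b - a)).im = a.im * (b.re - a.re) - a.re * (b.im - a.im) := by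
      simp [Complex.mul_im]; ring
    have hpos : 0 < ((b.re - a.re) * a.re + (b.im - a.im) * a.im) ^ 2 := by
      rw [hre, neg_sq]; positivity
    rw [him, mul_pow, sq s, hs2, hdn]
    nlinarith

namespace JordanRiemann

variable {Γ : Circle → ℂ} {F G : ℂ → ℂ}

theorem extendFrom_eq_of_chordSide (h : JordanRiemann Γ F G) {a b : ℂ} (ha : ‖a‖ = 1)
    (hb : ‖b‖ = 1) (hab : a ≠ b) (heq : extendFrom (ball 0 1) G a = extendFrom (ball 0 1) G b)
    {z₁ z₂ : ℂ} (hz₁ : ‖z₁‖ = 1) (hz₂ : ‖z₂‖ = 1) (h₁ : 0 < chordSide a b z₁)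
    (h₂ : chordSide a b z₂ < 0) (hne₁ : extendFrom (ball 0 1) G z₁ ≠ extendFrom (ball 0 1) G a)
    (hne₂ : extendFrom (ball 0 1) G z₂ ≠ extendFrom (ball 0 1) G a) : False := by
  set g := extendFrom (ball 0 1) G with hg
  have hmemΩ : ∀ z ∈ ball (0 : ℂ) 1, g z ∈ connectedComponentIn (range Γ)ᶜ (G 0) := fun z hz => by
    rw [hg, h.extendFrom_eq_of_mem hz]
    exact h.mapsG hz
  set K := g '' (closedBall 0 1 ∩ {z | chordSide a b z = 0}) with hK
  have hKc : IsCompact K := by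
    refine IsCompact.image_of_continuousOn ?_ (h.continuousOn_extendFrom_closedBall.mono
      inter_subset_left)
    exact (isCompact_closedBall 0 1).inter_right
      (isClosed_singleton.preimage (continuous_chordSide a b))
  have hJK : range Γ ∩ K ⊆ {g a} := by
    rintro _ ⟨hJ, z, ⟨hz, hz0⟩, rfl⟩
    rw [← ball_union_sphere] at hz
    rcases hz with hz | hz
    · exact absurd hJ (connectedComponentIn_subset _ _ (hmemΩ z hz))
    · rcases eq_or_eq_of_chordSide ha hb (mem_sphere_zero_iff_norm.1 hz) hab hz0 with rfl | rfl
      · rfl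
      · exact heq.symm
  obtain ⟨c, hc⟩ := h.extendFrom_mem_range (mem_sphere_zero_iff_norm.2 ha)
  have hpre : IsPreconnected (Γ '' {c}ᶜ) :=
    (isPreconnected_compl_singleton_circle c).image _ h.cont.continuousOn
  have hsub : Γ '' {c}ᶜ ⊆ Kᶜ := by
    rintro _ ⟨d, hd, rfl⟩ hdK
    exact hd (h.inj ((hJK ⟨mem_range_self d, hdK⟩).trans hc.symm))
  have hmem : ∀ z : ℂ, ‖z‖ = 1 → g z ≠ g a → g z ∈ Γ '' {c}ᶜ := by
    intro z hz hza
    obtain ⟨d, hd⟩ := h.extendFrom_mem_range (mem_sphere_zero_iff_norm.2 hz)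
    refine ⟨d, ?_, hd⟩
    rintro rfl
    exact hza (hd.symm.trans hc)
  have hcomp : ∀ z : ℂ, ‖z‖ = 1 → g z ≠ g a → g z ∈ connectedComponentIn Kᶜ (g z₁) :=
    fun z hz hza => hpre.subset_connectedComponentIn (hmem z₁ hz₁ hne₁) hsub (hmem z hz hza)
  have hnear : ∀ z : ℂ, ‖z‖ = 1 → g z ≠ g a → ∀ O : Set ℂ, IsOpen O → z ∈ O →
      ∃ w ∈ ball (0 : ℂ) 1, w ∈ O ∧ g w ∈ connectedComponentIn Kᶜ (g z₁) := by
    intro z hz hza O hO hzO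
    have hz1 : z ∈ closedBall (0 : ℂ) 1 := by simp [hz]
    have hne : (𝓝[ball (0 : ℂ) 1] z).NeBot := by
      rwa [← mem_closure_iff_nhdsWithin_neBot, closure_ball _ one_ne_zero]
    have h1 : Tendsto g (𝓝[ball 0 1] z) (𝓝 (g z)) :=
      (h.continuousOn_extendFrom_closedBall z hz1).mono ball_subset_closedBall
    have h2 := h1.eventually ((hKc.isClosed.isOpen_compl.connectedComponentIn).mem_nhds
      (hcomp z hz hza))
    have h3 : ∀ᶠ w in 𝓝[ball (0 : ℂ) 1] z, w ∈ O := mem_nhdsWithin_of_mem_nhds (hO.mem_nhds hzO)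
    have h4 : ∀ᶠ w in 𝓝[ball (0 : ℂ) 1] z, w ∈ ball (0 : ℂ) 1 := self_mem_nhdsWithin
    obtain ⟨w, ⟨hw1, hw2⟩, hw3⟩ := ((h3.and h2).and h4).exists
    exact ⟨w, hw3, hw1, hw2⟩
  obtain ⟨w₁, hw₁, hw₁O, hw₁K⟩ := hnear z₁ hz₁ hne₁ _
    (isOpen_lt continuous_const (continuous_chordSide a b)) h₁
  obtain ⟨w₂, hw₂, hw₂O, hw₂K⟩ := hnear z₂ hz₂ hne₂ _
    (isOpen_lt (continuous_chordSide a b) continuous_const) h₂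
  have hout : ∀ w ∈ ball (0 : ℂ) 1, g w ∈ connectedComponentIn Kᶜ (g z₁) → g w ∈ (range Γ ∪ K)ᶜ :=
    fun w hw hwK h' => h'.elim (connectedComponentIn_subset _ _ (hmemΩ w hw))
      (connectedComponentIn_subset _ _ hwK)
  have hΩeq := connectedComponentIn_eq (hmemΩ w₁ hw₁)
  have hE := mem_component_union (isCompact_range h.cont) hKc
    (subsingleton_singleton.anti hJK).isPreconnected (hout w₁ hw₁ hw₁K) (hout w₂ hw₂ hw₂K)
    (hΩeq ▸ hmemΩ w₂ hw₂) (connectedComponentIn_eq hw₁K ▸ hw₂K)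
  set E := connectedComponentIn (range Γ ∪ K)ᶜ (g w₁) with hEdef
  have hEsub : E ⊆ (range Γ ∪ K)ᶜ := connectedComponentIn_subset _ _
  have hzE : g w₁ ∈ E := mem_connectedComponentIn (hout w₁ hw₁ hw₁K)
  have hEΩ : E ⊆ connectedComponentIn (range Γ)ᶜ (G 0) := by
    rw [hΩeq]
    exact isPreconnected_connectedComponentIn.subset_connectedComponentIn hzE
      (hEsub.trans (compl_subset_compl.2 subset_union_left))
  have hFE : IsPreconnected (F '' E) :=
    isPreconnected_connectedComponentIn.image F (h.diffF.continuousOn.mono hEΩ)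
  have hd := hFE.image _ (continuous_chordSide a b).continuousOn
  have hFg : ∀ w ∈ ball (0 : ℂ) 1, F (g w) = w := fun w hw => by
    rw [hg, h.extendFrom_eq_of_mem hw, h.rightInv hw]
  obtain ⟨_, ⟨e, he, rfl⟩, her⟩ := hd.ordConnected.out
    ⟨w₂, ⟨g w₂, hE, hFg w₂ hw₂⟩, rfl⟩ ⟨w₁, ⟨g w₁, hzE, hFg w₁ hw₁⟩, rfl⟩
    ⟨(show chordSide a b w₂ < 0 from hw₂O).le, (show 0 < chordSide a b w₁ from hw₁O).le⟩
  refine hEsub he (Or.inr ⟨F e, ⟨ball_subset_closedBall (h.mapsF (hEΩ he)), her⟩, ?_⟩)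
  rw [hg, h.extendFrom_eq_of_mem (h.mapsF (hEΩ he)), h.leftInv (hEΩ he)]

theorem injOn_extendFrom_sphere (h : JordanRiemann Γ F G) :
    InjOn (extendFrom (ball 0 1) G) (sphere 0 1) := by
  intro a ha b hb heq
  by_contra hab
  have ha' := mem_sphere_zero_iff_norm.1 ha
  have hb' := mem_sphere_zero_iff_norm.1 hb
  obtain ⟨s, hs, H⟩ : ∃ s : ℝ, (s = 1 ∨ s = -1) ∧ ∀ z : ℂ, 0 < s * chordSide a b z → ‖z‖ = 1 →
      extendFrom (ball 0 1) G z = extendFrom (ball 0 1) G a := by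
    by_contra! hcon
    obtain ⟨z₁, h₁, hz₁, hne₁⟩ := hcon 1 (Or.inl rfl)
    obtain ⟨z₂, h₂, hz₂, hne₂⟩ := hcon (-1) (Or.inr rfl)
    exact h.extendFrom_eq_of_chordSide ha' hb' hab heq hz₁ hz₂ (by linarith) (by linarith) hne₁ hne₂
  obtain ⟨z, hz, hz0⟩ := exists_chordSide_pos ha' hb' hab hs
  have hd : DiffContOnCl ℂ (extendFrom (ball 0 1) G) (ball 0 1) :=
    ⟨h.diffG.congr fun z hz => h.extendFrom_eq_of_mem hz, by
      rw [closure_ball _ one_ne_zero]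
      exact h.continuousOn_extendFrom_closedBall⟩
  have h0 := eq_of_eqOn_arc hd
    (isOpen_lt continuous_const (continuous_const.mul (continuous_chordSide a b))) hz0 hz H
  rw [h.extendFrom_eq_of_mem (by simp)] at h0
  exact h.mem (h0 ▸ h.extendFrom_mem_range ha)

end JordanRiemann

end CaratheodoryInjective

section Cone
open Filter Topology Metric

/-- The direction of a nonzero complex number. -/
def circleDir (z : ℂ) : Circle :=
  if h : z = 0 then 1 else ⟨z / ‖z‖, mem_sphere_zero_iff_norm.2 (by simp [h])⟩

theorem coe_circleDir {z : ℂ} (h : z ≠ 0) : (circleDir z : ℂ) = z / ‖z‖ := by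
  have := congrArg (fun c : Circle => (c : ℂ)) (dif_neg h : circleDir z = _)
  exact this

theorem norm_mul_circleDir (z : ℂ) : (‖z‖ : ℂ) * circleDir z = z := by
  by_cases h : z = 0
  · simp [h]
  · have : (‖z‖ : ℂ) ≠ 0 := by simpa using h
    rw [coe_circleDir h]
    field_simp

theorem circleDir_mul {r : ℝ} (hr : 0 < r) (c : Circle) : circleDir (r * c) = c := by
  have h : (r * c : ℂ) ≠ 0 := mul_ne_zero (by exact_mod_cast hr.ne') (Circle.coe_ne_zero c)
  have hr' : (r : ℂ) ≠ 0 := by exact_mod_cast hr.ne'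
  ext
  rw [coe_circleDir h, norm_mul, Circle.norm_coe, Complex.norm_real, Real.norm_eq_abs,
    abs_of_pos hr, mul_one]
  field_simp

theorem circleDir_coe (c : Circle) : circleDir c = c := by
  simpa using circleDir_mul one_pos c

theorem continuousAt_circleDir {z : ℂ} (h : z ≠ 0) : ContinuousAt circleDir z := by
  refine Topology.IsInducing.subtypeVal.continuousAt_iff.2 ?_
  have h1 : ContinuousAt (fun w : ℂ => w / ‖w‖) z :=
    continuousAt_id.div (Complex.continuous_ofReal.comp continuous_norm).continuousAt
      (by simpa using h)
  refine h1.congr ?_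
  filter_upwards [isOpen_ne.mem_nhds h] with w hw using (coe_circleDir hw).symm

/-- The radial extension to the plane of a self-map of the unit circle. -/
def coneMap (b : Circle → Circle) (z : ℂ) : ℂ := ‖z‖ * b (circleDir z)

theorem norm_coneMap (b : Circle → Circle) (z : ℂ) : ‖coneMap b z‖ = ‖z‖ := by
  simp [coneMap, Circle.norm_coe]

theorem coneMap_zero (b : Circle → Circle) : coneMap b 0 = 0 := by simp [coneMap]

theorem coneMap_coe (b : Circle → Circle) (c : Circle) : coneMap b c = b c := by
  simp [coneMap, circleDir_coe, Circle.norm_coe]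

theorem continuous_coneMap {b : Circle → Circle} (hb : Continuous b) : Continuous (coneMap b) := by
  refine continuous_iff_continuousAt.2 fun z => ?_
  by_cases h : z = 0
  · subst h
    rw [ContinuousAt, coneMap_zero, tendsto_zero_iff_norm_tendsto_zero]
    simp only [norm_coneMap]
    exact tendsto_norm_zero
  · refine ContinuousAt.mul (Complex.continuous_ofReal.comp continuous_norm).continuousAt ?_
    exact (continuous_subtype_val.comp hb).continuousAt.comp (continuousAt_circleDir h)

theorem coneMap_coneMap (b b' : Circle → Circle) (z : ℂ) :
    coneMap b (coneMap b' z) = coneMap (b ∘ b') z := by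
  by_cases h : z = 0
  · simp [h, coneMap_zero]
  · rw [coneMap, norm_coneMap, coneMap, circleDir_mul (norm_pos_iff.2 h)]
    rfl

theorem coneMap_id (z : ℂ) : coneMap id z = z := norm_mul_circleDir z

end Cone

section JordanDisc
open Filter Topology Metric

/-- The closure of a bounded complementary component of a Jordan curve is a closed disc, with a
parametrization that extends the given one of the curve. -/
theorem exists_jordan_disc {Γ : Circle → ℂ} (hΓ : Continuous Γ) (hi : Function.Injective Γ) {p : ℂ}
    (hp : p ∈ (range Γ)ᶜ) (hb : Bornology.IsBounded (connectedComponentIn (range Γ)ᶜ p)) :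
    ∃ Ψ : ℂ → ℂ, ContinuousOn Ψ (closedBall 0 1) ∧ InjOn Ψ (closedBall 0 1) ∧ Ψ 0 = p ∧
      (∀ c : Circle, Ψ c = Γ c) ∧ Ψ '' ball 0 1 = connectedComponentIn (range Γ)ᶜ p := by
  obtain ⟨F, G, h, rfl⟩ := exists_jordanRiemann hΓ hi hp hb
  set g := extendFrom (ball 0 1) G with hg
  have hgc : ContinuousOn g (closedBall 0 1) := h.continuousOn_extendFrom_closedBall
  have hsph : ∀ c : Circle, (c : ℂ) ∈ sphere (0 : ℂ) 1 := fun c => by simp [Circle.norm_coe]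
  have hrange : ∀ c : Circle, g c ∈ range Γ := fun c => h.extendFrom_mem_range (hsph c)
  have hgcirc : Continuous fun c : Circle => g c :=
    hgc.comp_continuous continuous_subtype_val fun c => sphere_subset_closedBall (hsph c)
  let β : Circle → Circle := fun c => Function.invFun Γ (g c)
  have hβΓ : ∀ c, Γ (β c) = g c := fun c => Function.invFun_eq (hrange c)
  have hβ : Continuous β := (continuousOn_invFun_range hΓ hi).comp_continuous hgcirc hrange
  have hβb : Function.Bijective β := by
    constructor
    · intro c d hcd
      refine Circle.ext (h.injOn_extendFrom_sphere (hsph c) (hsph d) ?_)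
      rw [← hg, ← hβΓ, ← hβΓ, hcd]
    · intro c
      obtain ⟨z, hz, hzc⟩ := h.exists_extendFrom_eq c
      exact ⟨⟨z, hz⟩, hi ((hβΓ _).trans hzc)⟩
  let e : Circle ≃ₜ Circle := hβ.homeoOfEquivCompactToT2 (f := Equiv.ofBijective β hβb)
  have he : ∀ c, Γ c = g (e.symm c) := fun c => by
    rw [← hβΓ]
    exact congrArg Γ (e.apply_symm_apply c).symm
  have hleft : ∀ z, coneMap e (coneMap e.symm z) = z := fun z => by
    rw [coneMap_coneMap, show ⇑e ∘ ⇑e.symm = id from funext e.apply_symm_apply, coneMap_id]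
  have hright : ∀ z, coneMap e.symm (coneMap e z) = z := fun z => by
    rw [coneMap_coneMap, show ⇑e.symm ∘ ⇑e = id from funext e.symm_apply_apply, coneMap_id]
  have hginj : InjOn g (closedBall 0 1) := by
    have hcase : ∀ z ∈ ball (0 : ℂ) 1, ∀ w ∈ sphere (0 : ℂ) 1, g z ≠ g w := by
      intro z hz w hw hzw
      refine connectedComponentIn_subset _ _ (h.mapsG hz) ?_
      rw [← h.extendFrom_eq_of_mem hz, ← hg, hzw]
      exact h.extendFrom_mem_range hw
    intro z hz w hw hzw
    rw [← ball_union_sphere] at hz hw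
    rcases hz with hz | hz <;> rcases hw with hw | hw
    · rw [hg, h.extendFrom_eq_of_mem hz, h.extendFrom_eq_of_mem hw] at hzw
      exact h.injOn hz hw hzw
    · exact absurd hzw (hcase z hz w hw)
    · exact absurd hzw.symm (hcase w hw z hz)
    · exact h.injOn_extendFrom_sphere hz hw hzw
  have hmaps : ∀ b, MapsTo (coneMap b) (closedBall 0 1) (closedBall 0 1) := fun b z hz => by
    rw [mem_closedBall_zero_iff] at hz ⊢
    rwa [norm_coneMap]
  have hmaps' : ∀ b, MapsTo (coneMap b) (ball 0 1) (ball 0 1) := fun b z hz => by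
    rw [mem_ball_zero_iff] at hz ⊢
    rwa [norm_coneMap]
  refine ⟨g ∘ coneMap e.symm, hgc.comp (continuous_coneMap e.symm.continuous).continuousOn
    (hmaps _), hginj.comp (Function.LeftInverse.injective hleft).injOn (hmaps _), ?_, ?_, ?_⟩
  · rw [Function.comp_apply, coneMap_zero, hg, h.extendFrom_eq_of_mem (by simp)]
  · intro c
    rw [Function.comp_apply, coneMap_coe, he]
  · rw [← h.image_ball]
    refine Subset.antisymm ?_ ?_
    · rintro _ ⟨z, hz, rfl⟩
      exact ⟨_, hmaps' e.symm hz, (h.extendFrom_eq_of_mem (hmaps' e.symm hz)).symm⟩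
    · rintro _ ⟨z, hz, rfl⟩
      refine ⟨_, hmaps' e hz, ?_⟩
      rw [Function.comp_apply, hright, hg, h.extendFrom_eq_of_mem hz]

end JordanDisc

section SphereComponents
open Filter Topology Metric

instance : Fact (Module.finrank ℝ (EuclideanSpace ℝ (Fin 3)) = 2 + 1) := ⟨by simp⟩

/-- Stereographic projection of the sphere from the point `x` to the complex plane. -/
def stereo (x : Sph) : OpenPartialHomeomorph Sph ℂ :=
  (stereographic' 2 x).trans
    Complex.orthonormalBasisOneI.repr.symm.toHomeomorph.toOpenPartialHomeomorph

theorem stereo_source (x : Sph) : (stereo x).source = {x}ᶜ := by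
  simp [stereo]

theorem stereo_target (x : Sph) : (stereo x).target = univ := by
  simp [stereo]

theorem stereo_symm_ne (x : Sph) (z : ℂ) : (stereo x).symm z ≠ x := by
  have := (stereo x).map_target (x := z) (by simp [stereo_target])
  simpa [stereo_source] using this

theorem stereo_symm_stereo {x y : Sph} (h : y ≠ x) : (stereo x).symm (stereo x y) = y :=
  (stereo x).left_inv (by simpa [stereo_source] using h)

theorem stereo_stereo_symm (x : Sph) (z : ℂ) : stereo x ((stereo x).symm z) = z :=
  (stereo x).right_inv (by simp [stereo_target])

theorem continuous_stereo_symm (x : Sph) : Continuous (stereo x).symm := by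
  rw [← continuousOn_univ, ← stereo_target x]
  exact (stereo x).continuousOn_symm

theorem continuousOn_stereo (x : Sph) : ContinuousOn (stereo x) {x}ᶜ := by
  rw [← stereo_source x]
  exact (stereo x).continuousOn

theorem stereo_symm_injective (x : Sph) : Function.Injective (stereo x).symm :=
  Function.LeftInverse.injective (stereo_stereo_symm x)

variable {K : Set Sph} {x : Sph}

theorem isCompact_stereo_image (hK : IsClosed K) (hx : x ∉ K) : IsCompact (stereo x '' K) :=
  hK.isCompact.image_of_continuousOn ((continuousOn_stereo x).mono fun _ hy hyx => hx (hyx ▸ hy))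

theorem stereo_symm_mem_iff (hx : x ∉ K) {z : ℂ} : (stereo x).symm z ∈ K ↔ z ∈ stereo x '' K := by
  constructor
  · exact fun h => ⟨_, h, stereo_stereo_symm x z⟩
  · rintro ⟨y, hy, rfl⟩
    rwa [stereo_symm_stereo (by rintro rfl; exact hx hy)]

theorem stereo_mem_iff (hx : x ∉ K) {y : Sph} (hy : y ≠ x) :
    stereo x y ∈ stereo x '' K ↔ y ∈ K := by
  rw [← stereo_symm_mem_iff hx, stereo_symm_stereo hy]

theorem stereo_symm_image_component_subset (hx : x ∉ K) {q : Sph} (hq : q ∈ Kᶜ) (hqx : q ≠ x) :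
    (stereo x).symm '' connectedComponentIn (stereo x '' K)ᶜ (stereo x q) ⊆
      connectedComponentIn Kᶜ q := by
  refine (isPreconnected_connectedComponentIn.image _
    (continuous_stereo_symm x).continuousOn).subset_connectedComponentIn
    ⟨_, mem_connectedComponentIn fun h => hq ((stereo_mem_iff hx hqx).1 h),
      stereo_symm_stereo hqx⟩ ?_
  rintro _ ⟨z, hz, rfl⟩ hzK
  exact connectedComponentIn_subset _ _ hz ((stereo_symm_mem_iff hx).1 hzK)

theorem stereo_mem_component (hx : x ∉ K) {q r : Sph} (hq : q ∈ Kᶜ)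
    (hr : r ∈ connectedComponentIn Kᶜ q)
    (hxq : x ∉ connectedComponentIn Kᶜ q) :
    stereo x r ∈ connectedComponentIn (stereo x '' K)ᶜ (stereo x q) := by
  have hne : ∀ y ∈ connectedComponentIn Kᶜ q, y ≠ x := fun y hy h => hxq (h ▸ hy)
  refine (isPreconnected_connectedComponentIn.image (stereo x) ((continuousOn_stereo x).mono
    hne)).subset_connectedComponentIn ⟨q, mem_connectedComponentIn hq, rfl⟩ ?_ ⟨r, hr, rfl⟩
  rintro _ ⟨y, hy, rfl⟩ hyK
  exact connectedComponentIn_subset _ _ hy ((stereo_mem_iff hx (hne y hy)).1 hyK)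

theorem stereo_symm_image_component (hx : x ∉ K) {q : Sph} (hq : q ∈ Kᶜ)
    (hxq : x ∉ connectedComponentIn Kᶜ q) :
    (stereo x).symm '' connectedComponentIn (stereo x '' K)ᶜ (stereo x q) =
      connectedComponentIn Kᶜ q := by
  have hqx : q ≠ x := fun h => hxq (h ▸ mem_connectedComponentIn hq)
  refine Subset.antisymm (stereo_symm_image_component_subset hx hq hqx) fun r hr =>
    ⟨stereo x r, stereo_mem_component hx hq hr hxq, stereo_symm_stereo fun h => hxq (h ▸ hr)⟩

theorem mem_component_of_not_isBounded (hx : x ∉ K) {q : Sph} (hq : q ∈ Kᶜ)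
    (hqx : q ≠ x)
    (h : ¬ Bornology.IsBounded (connectedComponentIn (stereo x '' K)ᶜ (stereo x q))) :
    x ∈ connectedComponentIn Kᶜ q := by
  set C := connectedComponentIn (stereo x '' K)ᶜ (stereo x q)
  have hsub := stereo_symm_image_component_subset hx hq hqx
  have hmem : q ∈ (stereo x).symm '' C :=
    ⟨_, mem_connectedComponentIn fun h => hq ((stereo_mem_iff hx hqx).1 h), stereo_symm_stereo hqx⟩
  have hcl : x ∈ closure ((stereo x).symm '' C) := by
    rw [_root_.mem_closure_iff]
    intro O hO hxO
    by_contra hne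
    refine h ((isCompact_stereo_image (K := Oᶜ) hO.isClosed_compl
      (by simpa using hxO)).isBounded.subset
      fun z hz => (stereo_symm_mem_iff (by simpa using hxO)).1 fun hzO => hne ⟨_, hzO, _, hz, rfl⟩)
  have hpre : IsPreconnected (insert x ((stereo x).symm '' C)) :=
    (isPreconnected_connectedComponentIn.image _
      (continuous_stereo_symm x).continuousOn).subset_closure (subset_insert _ _)
      (insert_subset hcl subset_closure)
  exact hpre.subset_connectedComponentIn (mem_insert_of_mem _ hmem)
    (insert_subset hx (hsub.trans (connectedComponentIn_subset _ _))) (mem_insert _ _)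

theorem not_isBounded_of_mem_component (hK : IsClosed K) (hx : x ∉ K) {q : Sph} (hq : q ∈ Kᶜ)
    (hqx : q ≠ x) (h : x ∈ connectedComponentIn Kᶜ q) :
    ¬ Bornology.IsBounded (connectedComponentIn (stereo x '' K)ᶜ (stereo x q)) := by
  intro hb
  set C := connectedComponentIn (stereo x '' K)ᶜ (stereo x q) with hC
  have hKc := isCompact_stereo_image hK hx
  have ho : IsOpen ((stereo x).symm '' C) :=
    (stereo x).symm.isOpen_image_of_subset_source hKc.isClosed.isOpen_compl.connectedComponentIn
      (by simp [stereo_target])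
  have hcl : IsClosed ((stereo x).symm '' closure C) :=
    (hb.isCompact_closure.image (continuous_stereo_symm x)).isClosed
  have hmem : q ∈ (stereo x).symm '' C :=
    ⟨_, mem_connectedComponentIn fun h => hq ((stereo_mem_iff hx hqx).1 h), stereo_symm_stereo hqx⟩
  have hxn : ∀ A : Set ℂ, x ∉ (stereo x).symm '' A := by
    rintro A ⟨z, -, hz⟩
    exact stereo_symm_ne x z hz
  have hpre : IsPreconnected (connectedComponentIn Kᶜ q) := isPreconnected_connectedComponentIn
  obtain ⟨y, hy, hy1, hy2⟩ := hpre _ _ ho hcl.isOpen_compl (fun y hy => by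
      by_cases hyc : y ∈ (stereo x).symm '' closure C
      · obtain ⟨z, hz, rfl⟩ := hyc
        refine Or.inl ⟨z, (closure_connectedComponentIn_subset hKc.isClosed _ hz).resolve_right
          fun hzK => ?_, rfl⟩
        exact connectedComponentIn_subset _ _ hy ((stereo_symm_mem_iff hx).2 hzK)
      · exact Or.inr hyc)
    ⟨q, mem_connectedComponentIn hq, hmem⟩ ⟨x, h, hxn _⟩
  exact hy2 (image_mono subset_closure hy1)

/-- If neither of two closed sets with connected intersection separates `x` from `z`, then neither
does their union. -/
theorem mem_component_union_sphere {A B : Set Sph} (hA : IsClosed A) (hB : IsClosed B)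
    (hAB : IsPreconnected (A ∩ B)) {x z : Sph} (hx : x ∈ (A ∪ B)ᶜ) (hz : z ∈ (A ∪ B)ᶜ)
    (h1 : z ∈ connectedComponentIn Aᶜ x) (h2 : z ∈ connectedComponentIn Bᶜ x) :
    z ∈ connectedComponentIn (A ∪ B)ᶜ x := by
  rcases eq_or_ne z x with rfl | hzx
  · exact mem_connectedComponentIn hx
  have hsymm : ∀ K : Set Sph, z ∈ connectedComponentIn Kᶜ x → x ∈ Kᶜ →
      x ∈ connectedComponentIn Kᶜ z := fun K hK hx => by
    rw [← connectedComponentIn_eq hK]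
    exact mem_connectedComponentIn hx
  have hxA : x ∉ A := fun h => hx (Or.inl h)
  have hxB : x ∉ B := fun h => hx (Or.inr h)
  have hzA : z ∈ Aᶜ := fun h => hz (Or.inl h)
  have hzB : z ∈ Bᶜ := fun h => hz (Or.inr h)
  have hinj : InjOn (stereo x) {x}ᶜ := by
    rw [← stereo_source x]
    exact (stereo x).injOn
  have hinter : stereo x '' A ∩ stereo x '' B = stereo x '' (A ∩ B) :=
    (hinj.image_inter (fun y hy h => hxA (h ▸ hy)) (fun y hy h => hxB (h ▸ hy))).symm
  have h := unbounded_component_union (isCompact_stereo_image hA hxA)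
    (isCompact_stereo_image hB hxB)
    (hinter ▸ hAB.image _ ((continuousOn_stereo x).mono fun y hy h => hxA (h ▸ hy.1)))
    (p := stereo x z) (by rw [← image_union]; exact fun h => hz ((stereo_mem_iff hx hzx).1 h))
    (not_isBounded_of_mem_component hA hxA hzA hzx (hsymm A h1 hxA))
    (not_isBounded_of_mem_component hB hxB hzB hzx (hsymm B h2 hxB))
  rw [← image_union] at h
  have h3 := mem_component_of_not_isBounded hx hz hzx h
  rw [← connectedComponentIn_eq h3]
  exact mem_connectedComponentIn hz

end SphereComponents

section SphereJordan
open Filter Topology Metric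

variable {γ : Circle → Sph}

theorem mem_component_symm {X : Type*} [TopologicalSpace X] {K : Set X} {x y : X}
    (hx : x ∈ K) (h : y ∈ connectedComponentIn K x) : x ∈ connectedComponentIn K y := by
  rw [← connectedComponentIn_eq h]
  exact mem_connectedComponentIn hx

theorem continuous_stereo_comp (hγ : Continuous γ) {x : Sph} (hx : x ∉ range γ) :
    Continuous fun c => stereo x (γ c) :=
  (continuousOn_stereo x).comp_continuous hγ fun c h => hx ⟨c, h⟩

theorem stereo_comp_injective (hi : Function.Injective γ) {x : Sph} (hx : x ∉ range γ) :
    Function.Injective fun c => stereo x (γ c) := fun a b h => hi <| by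
  have h' : (stereo x).symm (stereo x (γ a)) = (stereo x).symm (stereo x (γ b)) :=
    congrArg (stereo x).symm h
  rwa [stereo_symm_stereo fun h => hx ⟨a, h⟩, stereo_symm_stereo fun h => hx ⟨b, h⟩] at h'

theorem range_stereo_comp (x : Sph) : range (fun c => stereo x (γ c)) = stereo x '' range γ :=
  range_comp (stereo x) γ

theorem exists_not_mem_component_sphere (hγ : Continuous γ) (hi : Function.Injective γ) {x : Sph}
    (hx : x ∉ range γ) : ∃ q ∈ (range γ)ᶜ, q ∉ connectedComponentIn (range γ)ᶜ x := by
  have hcl : IsClosed (range γ) := (isCompact_range hγ).isClosed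
  obtain ⟨p, hp, hb⟩ := exists_bounded_component (continuous_stereo_comp hγ hx)
    (stereo_comp_injective hi hx)
  rw [range_stereo_comp] at hp hb
  have hq : (stereo x).symm p ∈ (range γ)ᶜ := fun h => hp ((stereo_symm_mem_iff hx).1 h)
  refine ⟨_, hq, fun h => not_isBounded_of_mem_component hcl hx hq (stereo_symm_ne x p)
    (mem_component_symm hx h) ?_⟩
  rwa [stereo_stereo_symm]

theorem range_subset_closure_component_sphere (hγ : Continuous γ) (hi : Function.Injective γ)
    {x : Sph} (hx : x ∉ range γ) : range γ ⊆ closure (connectedComponentIn (range γ)ᶜ x) := by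
  obtain ⟨q, hq, hqx⟩ := exists_not_mem_component_sphere hγ hi hx
  have hqx' : q ∉ connectedComponentIn (range γ)ᶜ x := hqx
  have hne : x ≠ q := by rintro rfl; exact hqx (mem_connectedComponentIn hq)
  rw [← stereo_symm_image_component hq (q := x) hx hqx]
  rintro _ ⟨c, rfl⟩
  have h := range_subset_closure_component (continuous_stereo_comp hγ hq)
    (stereo_comp_injective hi hq) (p := stereo q x)
    (by rw [range_stereo_comp]; exact fun h => hx ((stereo_mem_iff hq hne).1 h)) (mem_range_self c)
  rw [range_stereo_comp] at h
  have h' := image_closure_subset_closure_image (continuous_stereo_symm q) (mem_image_of_mem _ h)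
  rwa [stereo_symm_stereo fun h => hq ⟨c, h⟩] at h'

theorem isBounded_component_of_not_mem {x q : Sph} (hx : x ∉ range γ)
    (hq : q ∈ (range γ)ᶜ) (hqx : q ∉ connectedComponentIn (range γ)ᶜ x) :
    Bornology.IsBounded (connectedComponentIn (stereo x '' range γ)ᶜ (stereo x q)) := by
  have hne : q ≠ x := by rintro rfl; exact hqx (mem_connectedComponentIn hq)
  by_contra h
  exact hqx (mem_component_symm hq (mem_component_of_not_isBounded hx hq hne h))

theorem mem_component_of_not_mem (hγ : Continuous γ) (hi : Function.Injective γ) {x q r : Sph}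
    (hx : x ∉ range γ) (hq : q ∈ (range γ)ᶜ) (hqx : q ∉ connectedComponentIn (range γ)ᶜ x)
    (hr : r ∈ (range γ)ᶜ) (hrx : r ∉ connectedComponentIn (range γ)ᶜ x) :
    r ∈ connectedComponentIn (range γ)ᶜ q := by
  have hne : ∀ y, y ∉ connectedComponentIn (range γ)ᶜ x → y ≠ x := by
    rintro y hy rfl
    exact hy (mem_connectedComponentIn hx)
  have h := mem_component_of_bounded (continuous_stereo_comp hγ hx)
    (stereo_comp_injective hi hx) (p := stereo x q) (q := stereo x r)
  rw [range_stereo_comp] at h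
  exact stereo_symm_image_component_subset hx hq (hne q hqx) ⟨_, h
    (fun h => hq ((stereo_mem_iff hx (hne q hqx)).1 h))
    (fun h => hr ((stereo_mem_iff hx (hne r hrx)).1 h))
    (isBounded_component_of_not_mem hx hq hqx) (isBounded_component_of_not_mem hx hr hrx),
    stereo_symm_stereo (hne r hrx)⟩

theorem exists_jordan_disc_sphere (hγ : Continuous γ) (hi : Function.Injective γ) {x q : Sph}
    (hx : x ∈ (range γ)ᶜ) (hq : q ∉ range γ) (hxq : x ∉ connectedComponentIn (range γ)ᶜ q) :
    ∃ f : ℂ → Sph, ContinuousOn f (closedBall 0 1) ∧ InjOn f (closedBall 0 1) ∧ f 0 = x ∧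
      (∀ c : Circle, f c = γ c) ∧ f '' ball 0 1 = connectedComponentIn (range γ)ᶜ x := by
  have hne : x ≠ q := by rintro rfl; exact hxq (mem_connectedComponentIn hx)
  obtain ⟨Ψ, h1, h2, h3, h4, h5⟩ := exists_jordan_disc (continuous_stereo_comp hγ hq)
    (stereo_comp_injective hi hq) (p := stereo q x)
    (by rw [range_stereo_comp]; exact fun h => hx ((stereo_mem_iff hq hne).1 h))
    (by rw [range_stereo_comp]; exact isBounded_component_of_not_mem hq hx hxq)
  rw [range_stereo_comp] at h5
  refine ⟨(stereo q).symm ∘ Ψ, (continuous_stereo_symm q).comp_continuousOn h1,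
    (stereo_symm_injective q).comp_injOn h2, ?_, fun c => ?_, ?_⟩
  · rw [Function.comp_apply, h3, stereo_symm_stereo hne]
  · rw [Function.comp_apply, h4, stereo_symm_stereo fun h => hq ⟨c, h⟩]
  · rw [image_comp, h5]
    exact stereo_symm_image_component hq hx fun h => hxq (mem_component_symm hx h)

end SphereJordan

section Schoenflies
open Filter Topology Metric

/-- The orthogonal projection of the sphere to the equatorial plane. -/
def sphProj (v : Sph) : ℂ := ⟨v.1 0, v.1 1⟩

/-- The height of a point above the equatorial plane. -/
def sphHeight (v : Sph) : ℝ := v.1 2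

theorem continuous_sphHeight : Continuous sphHeight := by
  unfold sphHeight
  fun_prop

theorem continuous_sphProj : Continuous sphProj := by
  have : sphProj = fun v : Sph => (v.1 0 : ℂ) + (v.1 1 : ℂ) * Complex.I := by
    ext v
    exact Complex.mk_eq_add_mul_I _ _
  rw [this]
  fun_prop

theorem norm_sphProj_sq (v : Sph) : ‖sphProj v‖ ^ 2 + sphHeight v ^ 2 = 1 := by
  have h : ‖(v : EuclideanSpace ℝ (Fin 3))‖ = 1 := mem_sphere_zero_iff_norm.1 v.2
  have h2 := EuclideanSpace.real_norm_sq_eq (v : EuclideanSpace ℝ (Fin 3))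
  rw [h, Fin.sum_univ_three] at h2
  rw [← Complex.normSq_eq_norm_sq, Complex.normSq_apply]
  simp only [sphProj, sphHeight]
  linarith

theorem sph_ext {v w : Sph} (h : sphProj v = sphProj w) (h' : sphHeight v = sphHeight w) :
    v = w := by
  have h1 := congrArg Complex.re h
  have h2 := congrArg Complex.im h
  ext i
  fin_cases i
  · exact h1
  · exact h2
  · exact h'

/-- The point of the sphere with given projection and height. -/
def sphMk (z : ℂ) (t : ℝ) (h : ‖z‖ ^ 2 + t ^ 2 = 1) : Sph :=
  ⟨!₂[z.re, z.im, t], by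
    rw [mem_sphere_zero_iff_norm, ← sq_eq_sq₀ (norm_nonneg _) zero_le_one,
      EuclideanSpace.real_norm_sq_eq, Fin.sum_univ_three]
    rw [← Complex.normSq_eq_norm_sq, Complex.normSq_apply] at h
    simp only [Matrix.cons_val]
    linarith⟩

@[simp] theorem sphProj_sphMk (z : ℂ) (t : ℝ) (h : ‖z‖ ^ 2 + t ^ 2 = 1) :
    sphProj (sphMk z t h) = z := rfl

@[simp] theorem sphHeight_sphMk (z : ℂ) (t : ℝ) (h : ‖z‖ ^ 2 + t ^ 2 = 1) :
    sphHeight (sphMk z t h) = t := rfl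

/-- The equator of the sphere. -/
def equator (c : Circle) : Sph := sphMk c 0 (by simp [Circle.norm_coe])

/-- The north pole of the sphere. -/
def northPole : Sph := sphMk 0 1 (by simp)

theorem sphProj_mem_closedBall (v : Sph) : sphProj v ∈ closedBall (0 : ℂ) 1 := by
  rw [mem_closedBall_zero_iff]
  nlinarith [norm_sphProj_sq v, sq_nonneg (sphHeight v), norm_nonneg (sphProj v)]

theorem sphProj_mem_ball {v : Sph} (h : sphHeight v ≠ 0) : sphProj v ∈ ball (0 : ℂ) 1 := by
  rw [mem_ball_zero_iff]
  have : 0 < sphHeight v ^ 2 := by positivity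
  nlinarith [norm_sphProj_sq v, norm_nonneg (sphProj v)]

theorem exists_equator_eq {v : Sph} (h : sphHeight v = 0) : ∃ c, equator c = v := by
  have h1 := norm_sphProj_sq v
  rw [h, zero_pow two_ne_zero, add_zero, pow_eq_one_iff_of_nonneg (norm_nonneg _) two_ne_zero] at h1
  exact ⟨⟨sphProj v, mem_sphere_zero_iff_norm.2 h1⟩, sph_ext rfl h.symm⟩

theorem eq_of_sphProj_eq {v w : Sph} (h : sphProj v = sphProj w)
    (h' : 0 ≤ sphHeight v * sphHeight w) : v = w := by
  refine sph_ext h ?_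
  have h1 := norm_sphProj_sq v
  have h2 := norm_sphProj_sq w
  rw [h] at h1
  have h3 : sphHeight v ^ 2 = sphHeight w ^ 2 := by linarith
  rcases sq_eq_sq_iff_eq_or_eq_neg.1 h3 with h4 | h4
  · exact h4
  · rw [h4] at h' ⊢
    have : sphHeight w = 0 := by nlinarith [sq_nonneg (sphHeight w)]
    rw [this, neg_zero]

/-- A point with given projection in the open disc, on the prescribed side. -/
theorem exists_sphProj_eq {z : ℂ} (hz : z ∈ ball (0 : ℂ) 1) :
    ∃ v : Sph, sphProj v = z ∧ 0 < sphHeight v := by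
  rw [mem_ball_zero_iff] at hz
  have h : 0 < 1 - ‖z‖ ^ 2 := by nlinarith [norm_nonneg z]
  exact ⟨sphMk z (√(1 - ‖z‖ ^ 2)) (by rw [Real.sq_sqrt h.le]; ring), rfl, Real.sqrt_pos.2 h⟩

theorem exists_sphProj_eq_neg {z : ℂ} (hz : z ∈ ball (0 : ℂ) 1) :
    ∃ v : Sph, sphProj v = z ∧ sphHeight v < 0 := by
  obtain ⟨v, rfl, hv⟩ := exists_sphProj_eq hz
  exact ⟨sphMk (sphProj v) (-sphHeight v) (by rw [neg_sq]; exact norm_sphProj_sq v), rfl,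
    neg_lt_zero.2 hv⟩

/-- The Schoenflies theorem on the sphere. -/
theorem exists_schoenflies {γ : Circle → Sph} (hγ : Continuous γ) (hi : Function.Injective γ)
    {x : Sph} (hx : x ∉ range γ) : ∃ Φ : Sph ≃ₜ Sph, (∀ c, Φ (equator c) = γ c) ∧
      Φ northPole = x ∧ Φ '' {v | 0 < sphHeight v} = connectedComponentIn (range γ)ᶜ x := by
  obtain ⟨q, hq, hqx⟩ := exists_not_mem_component_sphere hγ hi hx
  have hxq : x ∉ connectedComponentIn (range γ)ᶜ q := fun h => hqx (mem_component_symm hq h)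
  obtain ⟨f, hfc, hfi, hf0, hfγ, hfb⟩ := exists_jordan_disc_sphere hγ hi hx hq hxq
  obtain ⟨g, hgc, hgi, -, hgγ, hgb⟩ := exists_jordan_disc_sphere hγ hi hq hx hqx
  let φ : Sph → Sph := fun v => if 0 ≤ sphHeight v then f (sphProj v) else g (sphProj v)
  have hpos : ∀ v, 0 ≤ sphHeight v → φ v = f (sphProj v) := fun v h => if_pos h
  have hneg : ∀ v, sphHeight v < 0 → φ v = g (sphProj v) := fun v h => if_neg h.not_ge
  have heq : ∀ c, φ (equator c) = γ c := fun c => (hpos _ le_rfl).trans (hfγ c)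
  have hup : ∀ v, 0 < sphHeight v → φ v ∈ connectedComponentIn (range γ)ᶜ x := fun v h => by
    rw [hpos v h.le, ← hfb]
    exact mem_image_of_mem _ (sphProj_mem_ball h.ne')
  have hdown : ∀ v, sphHeight v < 0 → φ v ∈ connectedComponentIn (range γ)ᶜ q := fun v h => by
    rw [hneg v h, ← hgb]
    exact mem_image_of_mem _ (sphProj_mem_ball h.ne)
  have hdisj : ∀ y, y ∈ connectedComponentIn (range γ)ᶜ x →
      y ∉ connectedComponentIn (range γ)ᶜ q := fun y h h' => hqx <| by
    rw [connectedComponentIn_eq h]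
    exact mem_component_symm hq h'
  have hcont : Continuous φ := by
    refine continuous_if_le continuous_const continuous_sphHeight
      (hfc.comp continuous_sphProj.continuousOn fun v _ => sphProj_mem_closedBall v)
      (hgc.comp continuous_sphProj.continuousOn fun v _ => sphProj_mem_closedBall v) fun v hv => ?_
    obtain ⟨c, rfl⟩ := exists_equator_eq hv.symm
    exact (hfγ c).trans (hgγ c).symm
  have hneside : ∀ v w, 0 ≤ sphHeight v → sphHeight w < 0 → φ v ≠ φ w := by
    intro v w hv hw h
    rcases hv.eq_or_lt with hv | hv
    · obtain ⟨c, rfl⟩ := exists_equator_eq hv.symm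
      rw [heq] at h
      exact connectedComponentIn_subset _ _ (hdown w hw) ⟨c, h⟩
    · exact hdisj _ (hup v hv) (h ▸ hdown w hw)
  have hbij : Function.Bijective φ := by
    constructor
    · intro v w h
      rcases le_or_gt 0 (sphHeight v) with hv | hv <;> rcases le_or_gt 0 (sphHeight w) with hw | hw
      · rw [hpos v hv, hpos w hw] at h
        exact eq_of_sphProj_eq (hfi (sphProj_mem_closedBall v) (sphProj_mem_closedBall w) h)
          (mul_nonneg hv hw)
      · exact absurd h (hneside v w hv hw)
      · exact absurd h.symm (hneside w v hw hv)
      · rw [hneg v hv, hneg w hw] at h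
        exact eq_of_sphProj_eq (hgi (sphProj_mem_closedBall v) (sphProj_mem_closedBall w) h)
          (mul_nonneg_of_nonpos_of_nonpos hv.le hw.le)
    · intro y
      by_cases hyγ : y ∈ range γ
      · obtain ⟨c, rfl⟩ := hyγ
        exact ⟨_, heq c⟩
      by_cases hyx : y ∈ connectedComponentIn (range γ)ᶜ x
      · rw [← hfb] at hyx
        obtain ⟨z, hz, rfl⟩ := hyx
        obtain ⟨v, rfl, hv⟩ := exists_sphProj_eq hz
        exact ⟨v, hpos v hv.le⟩
      · have hyq := mem_component_of_not_mem hγ hi hx hq hqx hyγ hyx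
        rw [← hgb] at hyq
        obtain ⟨z, hz, rfl⟩ := hyq
        obtain ⟨v, rfl, hv⟩ := exists_sphProj_eq_neg hz
        exact ⟨v, hneg v hv⟩
  refine ⟨hcont.homeoOfEquivCompactToT2 (f := Equiv.ofBijective φ hbij), heq, ?_, ?_⟩
  · exact (hpos _ zero_le_one).trans hf0
  · refine Subset.antisymm ?_ fun y hy => ?_
    · rintro _ ⟨v, hv, rfl⟩
      exact hup v hv
    · rw [← hfb] at hy
      obtain ⟨z, hz, rfl⟩ := hy
      obtain ⟨v, rfl, hv⟩ := exists_sphProj_eq hz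
      exact ⟨v, hv, hpos v hv.le⟩

end Schoenflies

section Orientation
open Filter Topology Metric

theorem sph_sum_sq (v : Sph) : v.1 0 ^ 2 + v.1 1 ^ 2 + v.1 2 ^ 2 = 1 := by
  have h : ‖(v : EuclideanSpace ℝ (Fin 3))‖ = 1 := mem_sphere_zero_iff_norm.1 v.2
  have h2 := EuclideanSpace.real_norm_sq_eq (v : EuclideanSpace ℝ (Fin 3))
  rw [h, Fin.sum_univ_three] at h2
  linarith

theorem continuous_sph_apply (i : Fin 3) : Continuous fun v : Sph => v.1 i := by fun_prop

/-- The point `(1, 0, 0)` of the sphere. -/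
def eastPole : Sph := equator 1

@[simp] theorem eastPole_zero : eastPole.1 0 = 1 := rfl
@[simp] theorem eastPole_one : eastPole.1 1 = 0 := rfl
@[simp] theorem eastPole_two : eastPole.1 2 = 0 := rfl

theorem eq_eastPole {v : Sph} (h0 : 0 < v.1 0) (h1 : v.1 1 = 0) (h2 : v.1 2 = 0) :
    v = eastPole := by
  have h := sph_sum_sq v
  have h3 : v.1 0 = 1 := by
    rw [h1, h2] at h
    nlinarith
  ext i
  fin_cases i
  · exact h3
  · exact h1
  · exact h2

theorem dist_eastPole_sq (v : Sph) : dist v eastPole ^ 2 = 2 - 2 * v.1 0 := by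
  rw [Subtype.dist_eq, dist_eq_norm, EuclideanSpace.real_norm_sq_eq, Fin.sum_univ_three]
  have h := sph_sum_sq v
  simp only [PiLp.sub_apply, eastPole_zero, eastPole_one, eastPole_two]
  linarith

theorem exists_cap_subset {U : Set Sph} (hU : U ∈ 𝓝 eastPole) :
    ∃ r, 0 < r ∧ r < 1 ∧ {v : Sph | r < v.1 0} ⊆ U := by
  obtain ⟨ε, hε, h⟩ := Metric.mem_nhds_iff.1 hU
  refine ⟨max (1 / 2) (1 - ε ^ 2 / 2), lt_max_of_lt_left (by norm_num),
    max_lt (by norm_num) (by linarith [pow_pos hε 2]), fun v hv => h ?_⟩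
  rw [mem_ball]
  have h1 := dist_eastPole_sq v
  have h2 : 1 - ε ^ 2 / 2 < v.1 0 := (le_max_right _ _).trans_lt hv
  exact lt_of_pow_lt_pow_left₀ 2 hε.le (by linarith)

theorem cap_mem_nhds {r : ℝ} (hr : r < 1) : {v : Sph | r < v.1 0} ∈ 𝓝 eastPole :=
  (isOpen_lt continuous_const (continuous_sph_apply 0)).mem_nhds hr

/-- The point of the eastern hemisphere with the given remaining coordinates. -/
def eastMk (z : ℂ) (h : ‖z‖ ≤ 1) : Sph :=
  ⟨!₂[√(1 - ‖z‖ ^ 2), z.re, z.im], by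
    rw [mem_sphere_zero_iff_norm, ← sq_eq_sq₀ (norm_nonneg _) zero_le_one,
      EuclideanSpace.real_norm_sq_eq, Fin.sum_univ_three]
    simp only [Matrix.cons_val]
    rw [Real.sq_sqrt (by nlinarith [norm_nonneg z]), ← Complex.normSq_eq_norm_sq,
      Complex.normSq_apply]
    ring⟩

theorem continuous_eastMk :
    Continuous fun z : {z : ℂ // ‖z‖ ≤ 1} => eastMk z z.2 := by
  unfold eastMk
  refine Continuous.subtype_mk ?_ _
  refine (PiLp.continuous_toLp 2 _).comp (continuous_pi fun i => ?_)
  fin_cases i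
  · simp
    fun_prop
  · simp
    fun_prop
  · simp
    fun_prop

theorem eq_eastMk {v : Sph} (h : 0 ≤ v.1 0) : ∃ hz, v = eastMk ⟨v.1 1, v.1 2⟩ hz := by
  have h1 := sph_sum_sq v
  have h2 : ‖(⟨v.1 1, v.1 2⟩ : ℂ)‖ ^ 2 = v.1 1 ^ 2 + v.1 2 ^ 2 := by
    rw [← Complex.normSq_eq_norm_sq, Complex.normSq_apply]
    ring
  refine ⟨by nlinarith [norm_nonneg (⟨v.1 1, v.1 2⟩ : ℂ), sq_nonneg (v.1 0)], ?_⟩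
  ext i
  fin_cases i
  · change v.1 0 = √_
    rw [h2, show 1 - (v.1 1 ^ 2 + v.1 2 ^ 2) = v.1 0 ^ 2 by linarith, Real.sqrt_sq h]
  · rfl
  · rfl

theorem isPreconnected_cap_inter {r : ℝ} (hr : 0 < r) {K : Set ℂ} (hK : Convex ℝ K) :
    IsPreconnected {v : Sph | r < v.1 0 ∧ (⟨v.1 1, v.1 2⟩ : ℂ) ∈ K} := by
  let S : Set ℂ := {z : ℂ | ‖z‖ < √(1 - r ^ 2)} ∩ K
  have hS : IsPreconnected S := by
    refine Convex.isPreconnected (Convex.inter ?_ hK)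
    simpa [ball, dist_zero_right] using convex_ball (0 : ℂ) √(1 - r ^ 2)
  have hle : ∀ z ∈ S, ‖z‖ ≤ 1 := fun z hz => hz.1.le.trans
    (Real.sqrt_le_one.2 (by nlinarith))
  have : PreconnectedSpace S := isPreconnected_iff_preconnectedSpace.1 hS
  have h1 : IsPreconnected (range fun z : S => eastMk z (hle z z.2)) :=
    isPreconnected_range <| continuous_eastMk.comp
      (continuous_subtype_val.subtype_mk fun z : S => hle z z.2)
  convert h1 using 1
  ext v
  constructor
  · rintro ⟨hv, hv'⟩
    obtain ⟨hz, h⟩ := eq_eastMk (hr.trans hv).le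
    refine ⟨⟨_, ?_, hv'⟩, h.symm⟩
    refine Real.lt_sqrt_of_sq_lt ?_
    rw [← Complex.normSq_eq_norm_sq, Complex.normSq_apply]
    nlinarith [sph_sum_sq v]
  · rintro ⟨⟨z, hz, hz'⟩, rfl⟩
    refine ⟨?_, hz'⟩
    change r < √(1 - ‖z‖ ^ 2)
    have h2 : ‖z‖ < √(1 - r ^ 2) := hz
    have h3 := (Real.lt_sqrt (norm_nonneg _)).1 h2
    exact (Real.lt_sqrt hr.le).2 (by linarith)

/-- Radial projection to the sphere of a nowhere vanishing map. -/
def sphNormalize {X : Type*} [TopologicalSpace X] (w : X → EuclideanSpace ℝ (Fin 3))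
    (hw : Continuous w) (h0 : ∀ x, w x ≠ 0) : C(X, Sph) where
  toFun x := ⟨‖w x‖⁻¹ • w x, by
    rw [mem_sphere_zero_iff_norm, norm_smul, norm_inv, norm_norm,
      inv_mul_cancel₀ (norm_ne_zero_iff.2 (h0 x))]⟩
  continuous_toFun := ((hw.norm.inv₀ fun x => norm_ne_zero_iff.2 (h0 x)).smul hw).subtype_mk _

theorem sphNormalize_of_norm_eq_one {X : Type*} [TopologicalSpace X]
    {w : X → EuclideanSpace ℝ (Fin 3)} {hw : Continuous w} {h0 : ∀ x, w x ≠ 0} {x : X} {v : Sph}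
    (h : w x = v) : sphNormalize w hw h0 x = v := by
  refine Subtype.ext ?_
  change ‖w x‖⁻¹ • w x = v
  rw [h, mem_sphere_zero_iff_norm.1 v.2, inv_one, one_smul]

/-- Two self-maps which agree near a point and send nothing else to that point are homotopic. -/
theorem homotopic_of_eventuallyEq {g₁ g₂ : C(Sph, Sph)} {p : Sph} (h : ∀ᶠ z in 𝓝 p, g₁ z = g₂ z)
    (h₁ : ∀ z, z ≠ p → g₁ z ≠ p) (h₂ : ∀ z, z ≠ p → g₂ z ≠ p) : g₁.Homotopic g₂ := by
  classical
  let F : I × Sph → Sph := fun a => if a.2 = p then g₁ p else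
    (stereo p).symm ((1 - (a.1 : ℝ) : ℂ) * stereo p (g₁ a.2) + (a.1 : ℝ) * stereo p (g₂ a.2))
  have hF : ∀ a : I × Sph, g₁ a.2 = g₂ a.2 → F a = g₁ a.2 := by
    rintro ⟨s, z⟩ hz
    by_cases hzp : z = p
    · simp [F, hzp]
    · have h3 : (1 - (s : ℝ) : ℂ) * stereo p (g₁ z) + (s : ℝ) * stereo p (g₁ z) =
        stereo p (g₁ z) := by ring
      simp only [F, if_neg hzp, ← (show g₁ z = g₂ z from hz), h3]
      exact stereo_symm_stereo (h₁ z hzp)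
  refine ⟨⟨⟨F, continuous_iff_continuousAt.2 ?_⟩, fun z => ?_, fun z => ?_⟩⟩
  · rintro ⟨s, z⟩
    by_cases hzp : z = p
    · subst hzp
      have h3 : ∀ᶠ a : I × Sph in 𝓝 (s, z), g₁ a.2 = F a := by
        filter_upwards [continuousAt_snd.eventually h] with a ha using (hF a ha).symm
      exact ((g₁.continuous.comp continuous_snd).continuousAt).congr h3
    · have h3 : ∀ᶠ a : I × Sph in 𝓝 (s, z), a.2 ≠ p := continuousAt_snd.eventually
        (isOpen_compl_singleton.mem_nhds hzp)
      have hst : ∀ g : C(Sph, Sph), g z ≠ p →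
          ContinuousAt (fun a : I × Sph => stereo p (g a.2)) (s, z) := fun g hg =>
        ((continuousOn_stereo p).continuousAt (isOpen_compl_singleton.mem_nhds hg)).comp
          (f := fun a : I × Sph => g a.2) (g.continuous.comp continuous_snd).continuousAt
      have hs : ContinuousAt (fun a : I × Sph => ((a.1 : ℝ) : ℂ)) (s, z) := by fun_prop
      refine ContinuousAt.congr (f := fun a : I × Sph => (stereo p).symm
        ((1 - (a.1 : ℝ) : ℂ) * stereo p (g₁ a.2) + (a.1 : ℝ) * stereo p (g₂ a.2))) ?_ ?_
      · exact (continuous_stereo_symm p).continuousAt.comp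
          (((continuousAt_const.sub hs).mul (hst g₁ (h₁ z hzp))).add
            (hs.mul (hst g₂ (h₂ z hzp))))
      · filter_upwards [h3] with a ha
        simp only [F, if_neg ha]
  · by_cases hzp : z = p
    · simp [F, hzp]
    · simp [F, hzp, stereo_symm_stereo (h₁ z hzp)]
  · by_cases hzp : z = p
    · simp [F, hzp, h.self_of_nhds]
    · simp [F, hzp, stereo_symm_stereo (h₂ z hzp)]

/-- A self-map fixing `eastPole` which near that point never reverses directions is homotopic
to the identity. -/
theorem homotopic_id_of_signs {k : C(Sph, Sph)} (hp : k eastPole = eastPole)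
    (hk : ∀ z, z ≠ eastPole → k z ≠ eastPole)
    (hs : ∀ᶠ z in 𝓝 eastPole, (0 < z.1 2 → 0 < (k z).1 2) ∧ (z.1 2 < 0 → (k z).1 2 < 0) ∧
      (z.1 2 = 0 → 0 < z.1 1 → (k z).1 2 = 0 ∧ 0 < (k z).1 1) ∧
      (z.1 2 = 0 → z.1 1 < 0 → (k z).1 2 = 0 ∧ (k z).1 1 < 0)) :
    k.Homotopic (ContinuousMap.id Sph) := by
  have hk0 : ∀ᶠ z in 𝓝 eastPole, 0 < (k z).1 0 := by
    refine ((continuous_sph_apply 0).comp k.continuous).continuousAt.eventually_const_lt ?_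
    simp [hp]
  obtain ⟨r, hr0, hr1, hr⟩ := exists_cap_subset (hs.and hk0)
  let χ : Sph → ℝ := fun z => max 0 (min 1 (2 * (z.1 0 - r) / (1 - r)))
  have hχ : Continuous χ := by fun_prop
  have hχ0 : ∀ z, 0 ≤ χ z := fun z => le_max_left _ _
  have hχ1 : ∀ z, χ z ≤ 1 := fun z => max_le zero_le_one (min_le_left _ _)
  have hχr : ∀ z, z.1 0 ≤ r → χ z = 0 := fun z hz => max_eq_left <| (min_le_right _ _).trans <|
    div_nonpos_of_nonpos_of_nonneg (by linarith) (by linarith)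
  have hχp : ∀ z, (1 + r) / 2 < z.1 0 → χ z = 1 := fun z hz => by
    have : 1 ≤ 2 * (z.1 0 - r) / (1 - r) := by rw [le_div_iff₀ (by linarith)]; linarith
    simp only [χ, min_eq_left this]
    exact max_eq_right zero_le_one
  let w : I × Sph → EuclideanSpace ℝ (Fin 3) := fun a =>
    (1 - (a.1 : ℝ) * χ a.2) • (k a.2 : EuclideanSpace ℝ (Fin 3)) + ((a.1 : ℝ) * χ a.2) • a.2.1
  have hwc : Continuous w := by fun_prop
  have hwi : ∀ a i, (w a).1 i =
      (1 - (a.1 : ℝ) * χ a.2) * (k a.2).1 i + ((a.1 : ℝ) * χ a.2) * a.2.1 i := fun a i => by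
    simp [w]
  have hwk : ∀ a : I × Sph, a.2.1 0 ≤ r → w a = k a.2 := fun a ha => by simp [w, hχr _ ha]
  have hc0 : ∀ a : I × Sph, 0 ≤ (a.1 : ℝ) * χ a.2 := fun a => mul_nonneg a.1.2.1 (hχ0 _)
  have hc1 : ∀ a : I × Sph, 0 ≤ 1 - (a.1 : ℝ) * χ a.2 := fun a =>
    sub_nonneg.2 (mul_le_one₀ a.1.2.2 (hχ0 _) (hχ1 _))
  have hcomb : ∀ (a : I × Sph) {m n : ℝ}, 0 < m → 0 < n →
      0 < (1 - (a.1 : ℝ) * χ a.2) * m + ((a.1 : ℝ) * χ a.2) * n := fun a m n hm hn => by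
    rcases (hc0 a).eq_or_lt with h | h
    · rw [← h]; linarith
    · exact add_pos_of_nonneg_of_pos (mul_nonneg (hc1 a) hm.le) (mul_pos h hn)
  have hw0 : ∀ a, w a ≠ 0 := fun a h => by
    rcases le_or_gt (a.2.1 0) r with h1 | h1
    · rw [hwk a h1] at h
      have := mem_sphere_zero_iff_norm.1 (k a.2).2
      simp [h] at this
    · have h2 := hcomb a (hr h1).2 (hr0.trans h1)
      rw [← hwi, h] at h2
      exact lt_irrefl _ h2
  let G := sphNormalize w hwc hw0
  have hGi : ∀ a i, (G a).1 i = ‖w a‖⁻¹ * (w a).1 i := fun a i => rfl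
  have hG : ∀ a : I × Sph, a.2 ≠ eastPole → G a ≠ eastPole := by
    rintro ⟨s, z⟩ hz h
    rcases le_or_gt (z.1 0) r with h1 | h1
    · exact hk z hz ((sphNormalize_of_norm_eq_one (hwk (s, z) h1)).symm.trans h)
    · have hn : 0 < ‖w (s, z)‖⁻¹ := inv_pos.2 (norm_pos_iff.2 (hw0 _))
      have e : ∀ i, eastPole.1 i = 0 → (w (s, z)).1 i = 0 := fun i hi => by
        rw [← h, hGi] at hi
        exact (mul_eq_zero.1 hi).resolve_left hn.ne'
      have e1 := e 1 rfl
      have e2 := e 2 rfl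
      rw [hwi] at e1 e2
      obtain ⟨⟨s1, s2, s3, s4⟩, -⟩ := hr h1
      rcases lt_trichotomy (z.1 2) 0 with h2 | h2 | h2
      · have := hcomb (s, z) (neg_pos.2 (s2 h2)) (neg_pos.2 h2)
        dsimp only at this e2
        linarith
      · rcases lt_trichotomy (z.1 1) 0 with h3 | h3 | h3
        · have := hcomb (s, z) (neg_pos.2 (s4 h2 h3).2) (neg_pos.2 h3)
          dsimp only at this e1
          linarith
        · exact hz (eq_eastPole (hr0.trans h1) h3 h2)
        · have := hcomb (s, z) (s3 h2 h3).2 h3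
          dsimp only at this e1
          linarith
      · have := hcomb (s, z) (s1 h2) h2
        dsimp only at this e2
        linarith
  let g : C(Sph, Sph) := G.comp ((ContinuousMap.const Sph 1).prodMk (ContinuousMap.id Sph))
  have hkg : k.Homotopic g :=
    ⟨⟨G, fun z => sphNormalize_of_norm_eq_one (by simp [w]), fun z => rfl⟩⟩
  refine hkg.trans (homotopic_of_eventuallyEq (p := eastPole) ?_ (fun z hz => hG (1, z) hz)
    fun z hz => hz)
  filter_upwards [cap_mem_nhds (r := (1 + r) / 2) (by linarith)] with z hz
  have h1 : w (1, z) = z := by simp [w, hχp z hz]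
  exact sphNormalize_of_norm_eq_one (hw := hwc) (h0 := hw0) h1

end Orientation

section Germ
open Filter Topology Metric

theorem convex_im_preimage {s : Set ℝ} (hs : Convex ℝ s) : Convex ℝ {z : ℂ | z.im ∈ s} :=
  hs.linear_preimage Complex.imLm

/-- A preconnected set on which a function does not vanish is on one side of zero. -/
theorem forall_pos_of_isPreconnected {X : Type*} [TopologicalSpace X] {S : Set X}
    (hS : IsPreconnected S) {f : X → ℝ} (hf : ContinuousOn f S) (h0 : ∀ x ∈ S, f x ≠ 0)
    {x : X} (hx : x ∈ S) (hpos : 0 < f x) : ∀ y ∈ S, 0 < f y := by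
  intro y hy
  by_contra h
  obtain ⟨z, hz, hz0⟩ := hS.intermediate_value hy hx hf ⟨not_lt.1 h, hpos.le⟩
  exact h0 z hz hz0

theorem exists_mem_cap {r : ℝ} (hr : 0 < r) (hr1 : r < 1) : ∃ a : ℝ, 0 < a ∧ ∀ s : ℝ, s ^ 2 = 1 →
    (∃ v : Sph, r < v.1 0 ∧ v.1 1 = s * a ∧ v.1 2 = 0) ∧
      ∃ v : Sph, r < v.1 0 ∧ v.1 1 = 0 ∧ v.1 2 = s * a := by
  have h : 0 < 1 - ((1 + r) / 2) ^ 2 := by nlinarith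
  have h1 := Real.sq_sqrt h.le
  refine ⟨√(1 - ((1 + r) / 2) ^ 2), Real.sqrt_pos.2 h, fun s hs => ⟨⟨sphMk ⟨(1 + r) / 2, s *
    √(1 - ((1 + r) / 2) ^ 2)⟩ 0 ?_, ?_, rfl, rfl⟩, ⟨sphMk ⟨(1 + r) / 2, 0⟩ (s *
    √(1 - ((1 + r) / 2) ^ 2)) ?_, ?_, rfl, rfl⟩⟩⟩
  · rw [← Complex.normSq_eq_norm_sq, Complex.normSq_apply]
    linear_combination h1 + √(1 - ((1 + r) / 2) ^ 2) ^ 2 * hs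
  · change r < (1 + r) / 2
    linarith
  · rw [← Complex.normSq_eq_norm_sq, Complex.normSq_apply]
    linear_combination h1 + √(1 - ((1 + r) / 2) ^ 2) ^ 2 * hs
  · change r < (1 + r) / 2
    linarith

/-- A self-homeomorphism fixing `eastPole` which near that point preserves the two rays of the
equator and the upper side is homotopic to the identity. -/
theorem homotopic_id_of_germ (k : Sph ≃ₜ Sph) (hp : k eastPole = eastPole)
    (hpos : ∀ᶠ v in 𝓝 eastPole, v.1 2 = 0 → 0 ≤ v.1 1 → (k v).1 2 = 0 ∧ 0 ≤ (k v).1 1)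
    (hneg : ∀ᶠ v in 𝓝 eastPole, v.1 2 = 0 → v.1 1 ≤ 0 → (k v).1 2 = 0 ∧ (k v).1 1 ≤ 0)
    (hup : ∃ᶠ v in 𝓝 eastPole, 0 < v.1 2 ∧ 0 < (k v).1 2) : OrientPres k := by
  have hkne : ∀ z, z ≠ eastPole → k z ≠ eastPole := fun z hz h =>
    hz (k.injective (h.trans hp.symm))
  have hkc : ∀ i, Continuous fun v => (k v).1 i := fun i =>
    (continuous_sph_apply i).comp k.continuous
  have hk0 : ∀ᶠ z in 𝓝 eastPole, 0 < (k z).1 0 := by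
    refine (hkc 0).continuousAt.eventually_const_lt ?_
    simp [hp]
  obtain ⟨r, hr0, hr1, hr⟩ := exists_cap_subset (hk0.and (hpos.and hneg))
  have hspos : ∀ v : Sph, r < v.1 0 → v.1 2 = 0 → 0 < v.1 1 →
      (k v).1 2 = 0 ∧ 0 < (k v).1 1 := fun v hv h2 h1 => by
    obtain ⟨h3, h4, -⟩ := hr hv
    obtain ⟨h5, h6⟩ := h4 h2 h1.le
    refine ⟨h5, h6.lt_of_ne fun h => hkne v ?_ (eq_eastPole h3 h.symm h5)⟩
    rintro rfl
    exact h1.ne rfl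
  have hsneg : ∀ v : Sph, r < v.1 0 → v.1 2 = 0 → v.1 1 < 0 →
      (k v).1 2 = 0 ∧ (k v).1 1 < 0 := fun v hv h2 h1 => by
    obtain ⟨h3, -, h4⟩ := hr hv
    obtain ⟨h5, h6⟩ := h4 h2 h1.le
    refine ⟨h5, h6.lt_of_ne fun h => hkne v ?_ (eq_eastPole h3 h h5)⟩
    rintro rfl
    exact h1.ne rfl
  have hA : IsPreconnected {v : Sph | r < v.1 0 ∧ v.1 2 ∈ ({0} : Set ℝ)} :=
    isPreconnected_cap_inter hr0 (convex_im_preimage (convex_singleton (0 : ℝ)))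
  obtain ⟨a, ha, hav⟩ := exists_mem_cap hr0 hr1
  obtain ⟨v₁, h10, h11, h12⟩ := (hav 1 (by norm_num)).1
  obtain ⟨v₂, h20, h21, h22⟩ := (hav (-1) (by norm_num)).1
  have hv₁ := (hspos v₁ h10 h12 (by linarith)).2
  have hv₂ := (hsneg v₂ h20 h22 (by linarith)).2
  have hk1 : ∀ᶠ z in 𝓝 eastPole, (k v₂).1 1 < (k z).1 1 ∧ (k z).1 1 < (k v₁).1 1 := by
    refine ((hkc 1).continuousAt.eventually_const_lt ?_).and
      ((hkc 1).continuousAt.eventually_lt_const ?_)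
    · simpa [hp] using hv₂
    · simpa [hp] using hv₁
  obtain ⟨r', hr0', hr1', hr'⟩ := exists_cap_subset (hk1.and (cap_mem_nhds hr1))
  have hne : ∀ v : Sph, r' < v.1 0 → v.1 2 ≠ 0 → (k v).1 2 ≠ 0 := fun v hv h2 h => h2 <| by
    obtain ⟨⟨h3, h4⟩, h5⟩ := hr' hv
    obtain ⟨u, ⟨hu, hu2⟩, hu1⟩ := hA.intermediate_value ⟨h20, h22⟩ ⟨h10, h12⟩
      (hkc 1).continuousOn ⟨h3.le, h4.le⟩
    obtain ⟨hu3, hu4, hu5⟩ := hr hu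
    have hu6 : (k u).1 2 = 0 := (le_total 0 (u.1 1)).elim (fun h => (hu4 hu2 h).1)
      fun h => (hu5 hu2 h).1
    have hv3 : 0 < (k v).1 0 := (hr h5).1
    have huv : k u = k v := by
      have e1 := sph_sum_sq (k u)
      have e2 := sph_sum_sq (k v)
      dsimp only at hu1
      rw [hu6, hu1] at e1
      rw [h] at e2
      have e3 : (k u).1 0 = (k v).1 0 :=
        (sq_eq_sq₀ hu3.le hv3.le).1 (by linarith)
      ext i
      fin_cases i
      · exact e3
      · exact hu1
      · exact hu6.trans h.symm
    rw [← k.injective huv]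
    exact hu2
  have hU : ∀ v : Sph, r' < v.1 0 → 0 < v.1 2 → 0 < (k v).1 2 := by
    obtain ⟨v, ⟨hv2, hv2'⟩, hv0⟩ := (hup.and_eventually (cap_mem_nhds hr1')).exists
    have hC : IsPreconnected {v : Sph | r' < v.1 0 ∧ v.1 2 ∈ Ioi (0 : ℝ)} :=
      isPreconnected_cap_inter hr0' (convex_im_preimage (convex_Ioi (0 : ℝ)))
    exact fun u hu hu2 => forall_pos_of_isPreconnected hC (hkc 2).continuousOn
      (fun w hw => hne w hw.1 hw.2.ne') ⟨hv0, hv2⟩ hv2' u ⟨hu, hu2⟩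
  have hL : ∀ v : Sph, r' < v.1 0 → v.1 2 < 0 → (k v).1 2 < 0 := by
    intro v hv hv2
    by_contra hcon
    have hC : IsPreconnected {v : Sph | r' < v.1 0 ∧ v.1 2 ∈ Iio (0 : ℝ)} :=
      isPreconnected_cap_inter hr0' (convex_im_preimage (convex_Iio (0 : ℝ)))
    have hall : ∀ u : Sph, r' < u.1 0 → 0 ≤ (k u).1 2 := fun u hu => by
      rcases lt_trichotomy (u.1 2) 0 with h | h | h
      · exact (forall_pos_of_isPreconnected hC (hkc 2).continuousOn
          (fun w hw => hne w hw.1 hw.2.ne) ⟨hv, hv2⟩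
          ((not_lt.1 hcon).lt_of_ne (hne v hv hv2.ne).symm) u ⟨hu, h⟩).le
      · obtain ⟨-, h4, h5⟩ := hr (hr' hu).2
        exact ((le_total 0 (u.1 1)).elim (fun h' => (h4 h h').1) fun h' => (h5 h h').1).ge
      · exact (hU u hu h).le
    have hop : k '' {v : Sph | r' < v.1 0} ∈ 𝓝 eastPole := by
      rw [← hp]
      exact k.isOpenMap.image_mem_nhds (cap_mem_nhds hr1')
    obtain ⟨s, hs0, hs1, hs⟩ := exists_cap_subset hop
    obtain ⟨b, hb, hbv⟩ := exists_mem_cap hs0 hs1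
    obtain ⟨u, hu0, -, hu2⟩ := (hbv (-1) (by norm_num)).2
    obtain ⟨w, hw, rfl⟩ := hs hu0
    linarith [hall w hw]
  refine homotopic_id_of_signs hp hkne ?_
  filter_upwards [cap_mem_nhds hr1'] with z hz
  exact ⟨hU z hz, hL z hz, hspos z (hr' hz).2, hsneg z (hr' hz).2⟩

end Germ

section Transport
open Filter Topology Metric

theorem continuous_equator : Continuous equator := by
  unfold equator sphMk
  refine Continuous.subtype_mk ?_ _
  refine (PiLp.continuous_toLp 2 _).comp (continuous_pi fun i => ?_)
  fin_cases i
  · simp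
    fun_prop
  · simp
    fun_prop
  · simp
    fun_prop

theorem equator_injective : Function.Injective equator := fun a b h =>
  Subtype.ext (by simpa [equator] using congrArg sphProj h)

theorem eventually_equator {P : Circle → Prop} (h : ∀ᶠ c in 𝓝 1, P c) :
    ∀ᶠ v in 𝓝 eastPole, ∀ c, equator c = v → P c := by
  rwa [(continuous_equator.isClosedEmbedding equator_injective).isInducing.nhds_eq_comap,
    eventually_comap] at h

/-- Two Jordan curves with marked complementary components are matched by an orientation
preserving homeomorphism as soon as their germs at a point are. -/
theorem exists_orientPres_of_germ {γ₁ γ₂ : Circle → Sph} (hγ₁ : Continuous γ₁)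
    (hi₁ : Function.Injective γ₁) (hγ₂ : Continuous γ₂) (hi₂ : Function.Injective γ₂)
    {x₁ x₂ : Sph} (hx₁ : x₁ ∉ range γ₁) (hx₂ : x₂ ∉ range γ₂) {h : Sph ≃ₜ Sph} (ho : OrientPres h)
    (h1 : h (γ₁ 1) = γ₂ 1)
    (hpos : ∀ᶠ c : Circle in 𝓝 1, 0 ≤ (c : ℂ).im → h (γ₁ c) ∈ γ₂ '' {c | 0 ≤ (c : ℂ).im})
    (hneg : ∀ᶠ c : Circle in 𝓝 1, (c : ℂ).im ≤ 0 → h (γ₁ c) ∈ γ₂ '' {c | (c : ℂ).im ≤ 0})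
    (hup : ∃ᶠ y in 𝓝 (γ₁ 1), y ∈ connectedComponentIn (range γ₁)ᶜ x₁ ∧
      h y ∈ connectedComponentIn (range γ₂)ᶜ x₂) :
    ∃ H : Sph ≃ₜ Sph, OrientPres H ∧ (∀ c, H (γ₁ c) = γ₂ c) ∧ H x₁ = x₂ ∧
      H '' connectedComponentIn (range γ₁)ᶜ x₁ = connectedComponentIn (range γ₂)ᶜ x₂ := by
  obtain ⟨Φ₁, hΦ₁, hN₁, hC₁⟩ := exists_schoenflies hγ₁ hi₁ hx₁
  obtain ⟨Φ₂, hΦ₂, hN₂, hC₂⟩ := exists_schoenflies hγ₂ hi₂ hx₂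
  have hs₁ : ∀ c, Φ₁.symm (γ₁ c) = equator c := fun c => by
    rw [← hΦ₁, Φ₁.symm_apply_apply]
  have hs₂ : ∀ c, Φ₂.symm (γ₂ c) = equator c := fun c => by
    rw [← hΦ₂, Φ₂.symm_apply_apply]
  have hk : OrientPres (Φ₁.trans (h.trans Φ₂.symm)) := by
    refine homotopic_id_of_germ _ ?_ ?_ ?_ ?_
    · change Φ₂.symm (h (Φ₁ (equator 1))) = equator 1
      rw [hΦ₁, h1, hs₂]
    · filter_upwards [eventually_equator hpos] with v hv h2 h3
      obtain ⟨c, rfl⟩ := exists_equator_eq h2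
      obtain ⟨c', hc', he⟩ := hv c rfl h3
      change (Φ₂.symm (h (Φ₁ (equator c)))).1 2 = 0 ∧ 0 ≤ (Φ₂.symm (h (Φ₁ (equator c)))).1 1
      rw [hΦ₁, ← he, hs₂]
      exact ⟨rfl, hc'⟩
    · filter_upwards [eventually_equator hneg] with v hv h2 h3
      obtain ⟨c, rfl⟩ := exists_equator_eq h2
      obtain ⟨c', hc', he⟩ := hv c rfl h3
      change (Φ₂.symm (h (Φ₁ (equator c)))).1 2 = 0 ∧ (Φ₂.symm (h (Φ₁ (equator c)))).1 1 ≤ 0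
      rw [hΦ₁, ← he, hs₂]
      exact ⟨rfl, hc'⟩
    · have hN : Tendsto Φ₁.symm (𝓝 (γ₁ 1)) (𝓝 eastPole) := by
        have := Φ₁.symm.continuous.tendsto (γ₁ 1)
        rwa [hs₁] at this
      refine hN.frequently (hup.mono ?_)
      rintro y ⟨hy, hy'⟩
      rw [← hC₁] at hy
      rw [← hC₂] at hy'
      obtain ⟨v, hv, rfl⟩ := hy
      obtain ⟨w, hw, hwv⟩ := hy'
      rw [Φ₁.symm_apply_apply]
      refine ⟨hv, ?_⟩
      change 0 < (Φ₂.symm (h (Φ₁ v))).1 2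
      rw [← hwv, Φ₂.symm_apply_apply]
      exact hw
  have e1 : ∀ v, Φ₂ (Φ₂.symm (h (Φ₁ (Φ₁.symm v)))) = h v := fun v => by simp
  refine ⟨Φ₁.symm.trans Φ₂, ?_, fun c => ?_, ?_, ?_⟩
  · have h3 := ((ContinuousMap.Homotopic.refl ⟨Φ₂, Φ₂.continuous⟩).comp hk).comp
      (ContinuousMap.Homotopic.refl ⟨Φ₁.symm, Φ₁.symm.continuous⟩)
    refine ContinuousMap.Homotopic.trans (ContinuousMap.Homotopic.symm ?_) ho
    convert h3 using 1
    · exact ContinuousMap.ext fun v => (e1 v).symm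
    · rfl
  · change Φ₂ (Φ₁.symm (γ₁ c)) = γ₂ c
    rw [hs₁, hΦ₂]
  · change Φ₂ (Φ₁.symm x₁) = x₂
    rw [← hN₁, Φ₁.symm_apply_apply, hN₂]
  · rw [← hC₁, ← hC₂, ← image_comp]
    congr 1
    ext v
    simp

end Transport

section Loops
open Filter Topology Metric

variable {X : Type*} [TopologicalSpace X] {a b c : X}

theorem exists_circle_of_loop (l : Path a a)
    (hl : ∀ s t : I, l s = l t → s < t → s = 0 ∧ t = 1) :
    ∃ γ : Circle → X, Continuous γ ∧ Function.Injective γ ∧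
      ∀ t : I, γ (Circle.exp (2 * Real.pi * t)) = l t := by
  have : Fact ((0 : ℝ) < 1) := ⟨one_pos⟩
  let e : AddCircle (1 : ℝ) ≃ₜ Circle := AddCircle.homeomorphCircle one_ne_zero
  have he : ∀ t : ℝ, e.symm (Circle.exp (2 * Real.pi * t)) = (t : AddCircle (1 : ℝ)) := fun t => by
    rw [e.symm_apply_eq, AddCircle.homeomorphCircle_apply, AddCircle.toCircle_apply_mk, div_one]
  let γ : Circle → X := fun c => AddCircle.liftIco 1 0 l.extend (e.symm c)
  have h0 : l.extend 0 = l.extend (0 + 1) := by simp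
  have hγ : ∀ t : I, γ (Circle.exp (2 * Real.pi * t)) = l t := fun t => by
    simp only [γ, he]
    rcases t.2.2.lt_or_eq with ht | ht
    · rw [AddCircle.liftIco_coe_apply (by simpa using ⟨t.2.1, ht⟩), Path.extend_apply _ t.2]
    · have h1 : t = 1 := Subtype.ext ht
      rw [ht, h1, Path.target, AddCircle.coe_period,
        ← QuotientAddGroup.mk_zero, AddCircle.liftIco_coe_apply (by simp), Path.extend_zero]
  refine ⟨γ, ?_, fun z w hzw => ?_, hγ⟩
  · exact (AddCircle.liftIco_continuous h0 l.continuous_extend.continuousOn).comp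
      e.symm.continuous
  · obtain ⟨s, hs, rfl⟩ := exists_circleExp 0 z
    obtain ⟨t, ht, rfl⟩ := exists_circleExp 0 w
    rw [zero_add] at hs ht
    have hz := hγ ⟨s, hs.1, hs.2.le⟩
    have hw := hγ ⟨t, ht.1, ht.2.le⟩
    rw [hz, hw] at hzw
    rcases lt_trichotomy s t with h | h | h
    · exact absurd (congrArg Subtype.val (hl _ _ hzw h).2) ht.2.ne
    · rw [h]
    · exact absurd (congrArg Subtype.val (hl _ _ hzw.symm h).2) hs.2.ne

theorem trans_eq_trans {p : Path a b} {q : Path b c} (hp : Function.Injective p)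
    (hq : Function.Injective q) {s t : I} (h : p.trans q s = p.trans q t) (hst : s < t) :
    ∃ s' t' : I, (s' : ℝ) = 2 * s ∧ (t' : ℝ) = 2 * t - 1 ∧ p s' = q t' := by
  have hst' : (s : ℝ) < t := hst
  rw [Path.trans_apply, Path.trans_apply] at h
  split_ifs at h with h1 h2 h2
  · have := congrArg Subtype.val (hp h)
    dsimp only at this
    linarith
  · exact ⟨_, _, rfl, rfl, h⟩
  · linarith
  · have := congrArg Subtype.val (hq h)
    dsimp only at this
    linarith

theorem trans_injective {p : Path a b} {q : Path b c} (hp : Function.Injective p)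
    (hq : Function.Injective q) (hpq : range p ∩ range q ⊆ {b}) :
    Function.Injective (p.trans q) := by
  have key : ∀ s t : I, p.trans q s = p.trans q t → ¬ s < t := fun s t h hst => by
    obtain ⟨s', t', hs, ht, h'⟩ := trans_eq_trans hp hq h hst
    have hb : q t' = b := hpq ⟨⟨s', h'⟩, ⟨t', rfl⟩⟩
    have h1 : s' = 1 := hp (by rw [h', hb, p.target])
    have h2 : t' = 0 := hq (by rw [hb, q.source])
    rw [h1] at hs
    rw [h2] at ht
    have hst' : (s : ℝ) < t := hst
    simp only [Icc.coe_one, Icc.coe_zero] at hs ht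
    linarith
  exact fun s t h => le_antisymm (not_lt.1 (key t s h.symm)) (not_lt.1 (key s t h))

theorem circleExp_im_nonneg {t : ℝ} (h0 : 0 ≤ t) (h1 : t ≤ 1 / 2) :
    0 ≤ (Circle.exp (2 * Real.pi * t) : ℂ).im := by
  rw [Circle.coe_exp, Complex.exp_ofReal_mul_I_im]
  exact Real.sin_nonneg_of_nonneg_of_le_pi (by positivity) (by nlinarith [Real.pi_pos])

theorem circleExp_im_neg {t : ℝ} (h0 : 1 / 2 < t) (h1 : t < 1) :
    (Circle.exp (2 * Real.pi * t) : ℂ).im < 0 := by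
  rw [Circle.coe_exp, Complex.exp_ofReal_mul_I_im, ← Real.sin_sub_two_pi]
  exact Real.sin_neg_of_neg_of_neg_pi_lt (by nlinarith [Real.pi_pos]) (by nlinarith [Real.pi_pos])

theorem circleExp_im_nonpos {t : ℝ} (h0 : 1 / 2 < t) (h1 : t ≤ 1) :
    (Circle.exp (2 * Real.pi * t) : ℂ).im ≤ 0 := by
  rcases h1.lt_or_eq with h | rfl
  · exact (circleExp_im_neg h0 h).le
  · simp

/-- Three arcs forming a triangle, as a Jordan curve with a controlled parametrization. -/
theorem exists_circle_of_triangle {p : Path a b} {q : Path b c} {r : Path c a}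
    (hp : Function.Injective p) (hq : Function.Injective q) (hr : Function.Injective r)
    (hpq : range p ∩ range q ⊆ {b}) (hqr : range q ∩ range r ⊆ {c})
    (hpr : range p ∩ range r ⊆ {a}) :
    ∃ γ : Circle → X, Continuous γ ∧ Function.Injective γ ∧ γ 1 = a ∧
      γ (Circle.exp (2 * Real.pi * (1 / 2))) = b ∧ γ (Circle.exp (2 * Real.pi * (3 / 4))) = c ∧
      range γ = range p ∪ range q ∪ range r ∧
      γ '' {z | 0 ≤ (z : ℂ).im} = range p ∧ range r ⊆ γ '' {z | (z : ℂ).im ≤ 0} ∧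
      ∀ᶠ z : Circle in 𝓝 1, (z : ℂ).im ≤ 0 → γ z ∈ range r := by
  have hqri := trans_injective hq hr hqr
  obtain ⟨γ, hγ, hi, hl⟩ := exists_circle_of_loop (p.trans (q.trans r)) fun s t h hst => by
    obtain ⟨s', t', hs, ht, h'⟩ := trans_eq_trans hp hqri h hst
    have hst' : (s : ℝ) < t := hst
    have hmem : (q.trans r) t' ∈ range q ∪ range r := by
      rw [← Path.trans_range]
      exact mem_range_self t'
    rcases hmem with hm | hm
    · exfalso
      have hb : (q.trans r) t' = b := hpq ⟨⟨s', h'⟩, hm⟩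
      have h1 : s' = 1 := hp (by rw [h', hb, p.target])
      have h2 : t' = 0 := hqri (by rw [hb, Path.source])
      rw [h1] at hs
      rw [h2] at ht
      simp only [Icc.coe_one, Icc.coe_zero] at hs ht
      linarith
    · have ha : (q.trans r) t' = a := hpr ⟨⟨s', h'⟩, hm⟩
      have h1 : s' = 0 := hp (by rw [h', ha, p.source])
      have h2 : t' = 1 := hqri (by rw [ha, Path.target])
      rw [h1] at hs
      rw [h2] at ht
      simp only [Icc.coe_one, Icc.coe_zero] at hs ht
      exact ⟨Subtype.ext (by rw [Icc.coe_zero]; linarith),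
        Subtype.ext (by rw [Icc.coe_one]; linarith)⟩
  have hlow : ∀ t : ℝ, 0 ≤ t → t ≤ 1 / 2 → γ (Circle.exp (2 * Real.pi * t)) ∈ range p :=
    fun t h0 h1 => by
      have := hl ⟨t, h0, by linarith⟩
      rw [Path.trans_apply, dif_pos h1] at this
      exact ⟨_, this.symm⟩
  have hhigh : ∀ t : ℝ, 3 / 4 < t → t ≤ 1 → γ (Circle.exp (2 * Real.pi * t)) ∈ range r :=
    fun t h0 h1 => by
      have := hl ⟨t, by linarith, h1⟩
      rw [Path.trans_apply, dif_neg (by simp; linarith), Path.trans_apply,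
        dif_neg (by simp; linarith)] at this
      exact ⟨_, this.symm⟩
  have hpγ : ∀ s : I, p s = γ (Circle.exp (2 * Real.pi * (s / 2))) := fun s => by
    have h1 : (s : ℝ) / 2 ≤ 1 / 2 := by linarith [s.2.2]
    have := hl ⟨s / 2, by linarith [s.2.1], by linarith⟩
    rw [Path.trans_apply, dif_pos h1] at this
    rw [this]
    congr 1
    exact Subtype.ext (by simp; ring)
  have hrγ : ∀ s : I, 0 < s → r s = γ (Circle.exp (2 * Real.pi * ((s + 3) / 4))) := fun s hs => by
    have hs' : 0 < (s : ℝ) := hs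
    have := hl ⟨(s + 3) / 4, by linarith [s.2.1], by linarith [s.2.2]⟩
    rw [Path.trans_apply, dif_neg (by simp; linarith), Path.trans_apply,
      dif_neg (by simp; linarith)] at this
    rw [this]
    congr 1
    exact Subtype.ext (by simp; ring)
  have hb : γ (Circle.exp (2 * Real.pi * (1 / 2))) = b := by
    have := hpγ 1
    rw [p.target] at this
    simpa using this.symm
  have hc : γ (Circle.exp (2 * Real.pi * (3 / 4))) = c := by
    have := hl ⟨3 / 4, by norm_num, by norm_num⟩
    rw [Path.trans_apply, dif_neg (by norm_num), Path.trans_apply,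
      dif_pos (by norm_num)] at this
    refine this.trans (Eq.trans (congrArg q ?_) q.target)
    exact Subtype.ext (by norm_num)
  have ha : γ 1 = a := by
    have := hl 0
    rw [Path.source] at this
    simpa using this
  refine ⟨γ, hγ, hi, ha, hb, hc, ?_, ?_, ?_, ?_⟩
  · rw [union_assoc, ← Path.trans_range, ← Path.trans_range]
    refine Subset.antisymm ?_ ?_
    · rintro _ ⟨z, rfl⟩
      obtain ⟨t, ht, rfl⟩ := exists_circleExp 0 z
      rw [zero_add] at ht
      exact ⟨⟨t, ht.1, ht.2.le⟩, (hl _).symm⟩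
    · rintro _ ⟨t, rfl⟩
      exact ⟨_, hl t⟩
  · refine Subset.antisymm ?_ ?_
    · rintro _ ⟨z, hz, rfl⟩
      obtain ⟨t, ht, rfl⟩ := exists_circleExp 0 z
      rw [zero_add] at ht
      refine hlow t ht.1 (not_lt.1 fun h => ?_)
      exact absurd hz (not_le.2 (circleExp_im_neg h ht.2))
    · rintro _ ⟨s, rfl⟩
      exact ⟨_, circleExp_im_nonneg (by linarith [s.2.1]) (by linarith [s.2.2]), (hpγ s).symm⟩
  · rintro _ ⟨s, rfl⟩
    rcases s.2.1.lt_or_eq with h | h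
    · exact ⟨_, circleExp_im_nonpos (by linarith) (by linarith [s.2.2]), (hrγ s h).symm⟩
    · rw [show s = 0 from Subtype.ext h.symm, r.source]
      exact ⟨_, circleExp_im_nonpos (by norm_num) (by norm_num), hc⟩
  · have hnear : ∀ᶠ z : Circle in 𝓝 1, z ∉ (fun t : ℝ => Circle.exp (2 * Real.pi * t)) ''
        Icc (1 / 2) (3 / 4) := by
      refine IsOpen.mem_nhds ((isCompact_Icc.image (by fun_prop)).isClosed.isOpen_compl) ?_
      rintro ⟨t, ht, h⟩
      rw [← show Circle.exp (2 * Real.pi * 0) = 1 by simp] at h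
      obtain ⟨n, hn⟩ := circleExp_eq_iff.1 h
      rw [zero_add] at hn
      rw [hn] at ht
      have h1 : 0 < n := by exact_mod_cast (by linarith [ht.1] : (0 : ℝ) < n)
      have h2 : n < 1 := by exact_mod_cast (by linarith [ht.2] : (n : ℝ) < 1)
      omega
    filter_upwards [hnear] with z hz hz'
    obtain ⟨t, ht, rfl⟩ := exists_circleExp 0 z
    rw [zero_add] at ht
    rcases ht.1.lt_or_eq with h0 | h0
    · refine hhigh t (not_le.1 fun h => ?_) ht.2.le
      rcases le_or_gt (1 / 2) t with h2 | h2
      · exact hz ⟨t, ⟨h2, h⟩, rfl⟩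
      · refine absurd hz' (not_le.2 ?_)
        rw [Circle.coe_exp, Complex.exp_ofReal_mul_I_im]
        exact Real.sin_pos_of_pos_of_lt_pi (by positivity) (by nlinarith [Real.pi_pos])
    · rw [← h0]
      refine ⟨1, ?_⟩
      rw [r.target]
      simpa using ha.symm

end Loops

namespace SphereDrawing
open Filter Topology

variable {n : ℕ} {D D1 D2 : SphereDrawing n} {a b c x : Fin n}

theorem arc_eq (D : SphereDrawing n) {i j : Fin n} (h : i ≠ j) :
    D.arc i j = range (D.edge i j h) := by
  simp [arc, h]

theorem arc_comm (D : SphereDrawing n) (i j : Fin n) : D.arc i j = D.arc j i := by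
  by_cases h : i = j
  · rw [h]
  · rw [arc_eq D h, arc_eq D (Ne.symm h), D.edge_symm i j h, Path.symm_range]

theorem isClosed_arc (D : SphereDrawing n) {i j : Fin n} (h : i ≠ j) : IsClosed (D.arc i j) := by
  rw [arc_eq D h]
  exact (isCompact_range (D.edge i j h).continuous).isClosed

theorem left_mem_arc (D : SphereDrawing n) {i j : Fin n} (h : i ≠ j) : D.vert i ∈ D.arc i j := by
  rw [arc_eq D h]
  exact ⟨0, Path.source _⟩

theorem eq_or_eq_of_vert_mem_arc {i j k : Fin n} (hk : D.vert k ∈ D.arc i j) : k = i ∨ k = j := by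
  by_cases h : i = j
  · simp [arc, h] at hk
  · rw [arc_eq D h] at hk
    have h' : D.vert k ∈ range (D.edge i j h) ∩ range D.vert := ⟨hk, k, rfl⟩
    rw [D.edge_vert] at h'
    exact h'.imp (fun e => D.vert_inj e) fun e => D.vert_inj e

theorem IsGood.arc_inter_arc_subset (hD : D.IsGood) (hbc : b ≠ c) :
    D.arc a b ∩ D.arc a c ⊆ {D.vert a} := by
  rintro y ⟨hb, hc⟩
  by_cases hy : y ∈ range D.vert
  · obtain ⟨k, rfl⟩ := hy
    rcases eq_or_eq_of_vert_mem_arc hb with rfl | rfl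
    · rfl
    · rcases eq_or_eq_of_vert_mem_arc hc with rfl | rfl
      · rfl
      · exact absurd rfl hbc
  · have := hD.adj a b c hbc
    exact absurd (show y ∈ D.inner a b ∩ D.inner a c from ⟨⟨hb, hy⟩, hc, hy⟩)
      (by rw [this]; exact notMem_empty y)

theorem tri_swap (D : SphereDrawing n) (a b c : Fin n) : D.tri b a c = D.tri a b c := by
  simp only [tri, D.arc_comm b a]
  rw [union_right_comm]

theorem tri_rotate (D : SphereDrawing n) (a b c : Fin n) : D.tri c a b = D.tri a b c := by
  simp only [tri, D.arc_comm c a, D.arc_comm c b]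
  rw [union_comm (D.arc a c), union_right_comm]

theorem vert_notMem_tri (D : SphereDrawing n) (hxa : x ≠ a) (hxb : x ≠ b) (hxc : x ≠ c) :
    D.vert x ∉ D.tri a b c := by
  rintro ((h | h) | h) <;> rcases eq_or_eq_of_vert_mem_arc h with h | h <;> contradiction

theorem IsGood.exists_tri_curve (hD : D.IsGood) (hab : a ≠ b) (hac : a ≠ c) (hbc : b ≠ c) :
    ∃ γ : Circle → Sph, Continuous γ ∧ Function.Injective γ ∧ γ 1 = D.vert a ∧
      γ (Circle.exp (2 * Real.pi * (1 / 2))) = D.vert b ∧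
      γ (Circle.exp (2 * Real.pi * (3 / 4))) = D.vert c ∧ range γ = D.tri a b c ∧
      γ '' {z | 0 ≤ (z : ℂ).im} = D.arc a b ∧ D.arc a c ⊆ γ '' {z | (z : ℂ).im ≤ 0} ∧
      ∀ᶠ z : Circle in 𝓝 1, (z : ℂ).im ≤ 0 → γ z ∈ D.arc a c := by
  have h := exists_circle_of_triangle (D.edge_inj a b hab) (D.edge_inj b c hbc)
    (D.edge_inj c a hac.symm)
  simp only [← arc_eq] at h
  rw [D.arc_comm c a] at h
  refine h ?_ ?_ (hD.arc_inter_arc_subset hbc)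
  · rw [D.arc_comm a b]
    exact hD.arc_inter_arc_subset hac
  · rw [D.arc_comm b c, D.arc_comm a c]
    exact hD.arc_inter_arc_subset hab.symm

theorem IsGood.tri_subset_closure (hD : D.IsGood) (hab : a ≠ b) (hac : a ≠ c) (hbc : b ≠ c)
    (hxa : x ≠ a) (hxb : x ≠ b) (hxc : x ≠ c) :
    D.tri a b c ⊆ closure (connectedComponentIn (D.tri a b c)ᶜ (D.vert x)) := by
  obtain ⟨γ, hγ, hi, -, -, -, hr, -⟩ := hD.exists_tri_curve hab hac hbc
  rw [← hr]
  refine range_subset_closure_component_sphere hγ hi ?_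
  rw [hr]
  exact D.vert_notMem_tri hxa hxb hxc

theorem eventually_mem_of_entersInit {i j : Fin n} (hij : i ≠ j) {Δ : Set Sph}
    (h : EntersInit D i j hij Δ) :
    ∀ᶠ y in 𝓝 (D.vert i), y ∈ D.arc i j → y ≠ D.vert i → y ∈ Δ := by
  obtain ⟨ε, hε, h⟩ := h
  have hK : IsCompact {t : I | ε ≤ t} := (isClosed_le continuous_const (by fun_prop)).isCompact
  have hmem : D.vert i ∉ D.edge i j hij '' {t : I | ε ≤ t} := by
    rintro ⟨t, ht, he⟩
    have h0 : t = 0 := D.edge_inj i j hij (he.trans (Path.source _).symm)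
    rw [h0] at ht
    exact absurd ht (not_le.2 (by simpa using hε))
  filter_upwards [(hK.image (D.edge i j hij).continuous).isClosed.isOpen_compl.mem_nhds hmem]
    with y hy hya hyi
  rw [arc_eq D hij] at hya
  obtain ⟨t, rfl⟩ := hya
  refine h t (t.2.1.lt_of_ne fun h0 => hyi ?_) (not_le.1 fun h0 => hy ⟨t, h0, rfl⟩)
  rw [show t = 0 from Subtype.ext h0.symm, Path.source]

/-- Equal rotations at `a` and edges `ax` entering the sides containing `x` determine an
orientation preserving homeomorphism matching the triangles and the sides. -/
theorem exists_homeo_of_entersInit (h1 : D1.IsGood) (h2 : D2.IsGood)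
    (hrot : SameRotationAt D1 D2 a) (hab : a ≠ b) (hac : a ≠ c) (hbc : b ≠ c)
    (hax : a ≠ x) (hbx : b ≠ x) (hcx : c ≠ x)
    (he1 : EntersInit D1 a x hax (connectedComponentIn (D1.tri a b c)ᶜ (D1.vert x)))
    (he2 : EntersInit D2 a x hax (connectedComponentIn (D2.tri a b c)ᶜ (D2.vert x))) :
    ∃ h : Sph ≃ₜ Sph, OrientPres h ∧
      h (D1.vert a) = D2.vert a ∧ h (D1.vert b) = D2.vert b ∧
      h (D1.vert c) = D2.vert c ∧ h (D1.vert x) = D2.vert x ∧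
      h '' (D1.tri a b c) = D2.tri a b c ∧
      h '' (connectedComponentIn (D1.tri a b c)ᶜ (D1.vert x)) =
        connectedComponentIn (D2.tri a b c)ᶜ (D2.vert x) := by
  obtain ⟨h, ho, hv, U, hU, hh⟩ := hrot
  obtain ⟨γ₁, hγ₁, hi₁, ha₁, hb₁, hc₁, hr₁, hab₁, -, hac₁⟩ := h1.exists_tri_curve hab hac hbc
  obtain ⟨γ₂, hγ₂, hi₂, ha₂, hb₂, hc₂, hr₂, hab₂, hac₂, -⟩ := h2.exists_tri_curve hab hac hbc
  have hx₁ := D1.vert_notMem_tri hax.symm hbx.symm hcx.symm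
  have hx₂ := D2.vert_notMem_tri hax.symm hbx.symm hcx.symm
  rw [← hr₁] at hx₁ he1 ⊢
  rw [← hr₂] at hx₂ he2 ⊢
  have hUγ : ∀ᶠ z in 𝓝 (1 : Circle), γ₁ z ∈ U := hγ₁.continuousAt.eventually (by rwa [ha₁])
  have key : ∃ H : Sph ≃ₜ Sph, OrientPres H ∧ (∀ z, H (γ₁ z) = γ₂ z) ∧
      H (D1.vert x) = D2.vert x ∧ H '' connectedComponentIn (range γ₁)ᶜ (D1.vert x) =
        connectedComponentIn (range γ₂)ᶜ (D2.vert x) := by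
    refine exists_orientPres_of_germ hγ₁ hi₁ hγ₂ hi₂ hx₁ hx₂ ho (by rw [ha₁, ha₂, hv]) ?_ ?_ ?_
    · filter_upwards [hUγ] with z hz hz'
      rw [hab₂]
      refine hh b hab.symm ⟨_, ⟨?_, hz⟩, rfl⟩
      rw [← hab₁]
      exact mem_image_of_mem _ hz'
    · filter_upwards [hUγ, hac₁] with z hz hz' hz''
      exact hac₂ (hh c hac.symm ⟨_, ⟨hz' hz'', hz⟩, rfl⟩)
    · have hne : (𝓝[>] (0 : I)).NeBot := nhdsGT_neBot_of_exists_gt ⟨1, by simp⟩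
      have ht0 : Tendsto (D1.edge a x hax) (𝓝[>] 0) (𝓝 (D1.vert a)) := by
        have := (D1.edge a x hax).continuous.tendsto 0
        rw [Path.source] at this
        exact this.mono_left nhdsWithin_le_nhds
      have hev : ∀ᶠ y in 𝓝 (D1.vert a), h y ∈ D2.arc a x → h y ≠ D2.vert a →
          h y ∈ connectedComponentIn (range γ₂)ᶜ (D2.vert x) := by
        have hth := h.continuous.tendsto (D1.vert a)
        rw [hv] at hth
        exact hth.eventually (eventually_mem_of_entersInit hax he2)
      rw [ha₁]
      refine ht0.frequently (Eventually.frequently ?_)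
      obtain ⟨ε, hε, he1⟩ := he1
      have hlt : ∀ᶠ t : I in 𝓝[>] 0, (t : ℝ) < ε := nhdsWithin_le_nhds <|
        continuous_subtype_val.continuousAt.eventually_lt_const (by simpa using hε)
      filter_upwards [ht0.eventually hev, ht0.eventually hU, hlt, self_mem_nhdsWithin]
        with t h3 h4 h5 h6
      refine ⟨he1 t h6 h5, h3 (hh x hax.symm ⟨_, ⟨?_, h4⟩, rfl⟩) fun h7 => ?_⟩
      · rw [arc_eq D1 hax]
        exact mem_range_self t
      · rw [← hv, h.injective.eq_iff] at h7
        exact (ne_of_gt h6) (D1.edge_inj a x hax (h7.trans (Path.source _).symm))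
  obtain ⟨H, hH, hγ, hx, hC⟩ := key
  refine ⟨H, hH, ?_, ?_, ?_, hx, ?_, hC⟩
  · rw [← ha₁, ← ha₂, hγ]
  · rw [← hb₁, ← hb₂, hγ]
  · rw [← hc₁, ← hc₂, hγ]
  · rw [← range_comp]
    exact congrArg range (funext hγ)

end SphereDrawing

namespace SphereDrawing
open Filter Topology

variable {n : ℕ} {D : SphereDrawing n} {u v w x : Fin n}

theorem IsGood.mem_inner_of_mem_tri (hD : D.IsGood) (huv : u ≠ v) (huw : u ≠ w)
    (hux : u ≠ x) (hvx : v ≠ x) (hwx : w ≠ x) {y : Sph} (hy : y ∈ D.arc u x)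
    (hyu : y ≠ D.vert u) (ht : y ∈ D.tri u v w) : y ∈ D.inner u x ∩ D.inner v w := by
  rcases ht with (h | h) | h
  · exact absurd (hD.arc_inter_arc_subset hvx ⟨h, hy⟩) hyu
  · have hyv : y ∉ range D.vert := by
      rintro ⟨k, rfl⟩
      rcases eq_or_eq_of_vert_mem_arc hy with rfl | rfl <;>
        rcases eq_or_eq_of_vert_mem_arc h with rfl | rfl <;> contradiction
    exact ⟨⟨hy, hyv⟩, h, hyv⟩
  · exact absurd (hD.arc_inter_arc_subset hwx ⟨h, hy⟩) hyu

/-- An edge `ux` not entering the side of the triangle containing `x` stays off that side until it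
crosses the opposite edge. -/
theorem IsGood.exists_crossing (hD : D.IsGood) (huv : u ≠ v) (huw : u ≠ w) (hvw : v ≠ w)
    (hux : u ≠ x) (hvx : v ≠ x) (hwx : w ≠ x)
    (hE : ¬ EntersInit D u x hux (connectedComponentIn (D.tri u v w)ᶜ (D.vert x))) :
    ∃ s : I, 0 < s ∧ D.edge u x hux s ∈ D.inner v w ∧
      (∀ t, 0 < t → t < s → D.edge u x hux t ∉ D.tri u v w) ∧
      ∀ t ≤ s, D.edge u x hux t ∉ connectedComponentIn (D.tri u v w)ᶜ (D.vert x) := by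
  set e := D.edge u x hux with he
  set C := connectedComponentIn (D.tri u v w)ᶜ (D.vert x) with hC
  have hx : D.vert x ∈ (D.tri u v w)ᶜ := D.vert_notMem_tri hux.symm hvx.symm hwx.symm
  have hmem : ∀ t, e t ∈ D.arc u x := fun t => by
    rw [arc_eq D hux]
    exact mem_range_self t
  have hne : ∀ t : I, 0 < t → e t ≠ D.vert u := fun t ht h =>
    ht.ne' (D.edge_inj u x hux (h.trans (Path.source _).symm))
  have hin : ∀ t : I, 0 < t → e t ∈ D.tri u v w → e t ∈ D.inner u x ∩ D.inner v w :=
    fun t ht h => hD.mem_inner_of_mem_tri huv huw hux hvx hwx (hmem t) (hne t ht) h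
  have hsub := hD.indep u x v w (by
    simp only [List.nodup_cons, List.mem_cons, List.not_mem_nil, or_false, not_or]
    exact ⟨⟨hux, huv, huw⟩, ⟨hvx.symm, hwx.symm⟩, hvw, not_false, List.nodup_nil⟩)
  have hCsub : ∀ {y : Sph}, y ∈ C → y ∉ D.tri u v w := fun h => connectedComponentIn_subset _ _ h
  obtain ⟨s, hs0, hs⟩ : ∃ s : I, 0 < s ∧ e s ∈ D.tri u v w := by
    by_contra! hcon
    refine hE ⟨1, one_pos, fun t ht _ => ?_⟩
    have h1 : IsPreconnected (e '' Ioc 0 1) := isPreconnected_Ioc.image _ e.continuous.continuousOn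
    refine h1.subset_connectedComponentIn ⟨1, ⟨zero_lt_one, le_rfl⟩, e.target⟩ ?_
      ⟨t, ⟨ht, t.2.2⟩, rfl⟩
    rintro _ ⟨r, hr, rfl⟩
    exact hcon r hr.1
  have hlt : ∀ t, 0 < t → t < s → e t ∉ D.tri u v w := fun t ht hts h =>
    hts.ne (D.edge_inj u x hux (hsub (hin t ht h) (hin s hs0 hs)))
  refine ⟨s, hs0, (hin s hs0 hs).2, hlt, fun t hts ht => ?_⟩
  rcases hts.lt_or_eq with hts | rfl
  · rcases (show 0 ≤ t from t.2.1).lt_or_eq with ht0 | rfl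
    · refine hE ⟨s, hs0, fun r hr hrs => ?_⟩
      have h1 : IsPreconnected (e '' Ioo 0 s) :=
        isPreconnected_Ioo.image _ e.continuous.continuousOn
      rw [hC, connectedComponentIn_eq ht]
      refine h1.subset_connectedComponentIn ⟨t, ⟨ht0, hts⟩, rfl⟩ ?_ ⟨r, ⟨hr, hrs⟩, rfl⟩
      rintro _ ⟨r, hr, rfl⟩
      exact hlt r hr.1 hr.2
    · refine hCsub ht ?_
      rw [he, Path.source]
      exact Or.inl (Or.inl (left_mem_arc D huv))
  · exact hCsub ht hs

/-- Of two edges from the triangle to `x`, at least one enters the side containing `x`. -/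
theorem IsGood.entersInit_or (hD : D.IsGood) (huv : u ≠ v) (huw : u ≠ w) (hvw : v ≠ w)
    (hux : u ≠ x) (hvx : v ≠ x) (hwx : w ≠ x) :
    EntersInit D u x hux (connectedComponentIn (D.tri u v w)ᶜ (D.vert x)) ∨
      EntersInit D v x hvx (connectedComponentIn (D.tri u v w)ᶜ (D.vert x)) := by
  by_contra! hcon
  obtain ⟨s, hs0, hs, hst, hsC⟩ := hD.exists_crossing huv huw hvw hux hvx hwx hcon.1
  have hcon2 := hcon.2
  rw [← D.tri_swap] at hcon2
  obtain ⟨s', hs0', hs', hst', hsC'⟩ :=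
    hD.exists_crossing huv.symm hvw huw hvx hux hwx hcon2
  rw [D.tri_swap] at hst' hsC'
  set e := D.edge u x hux with he
  set f := D.edge v x hvx with hf
  set C := connectedComponentIn (D.tri u v w)ᶜ (D.vert x) with hC
  have hx : D.vert x ∈ (D.tri u v w)ᶜ := D.vert_notMem_tri hux.symm hvx.symm hwx.symm
  have hxC : D.vert x ∈ C := mem_connectedComponentIn hx
  have hCt : ∀ y ∈ C, y ∉ D.tri u v w := fun y hy => connectedComponentIn_subset _ _ hy
  have hcl : D.tri u v w ⊆ closure C :=
    hD.tri_subset_closure huv huw hvw hux.symm hvx.symm hwx.symm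
  have hCpre : IsPreconnected C := isPreconnected_connectedComponentIn
  have heu : ∀ t, e t ∈ D.arc u x := fun t => by
    rw [arc_eq D hux]
    exact mem_range_self t
  have hfv : ∀ t, f t ∈ D.arc v x := fun t => by
    rw [arc_eq D hvx]
    exact mem_range_self t
  -- the part of `ux` before the crossing
  let P := e '' Icc 0 s
  have hP : IsPreconnected P := isPreconnected_Icc.image _ e.continuous.continuousOn
  have hPcl : IsClosed P := (isCompact_Icc.image e.continuous).isClosed
  have hPC : ∀ y ∈ C, y ∉ P := by
    rintro _ hy ⟨t, ht, rfl⟩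
    exact hsC t ht.2 hy
  have hPu : P ⊆ D.arc u x := by
    rintro _ ⟨t, -, rfl⟩
    exact heu t
  have huP : D.vert u ∈ P := ⟨0, ⟨le_rfl, hs0.le⟩, e.source⟩
  have hfP : ∀ t ≤ s', f t ∉ P := fun t ht h => by
    have h1 : f t ∈ D.arc x u ∩ D.arc x v := by
      rw [D.arc_comm x u, D.arc_comm x v]
      exact ⟨hPu h, hfv t⟩
    have h2 : f t = D.vert x := hD.arc_inter_arc_subset huv h1
    exact hsC' t ht (h2.symm ▸ hxC)
  -- the two parts of the opposite edge
  set g := D.edge v w hvw with hg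
  have hgs : e s ∈ range g := by
    rw [← arc_eq D hvw]
    exact hs.1
  obtain ⟨r, hr⟩ := hgs
  have hgv : ∀ t, g t ∈ D.arc v w := fun t => by
    rw [arc_eq D hvw]
    exact mem_range_self t
  have hr0 : 0 < r := by
    refine (show 0 ≤ r from r.2.1).lt_of_ne ?_
    rintro rfl
    rw [hg, Path.source] at hr
    exact hs.2 ⟨v, hr⟩
  have hr1 : r < 1 := by
    refine (show r ≤ 1 from r.2.2).lt_of_ne ?_
    rintro rfl
    rw [hg, Path.target] at hr
    exact hs.2 ⟨w, hr⟩
  have hgP : g r ∈ P := hr ▸ ⟨s, ⟨hs0.le, le_rfl⟩, rfl⟩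
  let A := P ∪ (g '' Icc 0 r ∪ D.arc u v)
  let B := P ∪ (g '' Icc r 1 ∪ D.arc u w)
  have hA : IsClosed A :=
    hPcl.union ((isCompact_Icc.image g.continuous).isClosed.union (D.isClosed_arc huv))
  have hB : IsClosed B :=
    hPcl.union ((isCompact_Icc.image g.continuous).isClosed.union (D.isClosed_arc huw))
  have hgsub : ∀ a b : I, g '' Icc a b ⊆ D.arc v w := by
    rintro a b _ ⟨t, -, rfl⟩
    exact hgv t
  have hgu : ∀ t, g t ∈ D.arc u v → t = 0 := fun t ht => by
    rw [D.arc_comm] at ht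
    exact D.edge_inj v w hvw
      ((hD.arc_inter_arc_subset huw ⟨ht, hgv t⟩ : g t = D.vert v).trans (Path.source _).symm)
  have hgw : ∀ t, g t ∈ D.arc u w → t = 1 := fun t ht => by
    have h1 : g t ∈ D.arc w u ∩ D.arc w v := by
      rw [D.arc_comm w u, D.arc_comm w v]
      exact ⟨ht, hgv t⟩
    exact D.edge_inj v w hvw
      ((hD.arc_inter_arc_subset huv h1 : g t = D.vert w).trans (Path.target _).symm)
  have hAB : A ∩ B = P := by
    refine Subset.antisymm ?_ fun y hy => ⟨Or.inl hy, Or.inl hy⟩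
    rintro y ⟨hy | hy, hy' | hy'⟩
    · exact hy
    · exact hy
    · exact hy'
    · rcases hy with ⟨t, ht, rfl⟩ | hy <;> rcases hy' with ⟨t', ht', h'⟩ | hy'
      · have : t' = t := D.edge_inj v w hvw h'
        rw [this] at ht'
        rw [le_antisymm ht.2 ht'.1]
        exact hgP
      · exact absurd (hgw t hy') (ht.2.trans_lt hr1).ne
      · rw [← h'] at hy
        exact absurd (hgu t' hy) (hr0.trans_le ht'.1).ne'
      · rw [hD.arc_inter_arc_subset hvw ⟨hy, hy'⟩]
        exact huP
  have htri : D.tri u v w ⊆ A ∪ B := by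
    rintro y ((hy | hy) | hy)
    · exact Or.inl (Or.inr (Or.inr hy))
    · rw [arc_eq D hvw] at hy
      obtain ⟨t, rfl⟩ := hy
      rcases le_total t r with h | h
      · exact Or.inl (Or.inr (Or.inl ⟨t, ⟨t.2.1, h⟩, rfl⟩))
      · exact Or.inr (Or.inr (Or.inl ⟨t, ⟨h, t.2.2⟩, rfl⟩))
    · exact Or.inr (Or.inr (Or.inr hy))
  have hAsub : A ⊆ P ∪ D.tri u v w := union_subset_union_right _ <| union_subset
    ((hgsub _ _).trans fun y hy => Or.inl (Or.inr hy)) fun y hy => Or.inl (Or.inl hy)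
  have hBsub : B ⊆ P ∪ D.tri u v w := union_subset_union_right _ <| union_subset
    ((hgsub _ _).trans fun y hy => Or.inl (Or.inr hy)) fun y hy => Or.inr hy
  have hout : ∀ y, y ∉ P → y ∉ D.tri u v w → y ∉ A ∧ y ∉ B := fun y h1 h2 =>
    ⟨fun h => (hAsub h).elim h1 h2, fun h => (hBsub h).elim h1 h2⟩
  -- reaching the early part of `vx` from `x` through a boundary point
  have hreach : ∀ (K : Set Sph) (S : Set I) (t₀ t : I), IsPreconnected S → t₀ ∈ S → t ∈ S →
      (∀ y ∈ C, y ∉ K) → (∀ t ∈ S, f t ∉ K) → f t₀ ∈ D.tri u v w →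
      f t ∈ connectedComponentIn Kᶜ (D.vert x) := by
    intro K S t₀ t hS ht₀ ht hCK hSK h0
    have h1 : IsPreconnected (insert (f t₀) C) := hCpre.subset_closure (subset_insert _ _)
      (insert_subset (hcl h0) subset_closure)
    have h2 : IsPreconnected (insert (f t₀) C ∪ f '' S) :=
      h1.union (f t₀) (mem_insert _ _) ⟨t₀, ht₀, rfl⟩ (hS.image _ f.continuous.continuousOn)
    refine h2.subset_connectedComponentIn (Or.inl (Or.inr hxC)) ?_ (Or.inr ⟨t, ht, rfl⟩)
    rintro y ((rfl | hy) | ⟨t, ht, rfl⟩)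
    · exact hSK t₀ ht₀
    · exact hCK y hy
    · exact hSK t ht
  obtain ⟨t, ht0, hts⟩ := exists_between hs0'
  have hq : f s' ∈ D.arc u w := hs'.1
  have hqv : ∀ k, f s' ≠ D.vert k := fun k h => hs'.2 ⟨k, h.symm⟩
  have hz : f t ∉ P ∧ f t ∉ D.tri u v w := ⟨hfP t hts.le, hst' t ht0 hts⟩
  have hzA : f t ∈ connectedComponentIn Aᶜ (D.vert x) := by
    refine hreach A (Ioc 0 s') s' t isPreconnected_Ioc ⟨hs0', le_rfl⟩ ⟨ht0, hts.le⟩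
      (fun y hy => (hout y (hPC y hy) (hCt y hy)).1) (fun τ hτ => ?_) (Or.inr hq)
    rcases hτ.2.lt_or_eq with h | rfl
    · exact (hout _ (hfP τ hτ.2) (hst' τ hτ.1 h)).1
    · rintro (h | ⟨t', ht', h⟩ | h)
      · exact hfP _ le_rfl h
      · rw [← h] at hq
        exact (ht'.2.trans_lt hr1).ne (hgw t' hq)
      · exact hqv u (hD.arc_inter_arc_subset hvw ⟨h, hq⟩)
  have hzB : f t ∈ connectedComponentIn Bᶜ (D.vert x) := by
    refine hreach B (Ico 0 s') 0 t isPreconnected_Ico ⟨le_rfl, hs0'⟩ ⟨ht0.le, hts⟩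
      (fun y hy => (hout y (hPC y hy) (hCt y hy)).2) (fun τ hτ => ?_) ?_
    · rcases hτ.1.lt_or_eq with h | rfl
      · exact (hout _ (hfP τ hτ.2.le) (hst' τ h hτ.2)).2
      · rintro (h | ⟨t', ht', h⟩ | h)
        · exact hfP _ hs0'.le h
        · have : t' = 0 := D.edge_inj v w hvw (h.trans (f.source.trans (Path.source _).symm))
          exact (hr0.trans_le ht'.1).ne' this
        · rw [f.source] at h
          rcases eq_or_eq_of_vert_mem_arc h with h | h
          · exact huv h.symm
          · exact hvw h
    · rw [f.source]
      exact Or.inl (Or.inr (left_mem_arc D hvw))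
  have hxAB : D.vert x ∈ (A ∪ B)ᶜ := fun h => h.elim
    (hout _ (hPC _ hxC) (hCt _ hxC)).1 (hout _ (hPC _ hxC) (hCt _ hxC)).2
  have hzAB : f t ∈ (A ∪ B)ᶜ := fun h => h.elim (hout _ hz.1 hz.2).1 (hout _ hz.1 hz.2).2
  have hfin := mem_component_union_sphere hA hB (hAB ▸ hP) hxAB hzAB hzA hzB
  exact hsC' t hts.le (connectedComponentIn_mono _ (compl_subset_compl.2 htri) hfin)

end SphereDrawing

section Majority

variable {n : ℕ} {D : SphereDrawing n} {u v w x : Fin n}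

/-- Of the three edges from a triangle to `x`, at least two enter the side containing `x`. -/
theorem SphereDrawing.IsGood.entersInit_majority (hD : D.IsGood) (huv : u ≠ v) (huw : u ≠ w)
    (hvw : v ≠ w) (hux : u ≠ x) (hvx : v ≠ x) (hwx : w ≠ x) :
    (EntersInit D u x hux (connectedComponentIn (D.tri u v w)ᶜ (D.vert x)) ∧
      EntersInit D v x hvx (connectedComponentIn (D.tri u v w)ᶜ (D.vert x))) ∨
    (EntersInit D u x hux (connectedComponentIn (D.tri u v w)ᶜ (D.vert x)) ∧
      EntersInit D w x hwx (connectedComponentIn (D.tri u v w)ᶜ (D.vert x))) ∨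
    (EntersInit D v x hvx (connectedComponentIn (D.tri u v w)ᶜ (D.vert x)) ∧
      EntersInit D w x hwx (connectedComponentIn (D.tri u v w)ᶜ (D.vert x))) := by
  have hmaj : ∀ {p q r : Prop}, p ∨ q → p ∨ r → q ∨ r → (p ∧ q) ∨ (p ∧ r) ∨ (q ∧ r) := by tauto
  refine hmaj (hD.entersInit_or huv huw hvw hux hvx hwx) ?_ ?_
  · have h := hD.entersInit_or huw.symm hvw.symm huv hwx hux hvx
    rw [D.tri_rotate] at h
    exact h.symm
  · have h := hD.entersInit_or hvw huv.symm huw.symm hvx hwx hux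
    rw [← D.tri_rotate, D.tri_swap, D.tri_swap] at h
    exact h

end Majority

/-- For good drawings `D1`, `D2` of `K_n` with the same rotation scheme and
distinct vertices `u v w x`, the side of the triangle `uvw` containing `x` is the same in
both drawings: in each drawing `x` lies in the side initially entered by a majority of
the edges `ux`, `vx`, `wx`, and there is an orientation-preserving homeomorphism of the
sphere matching the triangles, the four vertices, and the sides containing `x`. -/
theorem side_of_triangle_determined {n : ℕ}
    (D1 D2 : SphereDrawing n) (h1 : D1.IsGood) (h2 : D2.IsGood)
    (hrot : SameRotation D1 D2)
    (u v w x : Fin n) (hnd : ([u, v, w, x] : List (Fin n)).Nodup)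
    (hux : u ≠ x) (hvx : v ≠ x) (hwx : w ≠ x) :
    (∀ (D : SphereDrawing n), D = D1 ∨ D = D2 →
      ((EntersInit D u x hux (connectedComponentIn (D.tri u v w)ᶜ (D.vert x)) ∧
        EntersInit D v x hvx (connectedComponentIn (D.tri u v w)ᶜ (D.vert x))) ∨
       (EntersInit D u x hux (connectedComponentIn (D.tri u v w)ᶜ (D.vert x)) ∧
        EntersInit D w x hwx (connectedComponentIn (D.tri u v w)ᶜ (D.vert x))) ∨
       (EntersInit D v x hvx (connectedComponentIn (D.tri u v w)ᶜ (D.vert x)) ∧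
        EntersInit D w x hwx (connectedComponentIn (D.tri u v w)ᶜ (D.vert x))))) ∧
    ∃ h : Sph ≃ₜ Sph, OrientPres h ∧
      h (D1.vert u) = D2.vert u ∧ h (D1.vert v) = D2.vert v ∧
      h (D1.vert w) = D2.vert w ∧ h (D1.vert x) = D2.vert x ∧
      h '' (D1.tri u v w) = D2.tri u v w ∧
      h '' (connectedComponentIn (D1.tri u v w)ᶜ (D1.vert x)) =
        connectedComponentIn (D2.tri u v w)ᶜ (D2.vert x) := by
  obtain ⟨⟨huv, huw, -⟩, ⟨hvw, -⟩, -⟩ : (u ≠ v ∧ u ≠ w ∧ u ≠ x) ∧ (v ≠ w ∧ v ≠ x) ∧ w ≠ x := by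
    simpa [List.nodup_cons, and_assoc] using hnd
  have hm1 := h1.entersInit_majority huv huw hvw hux hvx hwx
  have hm2 := h2.entersInit_majority huv huw hvw hux hvx hwx
  refine ⟨?_, ?_⟩
  · rintro D (rfl | rfl)
    exacts [hm1, hm2]
  have hcommon : ∀ {p q r p' q' r' : Prop}, (p ∧ q) ∨ (p ∧ r) ∨ (q ∧ r) →
      (p' ∧ q') ∨ (p' ∧ r') ∨ (q' ∧ r') → (p ∧ p') ∨ (q ∧ q') ∨ (r ∧ r') := by tauto
  rcases hcommon hm1 hm2 with ⟨he1, he2⟩ | ⟨he1, he2⟩ | ⟨he1, he2⟩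
  · exact SphereDrawing.exists_homeo_of_entersInit h1 h2 (hrot u) huv huw hvw hux hvx hwx he1 he2
  · rw [← D1.tri_swap] at he1 ⊢
    rw [← D2.tri_swap] at he2 ⊢
    obtain ⟨h, ho, hv, hu, hr⟩ := SphereDrawing.exists_homeo_of_entersInit h1 h2 (hrot v)
      huv.symm hvw huw hvx hux hwx he1 he2
    exact ⟨h, ho, hu, hv, hr⟩
  · rw [← D1.tri_rotate] at he1 ⊢
    rw [← D2.tri_rotate] at he2 ⊢
    obtain ⟨h, ho, hw, hu, hv, hr⟩ := SphereDrawing.exists_homeo_of_entersInit h1 h2 (hrot w)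
      huw.symm hvw.symm huv hwx hux hvx he1 he2
    exact ⟨h, ho, hu, hv, hw, hr⟩
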